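/- Let m,n be positive integers and d = m+n. For any h > 0 and any sequence (μ_k)_{k≥1} of a-invariant Borel probability measures on X_d = SL_d(ℝ)/SL_d(ℤ) with Kolmogorov–Sinai entropy h_{μ_k}(a) ≥ h for every k, any weak* limit μ of the sequence (μ_k) satisfies μ(X_d) ≥ h − (m+n−1). -/

import Mathlib

open MeasureTheory Matrix ENNReal Filter Topology

noncomputable section

/-- The supremum norm of a matrix (the maximum of the absolute values of its entries),
obtained from the sup norm on the corresponding function space. -/
def supNorm {p q : ℕ} (M : Matrix (Fin p) (Fin q) ℝ) : ℝ := ‖(Matrix.of.symm M)‖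

/-- The diagonal element `a_t = diag(e^{t/m} I_m, e^{-t/n} I_n)`. -/
def aMat (m n : ℕ) (t : ℝ) : Matrix (Fin (m + n)) (Fin (m + n)) ℝ :=
  Matrix.reindex finSumFinEquiv finSumFinEquiv
    (Matrix.fromBlocks (Real.exp (t / m) • (1 : Matrix (Fin m) (Fin m) ℝ)) 0 0
      (Real.exp (-(t / n)) • (1 : Matrix (Fin n) (Fin n) ℝ)))

/-- The unipotent element `u_A` with upper-right block `A`. -/
def uMat (m n : ℕ) (A : Fin m → Fin n → ℝ) : Matrix (Fin (m + n)) (Fin (m + n)) ℝ :=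
  Matrix.reindex finSumFinEquiv finSumFinEquiv
    (Matrix.fromBlocks 1 (Matrix.of A) 0 1)

lemma uMat_det (m n : ℕ) (A : Fin m → Fin n → ℝ) : (uMat m n A).det = 1 := by
  simp [uMat, Matrix.det_fromBlocks_zero₂₁]

lemma aMat_det (m n : ℕ) (hm : 0 < m) (hn : 0 < n) (t : ℝ) : (aMat m n t).det = 1 := by
  have hm' : (m : ℝ) ≠ 0 := Nat.cast_ne_zero.mpr hm.ne'
  have hn' : (n : ℝ) ≠ 0 := Nat.cast_ne_zero.mpr hn.ne'
  simp only [aMat, Matrix.det_reindex_self, Matrix.det_fromBlocks_zero₂₁,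
    Matrix.det_smul, Matrix.det_one, Fintype.card_fin, mul_one]
  rw [← Real.exp_nat_mul, ← Real.exp_nat_mul, ← Real.exp_add]
  rw [mul_div_cancel₀ _ hm']
  rw [show (n : ℝ) * -(t / n) = -t by field_simp [mul_comm]]
  simp

/-- `a_t` as an element of `SL_{m+n}(ℝ)`. -/
def aSL (m n : ℕ) (hm : 0 < m) (hn : 0 < n) (t : ℝ) :
    Matrix.SpecialLinearGroup (Fin (m + n)) ℝ :=
  ⟨aMat m n t, aMat_det m n hm hn t⟩

/-- `u_A` as an element of `SL_{m+n}(ℝ)`. -/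
def uSL (m n : ℕ) (A : Fin m → Fin n → ℝ) : Matrix.SpecialLinearGroup (Fin (m + n)) ℝ :=
  ⟨uMat m n A, uMat_det m n A⟩

instance SLtop (d : ℕ) : TopologicalSpace (Matrix.SpecialLinearGroup (Fin d) ℝ) :=
  instTopologicalSpaceSubtype

/-- `SL_d(ℤ)` viewed as a subgroup of `SL_d(ℝ)`. -/
def Gamma (d : ℕ) : Subgroup (Matrix.SpecialLinearGroup (Fin d) ℝ) :=
  (Matrix.SpecialLinearGroup.map (n := Fin d) (Int.castRingHom ℝ)).range

/-- The space of unimodular lattices `X_d = SL_d(ℝ)/SL_d(ℤ)`. -/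
abbrev XSp (d : ℕ) := Matrix.SpecialLinearGroup (Fin d) ℝ ⧸ Gamma d

instance (d : ℕ) : MeasurableSpace (XSp d) := borel _

/-- The first successive minimum `λ₁` of the lattice `g ℤ^d` (with respect to the sup norm):
the infimum of all `r` such that the lattice contains a nonzero vector of norm at most `r`. -/
def lam1M (d : ℕ) (g : Matrix (Fin d) (Fin d) ℝ) : ℝ :=
  sInf {r : ℝ | ∃ v : Fin d → ℤ, v ≠ 0 ∧ ‖g.mulVec (fun i => (v i : ℝ))‖ ≤ r}

/-- The first successive minimum `λ₁` of a unimodular lattice `x ∈ X_d`. -/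
def lam1X (d : ℕ) (x : XSp d) : ℝ :=
  sInf {r : ℝ | ∃ g : Matrix.SpecialLinearGroup (Fin d) ℝ,
    (QuotientGroup.mk g : XSp d) = x ∧
    ∃ v : Fin d → ℤ, v ≠ 0 ∧
      ‖(g : Matrix (Fin d) (Fin d) ℝ).mulVec (fun i => (v i : ℝ))‖ ≤ r}

/-- The lattice `g ℤ^d` as a subset of `ℝ^d`. -/
def latticeSet (d : ℕ) (g : Matrix (Fin d) (Fin d) ℝ) : Set (Fin d → ℝ) :=
  Set.range fun v : Fin d → ℤ => g.mulVec (fun i => (v i : ℝ))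

/-- Shannon entropy of a finite indexed partition with respect to a measure. -/
def partEnt {α : Type*} [MeasurableSpace α] (μ : Measure α) {ι : Type*} [Fintype ι]
    (P : ι → Set α) : ℝ :=
  ∑ i, Real.negMulLog (μ (P i)).toReal

/-- The join `⋁_{j<N} T^{-j} P` of a finite partition, indexed by itineraries. -/
def joinPart {α : Type*} (T : α → α) {k : ℕ} (P : Fin k → Set α) (N : ℕ) :
    (Fin N → Fin k) → Set α :=
  fun ω => ⋂ j : Fin N, T^[(j : ℕ)] ⁻¹' P (ω j)

/-- A finite measurable partition of the space. -/
def IsFinPart {α : Type*} [MeasurableSpace α] {k : ℕ} (P : Fin k → Set α) : Prop :=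
  (∀ i, MeasurableSet (P i)) ∧ Pairwise (Function.onFun Disjoint P) ∧ (⋃ i, P i) = Set.univ

/-- Kolmogorov–Sinai (measure-theoretic) entropy of a transformation `T` with respect to `μ`:
the supremum over finite measurable partitions `P` of `inf_N H_μ(⋁_{j<N} T^{-j}P)/N`. -/
def ksEntropy {α : Type*} [MeasurableSpace α] (T : α → α) (μ : Measure α) : ℝ :=
  ⨆ (k : ℕ) (P : Fin k → Set α) (_ : IsFinPart P),
    ⨅ N : ℕ, partEnt μ (joinPart T P (N + 1)) / (N + 1)

/-- The time-one map `x ↦ a x` on the space of lattices `X_{m+n}`. -/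
def aAct (m n : ℕ) (hm : 0 < m) (hn : 0 < n) : XSp (m + n) → XSp (m + n) :=
  fun x => aSL m n hm hn 1 • x

/-- The (topological) support of a measure: points all of whose open neighborhoods have
positive measure. -/
def μsupport {α : Type*} [TopologicalSpace α] [MeasurableSpace α] (μ : Measure α) : Set α :=
  {x | ∀ U : Set α, IsOpen U → x ∈ U → 0 < μ U}

set_option linter.unusedSectionVars false
set_option linter.unusedVariables false
set_option linter.style.longLine false

namespace KK

section Vol
variable {κ κ' ι ι' ξ η : Type*} [Fintype κ] [Fintype κ'] [Fintype ι] [Fintype ι'] [Fintype ξ]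
  [Fintype η] [DecidableEq ι] [DecidableEq ι'] [DecidableEq ξ] [DecidableEq η]

/-- Sup norm of the vector of maximal minors. -/
def vol (M : Matrix κ ι ℝ) : ℝ := ⨆ f : ι → κ, |(M.submatrix f id).det|

lemma le_vol (M : Matrix κ ι ℝ) (f : ι → κ) : |(M.submatrix f id).det| ≤ vol M :=
  le_ciSup (f := fun f : ι → κ => |(M.submatrix f id).det|) (Set.finite_range _).bddAbove f

lemma vol_nonneg (M : Matrix κ ι ℝ) : 0 ≤ vol M := Real.iSup_nonneg fun _ => abs_nonneg _

lemma vol_le (M : Matrix κ ι ℝ) {c : ℝ} (hc : 0 ≤ c) (h : ∀ f : ι → κ, |(M.submatrix f id).det| ≤ c) :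
    vol M ≤ c := Real.iSup_le h hc

lemma exists_vol (M : Matrix κ ι ℝ) (h : vol M ≠ 0) :
    ∃ f : ι → κ, |(M.submatrix f id).det| = vol M := by
  have : Nonempty (ι → κ) := by
    by_contra hn
    rw [not_nonempty_iff] at hn
    exact h (by simp [vol, Real.iSup_of_isEmpty])
  exact exists_eq_ciSup_of_finite (f := fun f : ι → κ => |(M.submatrix f id).det|)

lemma vol_mul_right (M : Matrix κ ι ℝ) (R : Matrix ι ι ℝ) : vol (M * R) = vol M * |R.det| := by
  unfold vol
  rw [Real.iSup_mul_of_nonneg (abs_nonneg _)]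
  congr 1; ext f
  rw [← abs_mul, ← det_mul]
  rfl

lemma vol_submatrix_le (M : Matrix κ ι ℝ) (g : κ' → κ) : vol (M.submatrix g id) ≤ vol M :=
  vol_le _ (vol_nonneg _) fun f => by
    simpa [submatrix_submatrix] using le_vol M (g ∘ f)

lemma vol_row_equiv (M : Matrix κ ι ℝ) (g : κ' ≃ κ) : vol (M.submatrix g id) = vol M := by
  refine le_antisymm (vol_submatrix_le _ _) ?_
  have := vol_submatrix_le (M.submatrix g id) g.symm
  simpa [submatrix_submatrix] using this

lemma vol_col_equiv (M : Matrix κ ι ℝ) (e : ι' ≃ ι) : vol (M.submatrix id e) = vol M := by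
  refine le_antisymm ?_ ?_
  · refine vol_le _ (vol_nonneg _) fun f => ?_
    have : ((M.submatrix id e).submatrix f id) = (M.submatrix (f ∘ e.symm) id).submatrix e e := by
      ext; simp
    rw [this, det_submatrix_equiv_self]
    exact le_vol _ _
  · refine vol_le _ (vol_nonneg _) fun f => ?_
    have : (M.submatrix f id) = ((M.submatrix id e).submatrix (f ∘ e) id).submatrix e.symm e.symm := by
      ext; simp
    rw [this, det_submatrix_equiv_self]
    exact le_vol _ _

lemma det_rect_mul (h : Matrix ι κ ℝ) (M : Matrix κ ι ℝ) :
    (h * M).det = ∑ φ : ι → κ, (∏ j, h j (φ j)) * (M.submatrix φ id).det := by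
  have := (detRowAlternating (R := ℝ) (n := ι)).toMultilinearMap.map_sum
    (g := fun (j : ι) (k : κ) => h j k • M k)
  have e : (fun i => ∑ j, h i j • M j) = h * M := by
    ext i j
    simp [Matrix.mul_apply, Finset.sum_apply]
  rw [e] at this
  change (h * M).det = _ at this
  rw [this]
  refine Finset.sum_congr rfl fun φ _ => ?_
  rw [MultilinearMap.map_smul_univ]
  rfl

lemma vol_mul_left (h : Matrix κ' κ ℝ) (M : Matrix κ ι ℝ) {c : ℝ} (hc : ∀ i j, |h i j| ≤ c)
    (hc0 : 0 ≤ c) :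
    vol (h * M) ≤ (Fintype.card κ * c) ^ Fintype.card ι * vol M := by
  refine vol_le _ (mul_nonneg (by positivity) (vol_nonneg _)) fun f => ?_
  have : (h * M).submatrix f id = (h.submatrix f id) * M := rfl
  rw [this, det_rect_mul]
  calc |∑ φ : ι → κ, (∏ j, h.submatrix f id j (φ j)) * (M.submatrix φ id).det|
      ≤ ∑ φ : ι → κ, |(∏ j, h.submatrix f id j (φ j)) * (M.submatrix φ id).det| :=
        Finset.abs_sum_le_sum_abs _ _
    _ ≤ ∑ φ : ι → κ, c ^ Fintype.card ι * vol M := by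
        refine Finset.sum_le_sum fun φ _ => ?_
        rw [abs_mul]
        refine mul_le_mul ?_ (le_vol _ _) (abs_nonneg _) (by positivity)
        rw [Finset.abs_prod]
        calc ∏ j, |h.submatrix f id j (φ j)| ≤ ∏ j : ι, c :=
              Finset.prod_le_prod (fun _ _ => abs_nonneg _) fun j _ => hc _ _
          _ = _ := by simp
    _ = _ := by
        simp [Finset.sum_const, mul_pow]; ring

/-- Normal form. -/
lemma exists_normal (M : Matrix κ ι ℝ) (h : vol M ≠ 0) :
    ∃ (f : ι → κ) (P : Matrix κ ι ℝ), P.submatrix f id = 1 ∧ (∀ i j, |P i j| ≤ 1) ∧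
      M = P * M.submatrix f id ∧ |(M.submatrix f id).det| = vol M := by
  obtain ⟨f, hf⟩ := exists_vol M h
  have hdet : IsUnit (M.submatrix f id).det := by
    rw [isUnit_iff_ne_zero]; intro h0; rw [h0] at hf; simp at hf; exact h hf.symm
  refine ⟨f, M * (M.submatrix f id)⁻¹, ?_, ?_, ?_, hf⟩
  · change M.submatrix f id * _ = 1
    exact mul_nonsing_inv _ hdet
  · intro r j
    set P := M * (M.submatrix f id)⁻¹ with hP
    have h1 : P.submatrix f id = 1 := mul_nonsing_inv (M.submatrix f id) hdet
    have h2 : M = P * M.submatrix f id := by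
      rw [hP, Matrix.mul_assoc, nonsing_inv_mul _ hdet, Matrix.mul_one]
    have h3 : (P.submatrix (Function.update f j r) id) = (1 : Matrix ι ι ℝ).updateRow j (P r) := by
      ext a b
      by_cases hab : a = j
      · subst hab; simp
      · simp only [submatrix_apply, ne_eq, hab, not_false_eq_true, Function.update_of_ne, id_eq,
          updateRow_ne]
        rw [← h1]; rfl
    have h4 : ((1 : Matrix ι ι ℝ).updateRow j (P r)).det = P r j := by
      rw [← cramer_transpose_apply, transpose_one, cramer_one]; rfl
    have h5 := le_vol M (Function.update f j r)
    have h6 : M.submatrix (Function.update f j r) id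
        = P.submatrix (Function.update f j r) id * M.submatrix f id := by
      conv_lhs => rw [h2]
      rfl
    rw [h6, det_mul, h3, h4, abs_mul, hf] at h5
    have : 0 < vol M := lt_of_le_of_ne (vol_nonneg _) (Ne.symm h)
    nlinarith
  · rw [Matrix.mul_assoc, nonsing_inv_mul _ hdet, Matrix.mul_one]

lemma vol_le_factorial (P : Matrix κ ι ℝ) (h : ∀ i j, |P i j| ≤ 1) :
    vol P ≤ (Fintype.card ι).factorial := by
  refine vol_le _ (by positivity) fun f => ?_
  have := Matrix.det_le (A := P.submatrix f id) (abv := AbsoluteValue.abs) (x := 1)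
    (fun i j => h _ _)
  simpa using this

lemma vol_fromCols_zero_left (M : Matrix κ ι ℝ) (Y : Matrix κ η ℝ) (h : vol M = 0) :
    vol (fromCols M Y) = 0 := by
  by_contra hne
  obtain ⟨φ, hφ⟩ := exists_vol _ hne
  have hu : IsUnit ((fromCols M Y).submatrix φ id).det := by
    rw [isUnit_iff_ne_zero]; intro h0; rw [h0] at hφ; simp at hφ; exact hne hφ.symm
  set S := (fromCols M Y).submatrix φ id with hS
  have h1 : (S⁻¹).submatrix Sum.inl id * M.submatrix φ id = 1 := by
    have h2 := nonsing_inv_mul S hu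
    have h3 := congrArg (fun Z => Z.submatrix (Sum.inl : ι → ι ⊕ η) (Sum.inl : ι → ι ⊕ η)) h2
    simp only [submatrix_one _ Sum.inl_injective] at h3
    rw [← h3]
    ext i j
    simp [Matrix.mul_apply, hS, Fintype.sum_sum_type]
  have h4 : vol ((S⁻¹).submatrix (Sum.inl : ι → ι ⊕ η) id * M.submatrix φ id) ≤ _ :=
    vol_mul_left (c := ∑ i, ∑ j, |S⁻¹ i j|) _ _ (fun i j => by
      calc |S⁻¹ (Sum.inl i) j| ≤ ∑ j, |S⁻¹ (Sum.inl i) j| :=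
            Finset.single_le_sum (f := fun j => |S⁻¹ (Sum.inl i) j|) (fun _ _ => abs_nonneg _) (Finset.mem_univ j)
        _ ≤ _ := Finset.single_le_sum (f := fun i => ∑ j, |S⁻¹ i j|)
            (fun _ _ => Finset.sum_nonneg fun _ _ => abs_nonneg _) (Finset.mem_univ (Sum.inl i)))
      (Finset.sum_nonneg fun _ _ => Finset.sum_nonneg fun _ _ => abs_nonneg _)
  have h5 : vol (M.submatrix φ id) = 0 :=
    le_antisymm ((vol_submatrix_le _ _).trans h.le) (vol_nonneg _)
  rw [h1, h5, mul_zero] at h4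
  have h6 := le_vol (1 : Matrix ι ι ℝ) id
  simp at h6
  linarith

lemma vol_fromCols_comm (M : Matrix κ ι ℝ) (Y : Matrix κ η ℝ) :
    vol (fromCols M Y) = vol (fromCols Y M) := by
  rw [← vol_col_equiv (fromCols Y M) (Equiv.sumComm ι η)]
  congr 1
  ext i (j | j) <;> simp

lemma vol_fromCols_le (M : Matrix κ ι ℝ) (Y : Matrix κ η ℝ) :
    vol (fromCols M Y) ≤ (Fintype.card ι + Fintype.card η).factorial * (vol M * vol Y) := by
  by_cases hM : vol M = 0
  · rw [vol_fromCols_zero_left _ _ hM, hM]; simp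
  by_cases hY : vol Y = 0
  · rw [vol_fromCols_comm, vol_fromCols_zero_left _ _ hY, hY]; simp
  obtain ⟨f, P, -, hP, hMP, hfd⟩ := exists_normal M hM
  obtain ⟨g, Q, -, hQ, hYQ, hgd⟩ := exists_normal Y hY
  have : fromCols M Y = fromCols P Q * fromBlocks (M.submatrix f id) 0 0 (Y.submatrix g id) := by
    rw [fromCols_mul_fromBlocks]
    simp [← hMP, ← hYQ]
  rw [this, vol_mul_right, det_fromBlocks_zero₂₁, abs_mul, hfd, hgd]
  refine mul_le_mul_of_nonneg_right ?_ (mul_nonneg (vol_nonneg _) (vol_nonneg _))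
  refine (vol_le_factorial _ ?_).trans (by simp)
  rintro i (j | j)
  · exact hP i j
  · exact hQ i j

/-- Submodularity. -/
lemma vol_submod (C : Matrix κ ι ℝ) (X : Matrix κ ξ ℝ) (Y : Matrix κ η ℝ) :
    vol C * vol (fromCols (fromCols C X) Y) ≤
      (Fintype.card ι + Fintype.card ξ + Fintype.card η).factorial *
        (vol (fromCols C X) * vol (fromCols C Y)) := by
  by_cases hC : vol C = 0
  · rw [hC, zero_mul]
    exact mul_nonneg (by positivity) (mul_nonneg (vol_nonneg _) (vol_nonneg _))
  obtain ⟨f, P, hPf, hP, hCP, hfd⟩ := exists_normal C hC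
  set X' := X - P * X.submatrix f id with hX'
  set Y' := Y - P * Y.submatrix f id with hY'
  have eX : fromCols C X = fromCols P X' * (fromBlocks (C.submatrix f id) (X.submatrix f id) (0 : Matrix ξ ι ℝ) (1 : Matrix ξ ξ ℝ) : Matrix (ι ⊕ ξ) (ι ⊕ ξ) ℝ) := by
    rw [fromCols_mul_fromBlocks]; simp [← hCP, hX']
  have eY : fromCols C Y = fromCols P Y' * (fromBlocks (C.submatrix f id) (Y.submatrix f id) (0 : Matrix η ι ℝ) (1 : Matrix η η ℝ) : Matrix (ι ⊕ η) (ι ⊕ η) ℝ) := by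
    rw [fromCols_mul_fromBlocks]; simp [← hCP, hY']
  have eXY : fromCols (fromCols C X) Y = fromCols (fromCols P X') Y' *
      (fromBlocks (fromBlocks (C.submatrix f id) (X.submatrix f id) (0 : Matrix ξ ι ℝ) (1 : Matrix ξ ξ ℝ))
        (fromRows (Y.submatrix f id) (0 : Matrix ξ η ℝ)) (0 : Matrix η (ι ⊕ ξ) ℝ) (1 : Matrix η η ℝ) :
        Matrix ((ι ⊕ ξ) ⊕ η) ((ι ⊕ ξ) ⊕ η) ℝ) := by
    rw [fromCols_mul_fromBlocks, eX]
    simp [fromCols_mul_fromRows, hY']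
  have vX : vol (fromCols C X) = vol (fromCols P X') * vol C := by
    rw [eX, vol_mul_right, det_fromBlocks_zero₂₁]; simp [hfd]
  have vY : vol (fromCols C Y) = vol (fromCols P Y') * vol C := by
    rw [eY, vol_mul_right, det_fromBlocks_zero₂₁]; simp [hfd]
  have vXY : vol (fromCols (fromCols C X) Y) = vol (fromCols (fromCols P X') Y') * vol C := by
    rw [eXY, vol_mul_right, det_fromBlocks_zero₂₁, det_fromBlocks_zero₂₁]; simp [hfd]
  have hY0 : Y'.submatrix f id = 0 := by
    have : Y'.submatrix f id = Y.submatrix f id - (P.submatrix f id) * Y.submatrix f id := rfl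
    rw [this, hPf]; simp
  have v1 : vol Y' ≤ vol (fromCols P Y') := by
    refine vol_le _ (vol_nonneg _) fun φ => ?_
    have h1 := le_vol (fromCols P Y') (Sum.elim f φ)
    have h2 : (fromCols P Y').submatrix (Sum.elim f φ) id =
        fromBlocks 1 0 (P.submatrix φ id) (Y'.submatrix φ id) := by
      rw [← hPf, ← hY0]
      ext (i | i) (j | j) <;> simp
    rw [h2, det_fromBlocks_zero₁₂] at h1
    simpa using h1
  have v2 := vol_fromCols_le (fromCols P X') Y'
  rw [vX, vY, vXY]
  have hpos : 0 ≤ vol C := vol_nonneg _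
  have h3 : vol (fromCols (fromCols P X') Y') ≤
      (Fintype.card ι + Fintype.card ξ + Fintype.card η).factorial *
        (vol (fromCols P X') * vol (fromCols P Y')) := by
    refine v2.trans ?_
    rw [Fintype.card_sum]
    refine mul_le_mul_of_nonneg_left ?_ (by positivity)
    exact mul_le_mul_of_nonneg_left v1 (vol_nonneg _)
  calc vol C * (vol (fromCols (fromCols P X') Y') * vol C)
      = vol (fromCols (fromCols P X') Y') * (vol C * vol C) := by ring
    _ ≤ _ := mul_le_mul_of_nonneg_right h3 (by positivity)
    _ = _ := by ring

end Vol
end KK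

namespace KK

section IntMat
variable {κ ι ι' : Type*} [Fintype κ] [Fintype ι] [Fintype ι'] [DecidableEq ι] [DecidableEq ι']

def ic (B : Matrix κ ι ℤ) : Matrix κ ι ℝ := B.map (fun z : ℤ => (z : ℝ))

lemma ic_mul (B : Matrix κ ι ℤ) (R : Matrix ι ι' ℤ) : ic (B * R) = ic B * ic R := by
  ext i j; simp [ic, Matrix.mul_apply]

lemma ic_det (R : Matrix ι ι ℤ) : (ic R).det = (R.det : ℝ) := by
  have := (Int.castRingHom ℝ).map_det R
  simp only [eq_intCast] at this
  rw [this]; rfl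

lemma ic_submatrix_det (B : Matrix κ ι ℤ) (f : ι → κ) :
    ((ic B).submatrix f id).det = ((B.submatrix f id).det : ℝ) := by
  rw [← ic_det]; rfl

lemma det_rect_mul' {F : Type*} [CommRing F] (h : Matrix ι κ F) (M : Matrix κ ι F) :
    (h * M).det = ∑ φ : ι → κ, (∏ j, h j (φ j)) * (M.submatrix φ id).det := by
  have := (detRowAlternating (R := F) (n := ι)).toMultilinearMap.map_sum
    (g := fun (j : ι) (k : κ) => h j k • M k)
  have e : (fun i => ∑ j, h i j • M j) = h * M := by
    ext i j
    simp [Matrix.mul_apply, Finset.sum_apply]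
  rw [e] at this
  change (h * M).det = _ at this
  rw [this]
  refine Finset.sum_congr rfl fun φ _ => ?_
  rw [MultilinearMap.map_smul_univ]
  rfl

lemma vol_ic_ne_zero {M : Matrix κ ι ℤ} (h : Function.Injective M.mulVec) : vol (ic M) ≠ 0 := by
  classical
  rw [mulVec_injective_iff] at h
  have h1 : LinearIndependent ℤ (fun j => (fun k => ((M k j : ℤ) : ℚ)) : ι → κ → ℚ) := by
    let L : (κ → ℤ) →ₗ[ℤ] (κ → ℚ) :=
      { toFun := fun v k => (v k : ℚ)
        map_add' := fun x y => by ext; simp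
        map_smul' := fun x y => by ext; simp }
    have := h.map' L (LinearMap.ker_eq_bot.2 (fun x y hxy => by
      ext k; have := congrFun hxy k; simpa [L] using this))
    exact this
  rw [LinearIndependent.iff_fractionRing ℤ ℚ] at h1
  set Mq : Matrix κ ι ℚ := Matrix.of fun k j => (M k j : ℚ) with hMq
  have h2 : LinearIndependent ℚ Mq.col := h1
  rw [← mulVec_injective_iff] at h2
  obtain ⟨P, hP⟩ := LinearMap.exists_leftInverse_of_injective Mq.mulVecLin
    (LinearMap.ker_eq_bot.2 h2)
  have h3 : (LinearMap.toMatrix' P) * Mq = 1 := by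
    have := congrArg LinearMap.toMatrix' hP
    rw [LinearMap.toMatrix'_comp, LinearMap.toMatrix'_id] at this
    rw [← this]
    congr 1
    exact (LinearMap.toMatrix'_toLin' Mq).symm
  have h4 : ((LinearMap.toMatrix' P) * Mq).det = 1 := by rw [h3, det_one]
  rw [det_rect_mul'] at h4
  intro hv
  have h5 : ∀ φ : ι → κ, (Mq.submatrix φ id).det = 0 := by
    intro φ
    have h6 := le_vol (ic M) φ
    rw [hv] at h6
    have h7 : ((ic M).submatrix φ id).det = 0 := abs_nonpos_iff.1 h6
    rw [ic_submatrix_det] at h7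
    have h8 : (M.submatrix φ id).det = 0 := by exact_mod_cast h7
    have h9 := (Int.castRingHom ℚ).map_det (M.submatrix φ id)
    rw [h8] at h9
    simp only [map_zero] at h9
    rw [h9]; rfl
  simp [h5] at h4

lemma inj_of_vol_ne_zero {M : Matrix κ ι ℤ} (h : vol (ic M) ≠ 0) : Function.Injective M.mulVec := by
  obtain ⟨f, hf⟩ := exists_vol _ h
  have h1 : (M.submatrix f id).det ≠ 0 := by
    intro h0
    rw [ic_submatrix_det, h0] at hf
    simp at hf; exact h hf.symm
  have : ∀ v, M.mulVec v = 0 → v = 0 := by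
    intro v hv
    refine Matrix.eq_zero_of_mulVec_eq_zero h1 ?_
    ext j
    exact congrFun hv (f j)
  intro v w hvw
  have := this (v - w) (by rw [mulVec_sub]; simpa [sub_eq_zero] using hvw)
  exact sub_eq_zero.1 this

lemma one_le_vol_ic {M : Matrix κ ι ℤ} (h : vol (ic M) ≠ 0) : 1 ≤ vol (ic M) := by
  obtain ⟨f, hf⟩ := exists_vol _ h
  rw [← hf, ic_submatrix_det]
  have h1 : (M.submatrix f id).det ≠ 0 := by
    intro h0
    rw [ic_submatrix_det, h0] at hf
    simp at hf; exact h hf.symm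
  exact_mod_cast Int.one_le_abs h1

/-- Integer column span. -/
def colspan (M : Matrix κ ι ℤ) : Submodule ℤ (κ → ℤ) := LinearMap.range M.mulVecLin

lemma mem_colspan {M : Matrix κ ι ℤ} {v : κ → ℤ} : v ∈ colspan M ↔ ∃ x, M.mulVec x = v := by
  simp [colspan]

lemma col_mem (M : Matrix κ ι ℤ) (j : ι) : M.col j ∈ colspan M :=
  mem_colspan.2 ⟨Pi.single j 1, by simp⟩

lemma exists_factor {M : Matrix κ ι ℤ} {B : Matrix κ ι' ℤ} (h : ∀ j, B.col j ∈ colspan M) :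
    ∃ R : Matrix ι ι' ℤ, B = M * R := by
  simp only [mem_colspan] at h
  choose x hx using h
  refine ⟨Matrix.of fun i j => x j i, ?_⟩
  ext k j
  have := congrFun (hx j) k
  simp only [col_apply] at this
  rw [← this]
  simp [Matrix.mul_apply, mulVec, dotProduct]

lemma vol_factor_le {κ' : Type*} [Fintype κ'] (g : Matrix κ' κ ℝ) {M B : Matrix κ ι ℤ} (hB : vol (ic B) ≠ 0)
    (h : colspan B ≤ colspan M) : vol (ic M) ≠ 0 ∧ vol (g * ic M) ≤ vol (g * ic B) := by
  obtain ⟨R, rfl⟩ := exists_factor (fun j => h (col_mem B j))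
  rw [ic_mul, vol_mul_right, ic_det] at hB
  have h1 : R.det ≠ 0 := by rintro h0; simp [h0] at hB
  refine ⟨fun h0 => by simp [h0] at hB, ?_⟩
  rw [ic_mul, ← Matrix.mul_assoc, vol_mul_right, ic_det]
  have : (1 : ℝ) ≤ |(R.det : ℝ)| := by exact_mod_cast Int.one_le_abs h1
  nlinarith [vol_nonneg (g * ic M)]

lemma card_le_of_inj {p q : Type*} [Fintype p] [Fintype q] [DecidableEq p] [DecidableEq q]
    {M : Matrix p q ℤ} (h : Function.Injective M.mulVec) :
    Fintype.card q ≤ Fintype.card p := by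
  have := LinearMap.finrank_le_finrank_of_injective (f := M.mulVecLin) h
  simpa using this

lemma card_le_of_colspan {M : Matrix κ ι ℤ} {B : Matrix κ ι' ℤ} (hB : Function.Injective B.mulVec)
    (h : ∀ j, B.col j ∈ colspan M) : Fintype.card ι' ≤ Fintype.card ι := by
  obtain ⟨R, rfl⟩ := exists_factor h
  refine card_le_of_inj (M := R) ?_
  intro x y hxy
  apply hB
  rw [← mulVec_mulVec, hxy, mulVec_mulVec]

/-- Saturated submodule. -/
def Sat (L : Submodule ℤ (κ → ℤ)) : Prop := ∀ k : ℤ, k ≠ 0 → ∀ v, k • v ∈ L → v ∈ L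

lemma exists_basis_mat (L : Submodule ℤ (κ → ℤ)) :
    ∃ (r : ℕ) (M : Matrix κ (Fin r) ℤ), Function.Injective M.mulVec ∧ colspan M = L := by
  classical
  obtain ⟨r, b⟩ := Submodule.basisOfPid (Pi.basisFun ℤ κ) L
  have key : ∀ x, (Matrix.of fun k j => (b j : κ → ℤ) k).mulVec x = ((∑ j, x j • b j : L) : κ → ℤ) := by
    intro x
    ext k
    simp [mulVec, dotProduct, mul_comm]
  refine ⟨r, Matrix.of fun k j => (b j : κ → ℤ) k, ?_, ?_⟩
  · intro x y hxy
    rw [key, key] at hxy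
    have := Subtype.ext hxy
    have h2 := b.linearIndependent
    rw [Fintype.linearIndependent_iff] at h2
    ext j
    have := h2 (fun j => x j - y j) (by simp [sub_smul, this]) j
    linarith
  · ext v
    rw [mem_colspan]
    constructor
    · rintro ⟨x, rfl⟩
      rw [key]; exact Subtype.prop _
    · intro hv
      refine ⟨b.repr ⟨v, hv⟩, ?_⟩
      rw [key, b.sum_repr]

lemma exists_saturation {i : ℕ} (B : Matrix κ (Fin i) ℤ) (hB : vol (ic B) ≠ 0) :
    ∃ M : Matrix κ (Fin i) ℤ, Function.Injective M.mulVec ∧ Sat (colspan M) ∧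
      colspan B ≤ colspan M := by
  classical
  let L : Submodule ℤ (κ → ℤ) :=
    { carrier := {v | ∃ k : ℤ, k ≠ 0 ∧ k • v ∈ colspan B}
      zero_mem' := ⟨1, one_ne_zero, by simp⟩
      add_mem' := by
        rintro a b ⟨k, hk, ha⟩ ⟨l, hl, hb⟩
        refine ⟨k * l, mul_ne_zero hk hl, ?_⟩
        rw [smul_add]
        refine add_mem ?_ ?_
        · rw [mul_comm, mul_smul]; exact Submodule.smul_mem _ _ ha
        · rw [mul_smul]; exact Submodule.smul_mem _ _ hb
      smul_mem' := by
        rintro c x ⟨k, hk, hx⟩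
        refine ⟨k, hk, ?_⟩
        rw [smul_comm]; exact Submodule.smul_mem _ _ hx }
  obtain ⟨r, M, hM, hML⟩ := exists_basis_mat L
  have hBL : colspan B ≤ L := fun v hv => ⟨1, one_ne_zero, by simpa using hv⟩
  have hsat : Sat L := by
    rintro k hk v ⟨l, hl, hv⟩
    exact ⟨l * k, mul_ne_zero hl hk, by rw [mul_smul]; exact hv⟩
  have h1 : i ≤ r := by
    have := card_le_of_colspan (M := M) (inj_of_vol_ne_zero hB)
      (fun j => by rw [hML]; exact hBL (col_mem B j))
    simpa using this
  have h2 : r ≤ i := by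
    have h3 : ∀ j, ∃ k : ℤ, k ≠ 0 ∧ k • M.col j ∈ colspan B := fun j => by
      have := col_mem M j; rw [hML] at this; exact this
    choose k hk hkm using h3
    have h4 : (∏ j, k j) ≠ 0 := Finset.prod_ne_zero_iff.2 fun j _ => hk j
    have := card_le_of_colspan (M := B) (B := (∏ j, k j) • M) ?_ ?_
    · simpa using this
    · intro x y hxy
      apply hM
      rw [smul_mulVec, smul_mulVec] at hxy
      exact smul_right_injective _ h4 hxy
    · intro j
      have : ((∏ j, k j) • M).col j = (∏ l ∈ Finset.univ.erase j, k l) • (k j • M.col j) := by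
        rw [smul_smul, Finset.prod_erase_mul _ _ (Finset.mem_univ j)]
        rfl
      rw [this]
      exact Submodule.smul_mem _ _ (hkm j)
  obtain rfl : i = r := le_antisymm h1 h2
  exact ⟨M, hM, by rw [hML]; exact hsat, by rw [hML]; exact hBL⟩

lemma fromCols_mulVec' {ξ : Type*} [Fintype ξ] (C : Matrix κ ι ℤ) (X : Matrix κ ξ ℤ) (v : ι ⊕ ξ → ℤ) :
    (fromCols C X).mulVec v = C.mulVec (v ∘ Sum.inl) + X.mulVec (v ∘ Sum.inr) := by
  rw [fromCols_mulVec]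

lemma exists_extend {c : ℕ} (C : Matrix κ (Fin c) ℤ) (hC : Function.Injective C.mulVec)
    (L L' : Submodule ℤ (κ → ℤ)) (hL' : Sat L') (hCL : colspan C = L ⊓ L') :
    ∃ (e : ℕ) (X : Matrix κ (Fin e) ℤ), Function.Injective (fromCols C X).mulVec ∧
      colspan (fromCols C X) = L := by
  classical
  set N : Submodule ℤ L := L'.comap L.subtype with hN
  have tf : Module.IsTorsionFree ℤ (L ⧸ N) := by
    rw [Module.isTorsionFree_iff_smul_eq_zero]
    intro k q hq
    obtain ⟨v, rfl⟩ := Submodule.Quotient.mk_surjective _ q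
    by_cases hk : k = 0
    · exact Or.inl hk
    · right
      rw [← Submodule.Quotient.mk_smul, Submodule.Quotient.mk_eq_zero] at hq
      rw [Submodule.Quotient.mk_eq_zero]
      exact hL' k hk _ (by simpa [hN] using hq)
  let b := Module.finBasis ℤ (L ⧸ N)
  set e := Module.finrank ℤ (L ⧸ N)
  have hl : ∀ j, ∃ x : L, (Submodule.Quotient.mk x : L ⧸ N) = b j :=
    fun j => Submodule.Quotient.mk_surjective _ _
  choose x hx using hl
  have key : ∀ y, (Matrix.of fun k j => (x j : κ → ℤ) k).mulVec y = ((∑ j, y j • x j : L) : κ → ℤ) := by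
    intro y
    ext k
    simp [mulVec, dotProduct, mul_comm]
  have key2 : ∀ y : Fin e → ℤ, (Submodule.Quotient.mk (∑ j, y j • x j) : L ⧸ N) = ∑ j, y j • b j := by
    intro y
    rw [← Submodule.mkQ_apply, map_sum]
    simp [hx]
  have hCN : ∀ v, C.mulVec v ∈ L ⊓ L' := fun v => by rw [← hCL]; exact mem_colspan.2 ⟨v, rfl⟩
  refine ⟨e, Matrix.of fun k j => (x j : κ → ℤ) k, ?_, ?_⟩
  · have : ∀ v, (fromCols C (Matrix.of fun k j => (x j : κ → ℤ) k)).mulVec v = 0 → v = 0 := by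
      intro v hv
      rw [fromCols_mulVec', key] at hv
      set s := ∑ j, (v ∘ Sum.inr) j • x j with hs
      have h1 : (s : κ → ℤ) = - C.mulVec (v ∘ Sum.inl) := eq_neg_of_add_eq_zero_right hv
      have h2 : s ∈ N := by
        change (s : κ → ℤ) ∈ L'
        rw [h1]; exact neg_mem (hCN _).2
      have h3 := (Submodule.Quotient.mk_eq_zero N).2 h2
      rw [hs, key2] at h3
      have h4 := Fintype.linearIndependent_iff.1 b.linearIndependent _ h3
      have h5 : s = 0 := by
        rw [hs]; exact Finset.sum_eq_zero fun j _ => by rw [h4 j, zero_smul]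
      rw [h5] at hv
      have h6 : v ∘ Sum.inl = 0 := hC (by simpa using hv)
      ext (j | j)
      · exact congrFun h6 j
      · exact h4 j
    intro v w hvw
    exact sub_eq_zero.1 (this (v - w) (by rw [mulVec_sub]; simpa [sub_eq_zero] using hvw))
  · ext v
    rw [mem_colspan]
    constructor
    · rintro ⟨w, rfl⟩
      rw [fromCols_mulVec', key]
      exact add_mem (hCN _).1 (Subtype.prop _)
    · intro hv
      set y := b.repr (Submodule.Quotient.mk ⟨v, hv⟩) with hy
      have h1 : (⟨v, hv⟩ - ∑ j, y j • x j : L) ∈ N := by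
        rw [← Submodule.Quotient.mk_eq_zero, Submodule.Quotient.mk_sub, key2 y, hy, b.sum_repr,
          sub_self]
      have h2 : v - ((∑ j, y j • x j : L) : κ → ℤ) ∈ colspan C := by
        rw [hCL]
        refine ⟨sub_mem hv (Subtype.prop _), ?_⟩
        have : ((⟨v, hv⟩ - ∑ j, y j • x j : L) : κ → ℤ) ∈ L' := h1
        simpa using this
      obtain ⟨z, hz⟩ := mem_colspan.1 h2
      refine ⟨Sum.elim z y, ?_⟩
      rw [fromCols_mulVec', key]
      simp only [Sum.elim_comp_inl, Sum.elim_comp_inr, hz]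
      simp

end IntMat
end KK

namespace KK

section Alpha
variable {d : ℕ} {ι : Type*} [Fintype ι] [DecidableEq ι]

/-- Short for the group. -/
abbrev G (d : ℕ) := Matrix.SpecialLinearGroup (Fin d) ℝ

lemma vol_le_inv (h h' : Matrix (Fin d) (Fin d) ℝ) (hh : h' * h = 1) {c : ℝ} (hc0 : 0 ≤ c)
    (hc : ∀ i j, |h' i j| ≤ c) (M : Matrix (Fin d) ι ℝ) :
    vol M ≤ (d * c) ^ Fintype.card ι * vol (h * M) := by
  have := vol_mul_left h' (h * M) hc hc0
  rwa [← Matrix.mul_assoc, hh, Matrix.one_mul, Fintype.card_fin] at this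

lemma exists_bound {p q : Type*} [Finite p] [Finite q] (h : Matrix p q ℝ) : ∃ c : ℝ, 0 ≤ c ∧ ∀ i j, |h i j| ≤ c := by
  cases nonempty_fintype p
  cases nonempty_fintype q
  refine ⟨∑ i, ∑ j, |h i j|, Finset.sum_nonneg fun _ _ => Finset.sum_nonneg fun _ _ => abs_nonneg _, fun i j => ?_⟩
  calc |h i j| ≤ ∑ j, |h i j| :=
        Finset.single_le_sum (f := fun j => |h i j|) (fun _ _ => abs_nonneg _) (Finset.mem_univ j)
    _ ≤ _ := Finset.single_le_sum (f := fun i => ∑ j, |h i j|)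
        (fun _ _ => Finset.sum_nonneg fun _ _ => abs_nonneg _) (Finset.mem_univ i)

lemma inv_mul_coe (g : G d) : (g⁻¹ : G d).1 * g.1 = 1 := by
  have := congrArg Subtype.val (inv_mul_cancel g); exact this

lemma vol_mul_ne_zero (g : G d) (M : Matrix (Fin d) ι ℝ) (hM : vol M ≠ 0) : vol (g.1 * M) ≠ 0 := by
  obtain ⟨c, hc0, hc⟩ := exists_bound (g⁻¹ : G d).1
  have := vol_le_inv g.1 (g⁻¹ : G d).1 (inv_mul_coe g) hc0 hc M
  intro h0
  rw [h0, mul_zero] at this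
  exact hM (le_antisymm this (vol_nonneg _))

lemma vol_pos_of {κ : Type*} [Fintype κ] {M : Matrix κ ι ℝ} (h : vol M ≠ 0) : 0 < vol M :=
  lt_of_le_of_ne (vol_nonneg _) h.symm

/-- The alpha function. -/
def alpha (i : ℕ) (g : G d) : ℝ :=
  ⨆ B : {B : Matrix (Fin d) (Fin i) ℤ // vol (ic B) ≠ 0}, (vol (g.1 * ic B.1))⁻¹

lemma alpha_bdd (i : ℕ) (g : G d) : BddAbove (Set.range
    fun B : {B : Matrix (Fin d) (Fin i) ℤ // vol (ic B) ≠ 0} => (vol (g.1 * ic B.1))⁻¹) := by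
  obtain ⟨c, hc0, hc⟩ := exists_bound (g⁻¹ : G d).1
  refine ⟨(d * c) ^ i, ?_⟩
  rintro _ ⟨⟨B, hB⟩, rfl⟩
  have h1 := vol_le_inv g.1 (g⁻¹ : G d).1 (inv_mul_coe g) hc0 hc (ic B)
  have h2 := one_le_vol_ic hB
  have h3 := vol_pos_of (vol_mul_ne_zero g _ hB)
  simp only [Fintype.card_fin] at h1
  change (vol (g.1 * ic B))⁻¹ ≤ _
  rw [inv_le_iff_one_le_mul₀ h3]
  linarith

lemma le_alpha (g : G d) (B : Matrix (Fin d) ι ℤ) (hB : vol (ic B) ≠ 0) {i : ℕ}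
    (hi : Fintype.card ι = i) : (vol (g.1 * ic B))⁻¹ ≤ alpha i g := by
  subst hi
  let e := (Fintype.equivFin ι).symm
  have h1 : ic (B.submatrix id e) = (ic B).submatrix id e := rfl
  have h2 : vol (ic (B.submatrix id e)) ≠ 0 := by rw [h1, vol_col_equiv]; exact hB
  have h3 := le_ciSup (alpha_bdd _ g) ⟨_, h2⟩
  have h4 : g.1 * ic (B.submatrix id e) = (g.1 * ic B).submatrix id e := rfl
  change (vol (g.1 * ic (B.submatrix id e)))⁻¹ ≤ _ at h3
  rwa [h4, vol_col_equiv] at h3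

lemma alpha_nonneg (i : ℕ) (g : G d) : 0 ≤ alpha i g :=
  Real.iSup_nonneg fun _ => inv_nonneg.2 (vol_nonneg _)

lemma alpha_le {i : ℕ} {g : G d} {c : ℝ} (hc : 0 ≤ c)
    (h : ∀ B : Matrix (Fin d) (Fin i) ℤ, vol (ic B) ≠ 0 → (vol (g.1 * ic B))⁻¹ ≤ c) :
    alpha i g ≤ c := Real.iSup_le (fun B => h B.1 B.2) hc

lemma exists_nondeg {i : ℕ} (hi : i ≤ d) : ∃ B : Matrix (Fin d) (Fin i) ℤ, vol (ic B) ≠ 0 := by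
  refine ⟨(1 : Matrix (Fin d) (Fin d) ℤ).submatrix id (Fin.castLE hi), ?_⟩
  intro h0
  have h1 := le_vol (ic ((1 : Matrix (Fin d) (Fin d) ℤ).submatrix id (Fin.castLE hi))) (Fin.castLE hi)
  rw [h0, ic_submatrix_det] at h1
  have : (((1 : Matrix (Fin d) (Fin d) ℤ).submatrix id (Fin.castLE hi)).submatrix (Fin.castLE hi) id)
      = 1 := by
    rw [submatrix_submatrix]
    exact submatrix_one _ (Fin.castLE_injective hi)
  rw [this] at h1
  norm_num at h1

lemma alpha_pos {i : ℕ} (hi : i ≤ d) (g : G d) : 0 < alpha i g := by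
  obtain ⟨B, hB⟩ := exists_nondeg hi
  exact lt_of_lt_of_le (inv_pos.2 (vol_pos_of (vol_mul_ne_zero g _ hB))) (le_alpha g B hB (by simp))

lemma alpha_zero (g : G d) : alpha 0 g = 1 := by
  have h1 : ∀ M : Matrix (Fin d) (Fin 0) ℝ, vol M = 1 := by
    intro M; simp [vol]
  refine le_antisymm (alpha_le zero_le_one fun B _ => by rw [h1]; simp) ?_
  have := le_alpha g (0 : Matrix (Fin d) (Fin 0) ℤ) (by rw [h1]; simp) (i := 0) (by simp)
  rwa [h1, inv_one] at this

lemma alpha_top (g : G d) : alpha d g ≤ 1 := by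
  refine alpha_le zero_le_one fun B hB => ?_
  have h1 : (ic B).det ≠ 0 := by
    intro h0
    apply hB
    have := vol_mul_right (1 : Matrix (Fin d) (Fin d) ℝ) (ic B)
    rwa [Matrix.one_mul, h0, abs_zero, mul_zero] at this
  have h2 := le_vol (g.1 * ic B) id
  have h3 : ((g.1 * ic B).submatrix id id).det = (B.det : ℝ) := by
    rw [submatrix_id_id, det_mul, ic_det, g.2, one_mul]
  rw [h3] at h2
  rw [ic_det] at h1
  have : (1 : ℝ) ≤ |(B.det : ℝ)| := by
    exact_mod_cast Int.one_le_abs (by exact_mod_cast h1)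
  exact inv_le_one_of_one_le₀ (this.trans h2)

lemma alpha_gamma_le (i : ℕ) (g γ : G d) (hγ : γ ∈ Gamma d) : alpha i (g * γ) ≤ alpha i g := by
  obtain ⟨γ', rfl⟩ := hγ
  refine alpha_le (alpha_nonneg _ _) fun B hB => ?_
  have h1 : ((Matrix.SpecialLinearGroup.map (Int.castRingHom ℝ) γ' : G d)).1 = ic γ'.1 := rfl
  have h2 : vol (ic (γ'.1 * B)) ≠ 0 := by
    rw [ic_mul, ← h1]; exact vol_mul_ne_zero _ _ hB
  have h3 := le_alpha g (γ'.1 * B) h2 (i := i) (by simp)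
  rw [ic_mul, ← h1, ← Matrix.mul_assoc] at h3
  exact h3

lemma alpha_gamma (i : ℕ) (g γ : G d) (hγ : γ ∈ Gamma d) : alpha i (g * γ) = alpha i g := by
  refine le_antisymm (alpha_gamma_le i g γ hγ) ?_
  have := alpha_gamma_le i (g * γ) γ⁻¹ (inv_mem hγ)
  rwa [mul_inv_cancel_right] at this

lemma alpha_mul_le {i : ℕ} (g h : G d) {c : ℝ} (hc0 : 0 ≤ c) (hc : ∀ a b, |(h⁻¹ : G d).1 a b| ≤ c) :
    alpha i (h * g) ≤ (d * c) ^ i * alpha i g := by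
  refine alpha_le (mul_nonneg (by positivity) (alpha_nonneg _ _)) fun B hB => ?_
  have h1 := vol_le_inv h.1 (h⁻¹ : G d).1 (inv_mul_coe h) hc0 hc (g.1 * ic B)
  have h2 := le_alpha g B hB (i := i) (by simp)
  have h3 := vol_pos_of (vol_mul_ne_zero g _ hB)
  have h4 := vol_pos_of (vol_mul_ne_zero h _ h3.ne')
  have h5 : (h * g).1 * ic B = h.1 * (g.1 * ic B) := by
    rw [← Matrix.mul_assoc]; rfl
  rw [h5]
  simp only [Fintype.card_fin] at h1
  calc (vol (h.1 * (g.1 * ic B)))⁻¹ ≤ (d * c) ^ i * (vol (g.1 * ic B))⁻¹ := by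
        rw [← div_eq_mul_inv, inv_eq_one_div, div_le_div_iff₀ h4 h3]; linarith
    _ ≤ _ := mul_le_mul_of_nonneg_left h2 (by positivity)

lemma emm {i : ℕ} (hi : i ≤ d) (g : G d) : ∃ B : Matrix (Fin d) (Fin i) ℤ, vol (ic B) ≠ 0 ∧
    ∀ (h : G d) (Q : ℝ), 0 ≤ Q → (∀ M : Matrix (Fin d) (Fin i) ℝ, vol M ≤ Q * vol (h.1 * M)) →
      ∀ S : ℝ, 0 ≤ S → (vol (h.1 * (g.1 * ic B)))⁻¹ ≤ S →
      (∀ j, 1 ≤ j → j ≤ i → i + j ≤ d →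
        2 * (d.factorial : ℝ) * Q ^ 2 * (alpha (i - j) g * alpha (i + j) g) ≤ S ^ 2) →
      alpha i (h * g) ≤ S := by
  have hα := alpha_pos hi g
  obtain ⟨B0, hB0⟩ := exists_nondeg hi
  have : Nonempty {B : Matrix (Fin d) (Fin i) ℤ // vol (ic B) ≠ 0} := ⟨⟨B0, hB0⟩⟩
  obtain ⟨⟨B1, hB1⟩, hB1'⟩ := exists_lt_of_lt_ciSup (show alpha i g / 2 < alpha i g by linarith)
  obtain ⟨B, hBinj, hBsat, hBB1⟩ := exists_saturation B1 hB1
  have hB := vol_ic_ne_zero hBinj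
  have hBv : alpha i g * vol (g.1 * ic B) ≤ 2 := by
    have h1 := (vol_factor_le g.1 hB1 hBB1).2
    have h2 := vol_pos_of (vol_mul_ne_zero g _ hB1)
    change alpha i g / 2 < (vol (g.1 * ic B1))⁻¹ at hB1'
    rw [lt_inv_comm₀ (by positivity) h2] at hB1'
    have : vol (g.1 * ic B) ≤ (alpha i g / 2)⁻¹ := h1.trans hB1'.le
    calc alpha i g * vol (g.1 * ic B) ≤ alpha i g * (alpha i g / 2)⁻¹ := by gcongr
      _ = 2 := by field_simp
  refine ⟨B, hB, fun h Q hQ0 hQ S hS hS1 hS2 => alpha_le hS fun B' hB' => ?_⟩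
  obtain ⟨B2, hB2inj, hB2sat, hBB2⟩ := exists_saturation B' hB'
  have hB2 := vol_ic_ne_zero hB2inj
  have e1 : ∀ M : Matrix (Fin d) (Fin i) ℝ, (h * g).1 * M = h.1 * (g.1 * M) := fun M => by
    rw [← Matrix.mul_assoc]; rfl
  have p2 : 0 < vol (h.1 * (g.1 * ic B2)) := vol_pos_of (vol_mul_ne_zero h _ (vol_mul_ne_zero g _ hB2))
  have pB : 0 < vol (h.1 * (g.1 * ic B)) := vol_pos_of (vol_mul_ne_zero h _ (vol_mul_ne_zero g _ hB))
  have s1 : (vol ((h * g).1 * ic B'))⁻¹ ≤ (vol (h.1 * (g.1 * ic B2)))⁻¹ := by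
    rw [← e1]
    have := (vol_factor_le (h * g).1 hB' hBB2).2
    rw [← e1] at p2
    exact inv_anti₀ p2 this
  refine s1.trans ?_
  by_cases hle : colspan B2 ≤ colspan B
  · have := (vol_factor_le (h * g).1 hB2 hle).2
    rw [e1, e1] at this
    exact (inv_anti₀ pB this).trans hS1
  obtain ⟨c, C, hC, hCN⟩ := exists_basis_mat (colspan B ⊓ colspan B2)
  obtain ⟨e, X, hX, hXL⟩ := exists_extend C hC (colspan B) (colspan B2) hB2sat hCN
  obtain ⟨e', Y, hY, hYL⟩ := exists_extend C hC (colspan B2) (colspan B) hBsat (by rw [hCN, inf_comm])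
  have k1 : c + e = i := by
    have a1 := card_le_of_colspan (M := B) hX (fun j => by rw [← hXL]; exact col_mem _ j)
    have a2 := card_le_of_colspan (M := fromCols C X) hBinj (fun j => by rw [hXL]; exact col_mem _ j)
    simp at a1 a2; omega
  have k2 : c + e' = i := by
    have a1 := card_le_of_colspan (M := B2) hY (fun j => by rw [← hYL]; exact col_mem _ j)
    have a2 := card_le_of_colspan (M := fromCols C Y) hB2inj (fun j => by rw [hYL]; exact col_mem _ j)
    simp at a1 a2; omega
  obtain rfl : e' = e := by omega
  have hXY : Function.Injective (fromCols (fromCols C X) Y).mulVec := by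
    have : ∀ v, (fromCols (fromCols C X) Y).mulVec v = 0 → v = 0 := by
      intro v hv
      rw [fromCols_mulVec'] at hv
      have m1 : (fromCols C X).mulVec (v ∘ Sum.inl) ∈ colspan B := by
        rw [← hXL]; exact mem_colspan.2 ⟨_, rfl⟩
      have m2 : Y.mulVec (v ∘ Sum.inr) ∈ colspan B := by
        rw [eq_neg_of_add_eq_zero_right hv]
        exact neg_mem m1
      have m3 : Y.mulVec (v ∘ Sum.inr) ∈ colspan B2 := by
        rw [← hYL]
        exact mem_colspan.2 ⟨Sum.elim 0 (v ∘ Sum.inr), by rw [fromCols_mulVec']; simp⟩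
      have m4 : Y.mulVec (v ∘ Sum.inr) ∈ colspan C := by rw [hCN]; exact ⟨m2, m3⟩
      obtain ⟨z, hz⟩ := mem_colspan.1 m4
      have m5 : Sum.elim (-z) (v ∘ Sum.inr) = 0 := hY (by
        rw [fromCols_mulVec']; simp [mulVec_neg, hz])
      have m6 : v ∘ Sum.inr = 0 := by
        ext j; exact congrFun m5 (Sum.inr j)
      rw [m6, mulVec_zero, add_zero] at hv
      have m7 : v ∘ Sum.inl = 0 := hX (by simpa using hv)
      ext (j | j)
      · exact congrFun m7 j
      · exact congrFun m6 j
    intro v w hvw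
    exact sub_eq_zero.1 (this (v - w) (by rw [mulVec_sub]; simpa [sub_eq_zero] using hvw))
  have he1 : 1 ≤ e' := by
    by_contra h0
    obtain rfl : e' = 0 := by omega
    apply hle
    have : colspan (fromCols C Y) ≤ colspan C := by
      intro v hv
      obtain ⟨z, rfl⟩ := mem_colspan.1 hv
      rw [fromCols_mulVec']
      refine mem_colspan.2 ⟨z ∘ Sum.inl, ?_⟩
      ext k; simp [mulVec, dotProduct]
    rw [hYL, hCN] at this
    exact this.trans inf_le_left
  have hid : i + e' ≤ d := by
    have := card_le_of_inj hXY
    simp at this; omega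
  have hs := hS2 e' he1 (by omega) hid
  have v0 := vol_submod (g.1 * ic C) (g.1 * ic X) (g.1 * ic Y)
  have icf : ∀ {a b : Type} [Fintype a] [Fintype b] [DecidableEq a] [DecidableEq b]
      (U : Matrix (Fin d) a ℤ) (V : Matrix (Fin d) b ℤ),
      fromCols (g.1 * ic U) (g.1 * ic V) = g.1 * ic (fromCols U V) := by
    intro a b _ _ _ _ U V
    have : ic (fromCols U V) = fromCols (ic U) (ic V) := by
      ext k (j | j) <;> rfl
    rw [this, mul_fromCols]
  rw [icf, icf, icf] at v0
  have nC := vol_ic_ne_zero hC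
  have nX := vol_ic_ne_zero hX
  have nY := vol_ic_ne_zero hY
  have nXY := vol_ic_ne_zero hXY
  have aC := le_alpha g C nC (i := i - e') (by simp; omega)
  have aXY := le_alpha g _ nXY (i := i + e') (by simp; omega)
  have pC := vol_pos_of (vol_mul_ne_zero g _ nC)
  have pXY := vol_pos_of (vol_mul_ne_zero g _ nXY)
  have pX := vol_pos_of (vol_mul_ne_zero g _ nX)
  have pY := vol_pos_of (vol_mul_ne_zero g _ nY)
  have pb := vol_pos_of (vol_mul_ne_zero g _ hB)
  have pb2 := vol_pos_of (vol_mul_ne_zero g _ hB2)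
  have cmp : ∀ (U : Matrix (Fin d) (Fin c ⊕ Fin e') ℤ) (V : Matrix (Fin d) (Fin i) ℤ),
      vol (ic V) ≠ 0 → colspan U = colspan V → vol (g.1 * ic U) ≤ vol (g.1 * ic V) := by
    intro U V hV hUV
    let ee : (Fin i) ≃ (Fin c ⊕ Fin e') := (finCongr k1.symm).trans finSumFinEquiv.symm
    have t1 : colspan V ≤ colspan (U.submatrix id ee) := by
      rw [← hUV]
      intro v hv
      obtain ⟨z, rfl⟩ := mem_colspan.1 hv
      refine mem_colspan.2 ⟨z ∘ ee, ?_⟩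
      rw [submatrix_mulVec_equiv]
      ext k; simp [Function.comp_assoc]
    have t2 := (vol_factor_le g.1 hV t1).2
    have t3 : g.1 * ic (U.submatrix id ee) = (g.1 * ic U).submatrix id ee := rfl
    rwa [t3, vol_col_equiv] at t2
  have cX := cmp _ _ hB hXL
  have cY := cmp _ _ hB2 hYL
  have hK : ((Fintype.card (Fin c) + Fintype.card (Fin e') + Fintype.card (Fin e')).factorial : ℝ)
      ≤ d.factorial := by
    exact_mod_cast Nat.factorial_le (by simp; omega)
  set K : ℝ := (d.factorial : ℝ)
  have hK0 : 0 < K := by positivity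
  set x := (vol (h.1 * (g.1 * ic B2)))⁻¹ with hx
  have hx0 : 0 < x := inv_pos.2 p2
  set α1 := alpha (i - e') g
  set α2 := alpha (i + e') g
  have q1 : 1 ≤ α1 * vol (g.1 * ic C) := by rwa [inv_le_iff_one_le_mul₀ pC] at aC
  have q2 : 1 ≤ α2 * vol (g.1 * ic (fromCols (fromCols C X) Y)) := by
    rwa [inv_le_iff_one_le_mul₀ pXY] at aXY
  have α1p : 0 ≤ α1 := alpha_nonneg _ _
  have α2p : 0 ≤ α2 := alpha_nonneg _ _
  have q3 : 1 ≤ α1 * α2 * (K * (vol (g.1 * ic B) * vol (g.1 * ic B2))) := by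
    calc (1 : ℝ) = 1 * 1 := by ring
      _ ≤ (α1 * vol (g.1 * ic C)) * (α2 * vol (g.1 * ic (fromCols (fromCols C X) Y))) :=
          mul_le_mul q1 q2 (by norm_num) (by positivity)
      _ = α1 * α2 * (vol (g.1 * ic C) * vol (g.1 * ic (fromCols (fromCols C X) Y))) := by ring
      _ ≤ _ := by
          refine mul_le_mul_of_nonneg_left (v0.trans ?_) (by positivity)
          gcongr
  have q4 : x * vol (g.1 * ic B2) ≤ Q := by
    have := hQ (g.1 * ic B2)
    rw [hx, inv_mul_le_iff₀ p2]; linarith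
  have q5 : x ≤ Q * alpha i g := by
    have a := le_alpha g B2 hB2 (i := i) (by simp)
    rw [inv_le_iff_one_le_mul₀ pb2] at a
    have : x ≤ x * (alpha i g * vol (g.1 * ic B2)) := le_mul_of_one_le_right hx0.le a
    calc x ≤ x * (alpha i g * vol (g.1 * ic B2)) := this
      _ = (x * vol (g.1 * ic B2)) * alpha i g := by ring
      _ ≤ _ := mul_le_mul_of_nonneg_right q4 hα.le
  have q6 : x * alpha i g ≤ 2 * K * Q * (α1 * α2) := by
    calc x * alpha i g ≤ x * alpha i g * (α1 * α2 * (K * (vol (g.1 * ic B) * vol (g.1 * ic B2)))) :=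
          le_mul_of_one_le_right (by positivity) q3
      _ = (alpha i g * vol (g.1 * ic B)) * (x * vol (g.1 * ic B2)) * (K * (α1 * α2)) := by ring
      _ ≤ 2 * Q * (K * (α1 * α2)) := by gcongr
      _ = _ := by ring
  have q7 : x ^ 2 ≤ S ^ 2 := by
    calc x ^ 2 = x * x := by ring
      _ ≤ x * (Q * alpha i g) := by gcongr
      _ = Q * (x * alpha i g) := by ring
      _ ≤ Q * (2 * K * Q * (α1 * α2)) := by gcongr
      _ = 2 * K * Q ^ 2 * (α1 * α2) := by ring
      _ ≤ _ := hs
  exact abs_le_of_sq_le_sq' q7 hS |>.2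

end Alpha
end KK

namespace KK

/-- Negative power. -/
def np (v β : ℝ) : ℝ≥0∞ := (ENNReal.ofReal v) ^ (-β)

lemma np_anti {v w β : ℝ} (hβ : 0 ≤ β) (h : v ≤ w) : np w β ≤ np v β := by
  unfold np
  rw [ENNReal.rpow_neg, ENNReal.rpow_neg, ENNReal.inv_le_inv]
  exact ENNReal.rpow_le_rpow (ENNReal.ofReal_le_ofReal h) hβ

lemma np_mul {v w : ℝ} (hv : 0 ≤ v) (β : ℝ) : np (v * w) β = np v β * np w β := by
  unfold np
  rw [ENNReal.ofReal_mul hv, ENNReal.mul_rpow_of_ne_top ENNReal.ofReal_ne_top ENNReal.ofReal_ne_top]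

lemma np_zero_exp (v : ℝ) : np v 0 = 1 := by simp [np]

lemma np_pow (v : ℝ) {β : ℝ} (hβ : 0 ≤ β) {n : ℕ} (hn : 0 < n) : np v (β / n) ^ n = np v β := by
  unfold np
  rw [← ENNReal.rpow_natCast, ← ENNReal.rpow_mul]
  congr 1
  have : (n : ℝ) ≠ 0 := by positivity
  field_simp

lemma np_pos_eq {v : ℝ} (hv : 0 < v) (β : ℝ) : np v β = ENNReal.ofReal (v ^ (-β)) := by
  unfold np
  rw [ENNReal.ofReal_rpow_of_pos hv]

lemma measurable_np {α : Type*} [MeasurableSpace α] {f : α → ℝ} (hf : Measurable f) (β : ℝ) :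
    Measurable fun x => np (f x) β := by
  unfold np
  exact (ENNReal.measurable_ofReal.comp hf).pow_const _

lemma measurable_vol {α κ ι : Type*} [MeasurableSpace α] [Fintype κ] [Fintype ι] [DecidableEq ι]
    {f : α → Matrix κ ι ℝ} (hf : ∀ i j, Measurable fun x => f x i j) : Measurable fun x => vol (f x) := by
  unfold vol
  refine Measurable.iSup fun φ => ?_
  have : Measurable fun x => ((f x).submatrix φ id).det := by
    simp only [det_apply, submatrix_apply, id]
    refine Finset.measurable_sum _ fun σ _ => ?_
    refine Measurable.const_smul ?_ _
    exact Finset.measurable_prod _ fun i _ => hf _ _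
  exact this.abs

section Schur
variable {κ ι η : Type*} [Fintype κ] [Fintype ι] [Fintype η] [DecidableEq ι] [DecidableEq η]

lemma vol_schur (C : Matrix κ ι ℝ) (Y : Matrix κ η ℝ) (f : ι → κ) (P : Matrix κ ι ℝ)
    (hPf : P.submatrix f id = 1) (hCP : C = P * C.submatrix f id)
    (hfd : |(C.submatrix f id).det| = vol C) :
    vol C * vol (Y - P * Y.submatrix f id) ≤ vol (fromCols C Y) := by
  set Y' := Y - P * Y.submatrix f id with hY'
  have eY : fromCols C Y = fromCols P Y' * (fromBlocks (C.submatrix f id) (Y.submatrix f id) (0 : Matrix η ι ℝ) (1 : Matrix η η ℝ) : Matrix (ι ⊕ η) (ι ⊕ η) ℝ) := by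
    rw [fromCols_mul_fromBlocks]; simp [← hCP, hY']
  have vY : vol (fromCols C Y) = vol (fromCols P Y') * vol C := by
    rw [eY, vol_mul_right, det_fromBlocks_zero₂₁]; simp [hfd]
  have hY0 : Y'.submatrix f id = 0 := by
    have : Y'.submatrix f id = Y.submatrix f id - (P.submatrix f id) * Y.submatrix f id := rfl
    rw [this, hPf]; simp
  have v1 : vol Y' ≤ vol (fromCols P Y') := by
    refine vol_le _ (vol_nonneg _) fun φ => ?_
    have h1 := le_vol (fromCols P Y') (Sum.elim f φ)
    have h2 : (fromCols P Y').submatrix (Sum.elim f φ) id =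
        fromBlocks 1 0 (P.submatrix φ id) (Y'.submatrix φ id) := by
      rw [← hPf, ← hY0]
      ext (i | i) (j | j) <;> simp
    rw [h2, det_fromBlocks_zero₁₂] at h1
    simpa using h1
  rw [vY, mul_comm]
  exact mul_le_mul_of_nonneg_right v1 (vol_nonneg _)

lemma inj_of_det_ne {M : Matrix κ ι ℝ} {f : ι → κ} (h : (M.submatrix f id).det ≠ 0) :
    Function.Injective f := by
  intro a b hab
  by_contra hne
  exact h (Matrix.det_zero_of_row_eq hne (by ext j; simp [hab]))

end Schur

section Marg
variable {δ : Type*} [DecidableEq δ] (ν : Measure ℝ) [IsProbabilityMeasure ν]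

lemma lmarg_le {s : Finset δ} {f : (δ → ℝ) → ℝ≥0∞} {x : δ → ℝ} {C : ℝ≥0∞}
    (h : ∀ y, f (Function.updateFinset x s y) ≤ C) : lmarginal (fun _ => ν) s f x ≤ C := by
  unfold lmarginal
  calc _ ≤ ∫⁻ y : (∀ i : s, ℝ), C ∂Measure.pi fun i : s => ν := lintegral_mono h
    _ = C := by simp

lemma lmarg_const_mul {s : Finset δ} {f : (δ → ℝ) → ℝ≥0∞} (hf : Measurable f) {x : δ → ℝ} {C : ℝ≥0∞} :
    lmarginal (fun _ => ν) s (fun x => C * f x) x = C * lmarginal (fun _ => ν) s f x := by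
  unfold lmarginal
  rw [lintegral_const_mul]
  exact hf.comp measurable_updateFinset

lemma lmarg_prod {γ : ℝ} {C0 : ℝ≥0∞} (hC : ∀ c, ∫⁻ x, np |x - c| γ ∂ν ≤ C0) (S : Finset δ) (c : δ → ℝ) :
    ∀ x, lmarginal (fun _ => ν) S (fun x => ∏ e ∈ S, np |x e - c e| γ) x ≤ C0 ^ S.card := by
  induction S using Finset.induction with
  | empty => intro x; simp
  | insert e S he ih =>
    intro x
    have hm : ∀ T : Finset δ, Measurable (fun x : δ → ℝ => ∏ e ∈ T, np |x e - c e| γ) := fun T =>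
      Finset.measurable_prod _ fun e _ =>
        measurable_np ((measurable_pi_apply e).sub_const _).abs _
    rw [lmarginal_insert _ (hm _) he]
    simp only [Finset.prod_insert he, Finset.card_insert_of_notMem he, pow_succ]
    calc ∫⁻ t, (∫⋯∫⁻_S, fun x ↦ np |x e - c e| γ * ∏ e ∈ S, np |x e - c e| γ ∂fun _ => ν)
            (Function.update x e t) ∂ν
        ≤ ∫⁻ t, C0 ^ S.card * np |t - c e| γ ∂ν := by
          refine lintegral_mono fun t => ?_
          have : (∫⋯∫⁻_S, fun x ↦ np |x e - c e| γ * ∏ e ∈ S, np |x e - c e| γ ∂fun _ => ν)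
            (Function.update x e t) = (∫⋯∫⁻_S, fun x ↦ np |t - c e| γ * ∏ e ∈ S, np |x e - c e| γ ∂fun _ => ν)
            (Function.update x e t) := by
            unfold lmarginal
            congr 1; ext y
            simp [Function.updateFinset, he]
          rw [this, lmarg_const_mul ν (hm S), mul_comm]
          gcongr
          exact ih _
      _ = C0 ^ S.card * ∫⁻ t, np |t - c e| γ ∂ν := by
          rw [lintegral_const_mul]
          exact measurable_np (measurable_id.sub_const _).abs _
      _ ≤ _ := by gcongr; exact hC _

variable {R : Type*} [Fintype R] [DecidableEq R]

lemma colstep {ι : Type*} [Fintype ι] [DecidableEq ι] {β : ℝ} (hβ : 0 ≤ β)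
    (hlt : Fintype.card ι < Fintype.card R)
    {C0 : ℝ≥0∞}
    (hC : ∀ c, ∫⁻ x, np |x - c| (β / ((Fintype.card R - Fintype.card ι : ℕ) : ℝ)) ∂ν ≤ C0)
    (Z : Matrix R ι ℝ) (hZ : vol Z ≠ 0) (loc : R → δ) (hloc : Function.Injective loc) (b : R → ℝ) (x : δ → ℝ) :
    lmarginal (fun _ => ν) (Finset.univ.image loc)
      (fun x => np (vol (fromCols Z (Matrix.of fun r (_ : Fin 1) => x (loc r) + b r))) β) x ≤
      C0 ^ (Fintype.card R - Fintype.card ι) * np (vol Z) β := by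
  classical
  obtain ⟨f, P, hPf, hP, hZP, hfd⟩ := exists_normal Z hZ
  have hfi : Function.Injective f := inj_of_det_ne (M := Z) (f := f) (fun h0 => by
    rw [h0] at hfd; simp at hfd; exact hZ hfd.symm)
  set S : Finset R := (Finset.univ.image f)ᶜ with hS
  have hSc : S.card = Fintype.card R - Fintype.card ι := by
    rw [hS, Finset.card_compl, Finset.card_image_of_injective _ hfi, Finset.card_univ]
  set k := Fintype.card R - Fintype.card ι with hk
  have hk0 : 0 < k := by omega
  have hun : Finset.univ.image loc = (Sᶜ.image loc) ∪ (S.image loc) := by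
    rw [← Finset.image_union, Finset.union_comm, Finset.union_compl]
  have hdis : Disjoint (Sᶜ.image loc) (S.image loc) := by
    rw [Finset.disjoint_image hloc]; exact disjoint_compl_left
  set γ : ℝ := β / (k : ℝ) with hγ
  have hm : Measurable (fun x : δ → ℝ => np (vol (fromCols Z (Matrix.of fun r (_ : Fin 1) => x (loc r) + b r))) β) := by
    refine measurable_np (measurable_vol ?_) _
    rintro i (j | j)
    · exact measurable_const
    · exact (measurable_pi_apply (loc i)).add_const _
  rw [hun, lmarginal_union _ _ hm hdis]
  refine lmarg_le ν fun y0 => ?_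
  set x1 := Function.updateFinset x (Sᶜ.image loc) y0
  let c : δ → ℝ := fun e => ∑ r, if loc r = e then (-(b r) + ∑ j, P r j * (x1 (loc (f j)) + b (f j))) else 0
  have hc : ∀ r, c (loc r) = -(b r) + ∑ j, P r j * (x1 (loc (f j)) + b (f j)) := by
    intro r
    simp only [c, hloc.eq_iff]
    simp
  have key : ∀ y, np (vol (fromCols Z (Matrix.of fun r (_ : Fin 1) =>
      (Function.updateFinset x1 (S.image loc) y) (loc r) + b r))) β ≤
      np (vol Z) β * ∏ e ∈ S.image loc, np |(Function.updateFinset x1 (S.image loc) y) e - c e| γ := by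
    intro y
    set x2 := Function.updateFinset x1 (S.image loc) y with hx2
    have hx2f : ∀ j, x2 (loc (f j)) = x1 (loc (f j)) := by
      intro j
      have : loc (f j) ∉ S.image loc := by
        intro hmem
        obtain ⟨r, hr, hrr⟩ := Finset.mem_image.1 hmem
        have := hloc hrr
        subst this
        simp [hS] at hr
      simp [hx2, Function.updateFinset, this]
    set W : Matrix R (Fin 1) ℝ := Matrix.of fun r (_ : Fin 1) => x2 (loc r) + b r with hW
    have h1 := vol_schur Z W f P hPf hZP hfd
    have h2 : ∀ r, |x2 (loc r) - c (loc r)| ≤ vol (W - P * W.submatrix f id) := by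
      intro r
      have := le_vol (W - P * W.submatrix f id) (fun _ => r)
      rw [det_unique] at this
      refine le_trans (le_of_eq ?_) this
      congr 1
      rw [hc]
      simp only [Matrix.submatrix_apply, Matrix.sub_apply, id, Matrix.mul_apply, hW, Matrix.of_apply, hx2f]
      ring
    have h3 : ∀ r, np (vol (fromCols Z W)) γ ≤ np (vol Z) γ * np |x2 (loc r) - c (loc r)| γ := by
      intro r
      rw [← np_mul (vol_nonneg _)]
      refine np_anti (by positivity) ?_
      exact (mul_le_mul_of_nonneg_left (h2 r) (vol_nonneg _)).trans h1
    rw [Finset.prod_image (fun a _ b _ h => hloc h)]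
    calc np (vol (fromCols Z W)) β = ∏ r ∈ S, np (vol (fromCols Z W)) γ := by
          rw [Finset.prod_const, hSc, np_pow _ hβ hk0]
      _ ≤ ∏ r ∈ S, np (vol Z) γ * np |x2 (loc r) - c (loc r)| γ :=
          Finset.prod_le_prod' fun r _ => h3 r
      _ = _ := by
          rw [Finset.prod_mul_distrib, Finset.prod_const, hSc, np_pow _ hβ hk0]
  have hm2 : Measurable (fun x : δ → ℝ => ∏ e ∈ S.image loc, np |x e - c e| γ) :=
      Finset.measurable_prod _ fun e _ =>
        measurable_np ((measurable_pi_apply e).sub_const _).abs _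
  calc _ ≤ lmarginal (fun _ => ν) (S.image loc) (fun x => np (vol Z) β * ∏ e ∈ S.image loc, np |x e - c e| γ) x1 :=
        lintegral_mono key
    _ = np (vol Z) β * _ := lmarg_const_mul ν hm2
    _ ≤ np (vol Z) β * C0 ^ (S.image loc).card := by
        gcongr
        exact lmarg_prod ν hC _ _ _
    _ = _ := by rw [Finset.card_image_of_injective _ hloc, hSc, mul_comm]

/-- Uniform integrability of negative powers. -/
def Good : Prop := ∀ γ : ℝ, 0 ≤ γ → γ < 1 → ∃ C0 : ℝ≥0∞, C0 ≠ ⊤ ∧ 1 ≤ C0 ∧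
  ∀ c, ∫⁻ x, np |x - c| γ ∂ν ≤ C0

lemma minor_integral (hν : Good ν) {β : ℝ} (hβ : 0 < β) (k l : ℕ) (hl : l ≤ k)
    (hlt : β < (k : ℝ) - l + 1) :
    ∃ C : ℝ≥0∞, C ≠ ⊤ ∧ ∀ (δ : Type) [DecidableEq δ] (R : Type) [Fintype R] [DecidableEq R],
      Fintype.card R = k → ∀ (loc : R → Fin l → δ),
      Function.Injective (fun p : R × Fin l => loc p.1 p.2) → ∀ (b : R → Fin l → ℝ) (x : δ → ℝ),
      lmarginal (fun _ => ν) (Finset.univ.image (fun p : R × Fin l => loc p.1 p.2))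
        (fun x => np (vol (Matrix.of fun r j => x (loc r j) + b r j)) β) x ≤ C := by
  induction l with
  | zero =>
    refine ⟨1, by simp, ?_⟩
    intro δ _ R _ _ hR loc hloc b x
    refine lmarg_le ν fun y => ?_
    have : ∀ M : Matrix R (Fin 0) ℝ, vol M = 1 := fun M => by simp [vol]
    rw [this]; simp [np]
  | succ l ih =>
    push_cast at hlt
    obtain ⟨C, hCtop, hC⟩ := ih (by omega) (by linarith)
    have hkl : 0 < k - l := by omega
    have hklr : ((k - l : ℕ) : ℝ) = (k : ℝ) - l := by rw [Nat.cast_sub (by omega)]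
    have hkl' : (0 : ℝ) < ((k - l : ℕ) : ℝ) := by exact_mod_cast hkl
    obtain ⟨C0, hC0top, hC01, hC0⟩ := hν (β / ((k - l : ℕ) : ℝ)) (by positivity) (by
      rw [div_lt_one hkl', hklr]; linarith)
    refine ⟨C0 ^ (k - l) * C, ENNReal.mul_ne_top (ENNReal.pow_ne_top hC0top) hCtop, ?_⟩
    intro δ _ R _ _ hR loc hloc b x
    set loc' : R → Fin l → δ := fun r j => loc r j.castSucc with hloc'
    have hinj' : Function.Injective (fun p : R × Fin l => loc' p.1 p.2) := by
      rintro ⟨a, b⟩ ⟨a', b'⟩ h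
      have := hloc (a₁ := (a, b.castSucc)) (a₂ := (a', b'.castSucc)) h
      simpa using this
    set loc1 : R → δ := fun r => loc r (Fin.last l) with hloc1
    have hinj1 : Function.Injective loc1 := by
      intro a a' h
      have := hloc (a₁ := (a, Fin.last l)) (a₂ := (a', Fin.last l)) h
      simpa using this
    have hun : Finset.univ.image (fun p : R × Fin (l + 1) => loc p.1 p.2) =
        Finset.univ.image (fun p : R × Fin l => loc' p.1 p.2) ∪ Finset.univ.image loc1 := by
      ext e
      simp only [Finset.mem_image, Finset.mem_univ, true_and, Finset.mem_union, Prod.exists]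
      constructor
      · rintro ⟨r, j, rfl⟩
        refine Fin.lastCases ?_ (fun j => ?_) j
        · exact Or.inr ⟨r, rfl⟩
        · exact Or.inl ⟨r, j, rfl⟩
      · rintro (⟨r, j, rfl⟩ | ⟨r, rfl⟩)
        · exact ⟨r, _, rfl⟩
        · exact ⟨r, _, rfl⟩
    have hdis : Disjoint (Finset.univ.image (fun p : R × Fin l => loc' p.1 p.2)) (Finset.univ.image loc1) := by
      rw [Finset.disjoint_left]
      intro e he he'
      simp only [Finset.mem_image, Finset.mem_univ, true_and, Prod.exists] at he he'
      obtain ⟨r, j, rfl⟩ := he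
      obtain ⟨r', h'⟩ := he'
      have := hloc (a₁ := (r', Fin.last l)) (a₂ := (r, j.castSucc)) h'
      simp only [Prod.mk.injEq] at this
      exact (Fin.castSucc_lt_last j).ne this.2.symm
    have hm : ∀ (q : ℕ) (lc : R → Fin q → δ) (bb : R → Fin q → ℝ), Measurable (fun x : δ → ℝ => np (vol (Matrix.of fun r j => x (lc r j) + bb r j)) β) := by
      intro q lc bb
      refine measurable_np (measurable_vol ?_) _
      intro i j
      exact (measurable_pi_apply (lc i j)).add_const _
    rw [hun, lmarginal_union _ _ (hm _ _ _) hdis]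
    refine le_trans (lmarginal_mono (g := fun x => C0 ^ (k - l) *
      np (vol (Matrix.of fun r j => x (loc' r j) + b r (Fin.castSucc j))) β) ?_ x) ?_
    · intro x'
      set Z : Matrix R (Fin l) ℝ := Matrix.of fun r j => x' (loc' r j) + b r (Fin.castSucc j) with hZ
      by_cases hv : vol Z = 0
      · have : np (vol Z) β = ⊤ := by
          rw [hv]; simp [np, hβ]
        change _ ≤ C0 ^ (k - l) * np (vol Z) β
        rw [this, ENNReal.mul_top]
        · exact le_top
        · exact pow_ne_zero _ (by rintro rfl; simp at hC01)
      · have cs := colstep (R := R) ν hβ.le (ι := Fin l) (by simp; omega) (C0 := C0)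
          (by simpa [hR] using hC0) Z hv loc1 hinj1 (fun r => b r (Fin.last l)) x'
        simp only [Fintype.card_fin, hR] at cs
        refine le_trans (le_of_eq ?_) cs
        unfold lmarginal
        congr 1; ext y
        beta_reduce
        refine congrArg (fun v => np v β) ?_
        rw [← vol_col_equiv _ (finSumFinEquiv (m := l) (n := 1))]
        congr 1
        ext r (j | j)
        · have : loc r j.castSucc ∉ Finset.univ.image loc1 :=
            Finset.disjoint_left.1 hdis (Finset.mem_image.2 ⟨(r, j), Finset.mem_univ _, rfl⟩)
          have e1 : (finSumFinEquiv (Sum.inl j : Fin l ⊕ Fin 1)) = j.castSucc := rfl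
          simp only [submatrix_apply, e1, id, of_apply, fromCols_apply_inl, hZ, hloc']
          rw [Function.updateFinset, dif_neg this]
        · have e1 : (finSumFinEquiv (Sum.inr j : Fin l ⊕ Fin 1)) = Fin.last l := by
            ext; simp
          simp only [submatrix_apply, e1, id, of_apply, fromCols_apply_inr]
          rfl
    · rw [lmarg_const_mul ν (hm _ _ _)]
      gcongr
      exact hC δ R hR loc' hinj' _ x

end Marg

/-- Uniform probability measure on `[-r,r]`. -/
def unif (r : ℝ) : Measure ℝ := (ENNReal.ofReal (2 * r))⁻¹ • volume.restrict (Set.Icc (-r) r)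

lemma unif_prob {r : ℝ} (hr : 0 < r) : IsProbabilityMeasure (unif r) := by
  constructor
  have h2 : ENNReal.ofReal (2 * r) ≠ 0 := by simpa using hr
  simp only [unif, Measure.smul_apply, Measure.restrict_apply MeasurableSet.univ, Set.univ_inter, Real.volume_Icc, smul_eq_mul]
  rw [show r - -r = 2 * r by ring]
  exact ENNReal.inv_mul_cancel h2 ENNReal.ofReal_ne_top

lemma lint_np_fin {γ : ℝ} (h0 : 0 ≤ γ) (h1 : γ < 1) :
    ∫⁻ y in Set.Ioo (-1 : ℝ) 1, np |y| γ ≠ ⊤ := by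
  have hpos : ∫⁻ y in Set.Ioo (0 : ℝ) 1, np |y| γ ≠ ⊤ := by
    have hi : IntegrableOn (fun x : ℝ => x ^ (-γ)) (Set.Ioo (0:ℝ) 1) := by
      rw [← integrableOn_Ioc_iff_integrableOn_Ioo]
      have := (intervalIntegral.intervalIntegrable_rpow' (a := 0) (b := 1) (r := -γ) (by linarith)).1
      exact this
    have e : ∫⁻ y in Set.Ioo (0 : ℝ) 1, np |y| γ = ∫⁻ y in Set.Ioo (0 : ℝ) 1, ‖y ^ (-γ)‖ₑ := by
      refine setLIntegral_congr_fun measurableSet_Ioo fun y hy => ?_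
      beta_reduce
      rw [abs_of_pos hy.1, np_pos_eq hy.1, Real.enorm_of_nonneg (Real.rpow_nonneg hy.1.le _)]
    rw [e]
    exact hi.2.ne
  have hneg : ∫⁻ y in Set.Ioo (-1 : ℝ) 0, np |y| γ = ∫⁻ y in Set.Ioo (0 : ℝ) 1, np |y| γ := by
    have := (Measure.measurePreserving_neg (volume : Measure ℝ)).setLIntegral_comp_preimage (s := Set.Ioo (0:ℝ) 1)
      measurableSet_Ioo (f := fun y => np |y| γ) (measurable_np measurable_id.abs _)
    rw [← this]
    simp
  have hsub : Set.Ioo (-1 : ℝ) 1 ⊆ (Set.Ioo (-1 : ℝ) 0 ∪ Set.Ioo (0 : ℝ) 1) ∪ {0} := by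
    intro y hy
    rcases lt_trichotomy y 0 with h | h | h
    · exact Or.inl (Or.inl ⟨hy.1, h⟩)
    · exact Or.inr h
    · exact Or.inl (Or.inr ⟨h, hy.2⟩)
  refine ne_top_of_le_ne_top ?_ ((lintegral_mono_set hsub).trans ((lintegral_union_le _ _ _).trans
    (add_le_add (lintegral_union_le _ _ _) le_rfl)))
  rw [hneg]
  simp [hpos]

lemma good_unif {r : ℝ} (hr : 0 < r) : Good (unif r) := by
  intro γ h0 h1
  have h2 : ENNReal.ofReal (2 * r) ≠ 0 := by simpa using hr
  set I := ∫⁻ y in Set.Ioo (-1 : ℝ) 1, np |y| γ with hI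
  refine ⟨1 + (ENNReal.ofReal (2 * r))⁻¹ * I, ?_, le_self_add, fun c => ?_⟩
  · exact ENNReal.add_ne_top.2 ⟨by simp, ENNReal.mul_ne_top (ENNReal.inv_ne_top.2 h2) (lint_np_fin h0 h1)⟩
  have hb : ∀ x, np |x - c| γ ≤ 1 + (Set.Ioo (-1 : ℝ) 1).indicator (fun y => np |y| γ) (x - c) := by
    intro x
    by_cases hx : x - c ∈ Set.Ioo (-1 : ℝ) 1
    · rw [Set.indicator_of_mem hx]; exact le_add_self
    · rw [Set.indicator_of_notMem hx, add_zero]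
      have : 1 ≤ |x - c| := by
        by_contra hlt
        exact hx (abs_lt.1 (not_le.1 hlt))
      refine (np_anti h0 this).trans ?_
      simp [np]
  have hmp := (measurePreserving_sub_right (volume : Measure ℝ) c)
  have := hmp.lintegral_comp (f := (Set.Ioo (-1 : ℝ) 1).indicator (fun y => np |y| γ)) ((measurable_np measurable_id.abs _).indicator measurableSet_Ioo)
  rw [lintegral_indicator measurableSet_Ioo] at this
  unfold unif
  rw [lintegral_smul_measure]
  calc _ ≤ (ENNReal.ofReal (2 * r))⁻¹ • (∫⁻ x in Set.Icc (-r) r, (1 + (Set.Ioo (-1 : ℝ) 1).indicator (fun y => np |y| γ) (x - c))) := by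
        gcongr with x; exact hb x
    _ ≤ (ENNReal.ofReal (2 * r))⁻¹ • (ENNReal.ofReal (2 * r) + I) := by
        rw [lintegral_add_left measurable_const]
        gcongr
        · simp [two_mul]
        · rw [hI, ← this]
          exact setLIntegral_le_lintegral _ _
    _ = _ := by
        rw [smul_eq_mul, mul_add, ENNReal.inv_mul_cancel h2 ENNReal.ofReal_ne_top]

end KK

namespace KK

section Repl
variable {κ ι : Type*} [Fintype κ] [Fintype ι] [DecidableEq ι]

lemma det_repl (U : Matrix κ ι ℝ) (f : ι → κ) (hU : U.submatrix f id = 1) (p : ι → Prop) [DecidablePred p]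
    (τ : {j // p j} → κ) :
    (U.submatrix (fun j => if h : p j then τ ⟨j, h⟩ else f j) id).det =
      (Matrix.of fun (a b : {j // p j}) => U (τ a) b.1).det := by
  have hrow : ∀ i j, U (f i) j = (1 : Matrix ι ι ℝ) i j := fun i j => by rw [← hU]; rfl
  rw [Matrix.twoBlockTriangular_det _ p]
  · have e1 : (toSquareBlockProp (U.submatrix (fun j => if h : p j then τ ⟨j, h⟩ else f j) id) p) =
      (Matrix.of fun (a b : {j // p j}) => U (τ a) b.1) := by
      ext a b
      simp [toSquareBlockProp_def, a.2]
    have e2 : (toSquareBlockProp (U.submatrix (fun j => if h : p j then τ ⟨j, h⟩ else f j) id) (fun i => ¬ p i)) = 1 := by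
      ext a b
      simp [toSquareBlockProp_def, a.2, hrow, Matrix.one_apply, Subtype.ext_iff]
    rw [e1, e2]; simp
  · intro i hi j hj
    simp only [submatrix_apply, hi, dif_neg, not_false_iff, id, hrow]
    rw [Matrix.one_apply_ne]
    rintro rfl; exact hi hj

lemma vol_repl [DecidableEq κ] (U : Matrix κ ι ℝ) (f : ι → κ) (hU : U.submatrix f id = 1) (p : ι → Prop) [DecidablePred p]
    (τ : {j // p j} → κ) (w : κ → ℝ) (hw : ∀ k, 0 < w k) :
    (∏ j, w (if h : p j then τ ⟨j, h⟩ else f j)) * |(Matrix.of fun (a b : {j // p j}) => U (τ a) b.1).det| ≤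
      vol (diagonal w * U) := by
  have h1 := le_vol (diagonal w * U) (fun j => if h : p j then τ ⟨j, h⟩ else f j)
  have h2 : (diagonal w * U).submatrix (fun j => if h : p j then τ ⟨j, h⟩ else f j) id =
      diagonal (fun j => w (if h : p j then τ ⟨j, h⟩ else f j)) * (U.submatrix (fun j => if h : p j then τ ⟨j, h⟩ else f j) id) := by
    ext a b
    simp only [submatrix_apply, diagonal_mul, id]
  rw [h2, det_mul, det_repl U f hU, det_diagonal, abs_mul, abs_of_pos (Finset.prod_pos fun j _ => hw _)] at h1
  exact h1

end Repl

section Sumrows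
variable {m n i : ℕ}

/-- diagonal weights -/
def aD (m n : ℕ) (t : ℝ) : Fin m ⊕ Fin n → ℝ := Sum.elim (fun _ => Real.exp (t / m)) (fun _ => Real.exp (-(t / n)))

lemma aD_pos (t : ℝ) (k : Fin m ⊕ Fin n) : 0 < aD m n t k := by
  rcases k with k | k <;> exact Real.exp_pos _

/-- top rows not used by f -/
abbrev RR (f : Fin i → Fin m ⊕ Fin n) := {r : Fin m // ∀ j, f j ≠ Sum.inl r}
/-- columns with bottom pivot -/
abbrev I2 (f : Fin i → Fin m ⊕ Fin n) := {j : Fin i // (f j).isRight = true}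

lemma card_RR (f : Fin i → Fin m ⊕ Fin n) (hf : Function.Injective f) :
    Fintype.card (RR f) + i = m + Fintype.card (I2 f) := by
  classical
  have h1 : Fintype.card {j : Fin i // ¬ ((f j).isRight = true)} = Fintype.card {r : Fin m // ¬ (∀ j, f j ≠ Sum.inl r)} := by
    refine Fintype.card_congr (Equiv.ofBijective
      (fun j => ⟨(f j.1).getLeft (by simpa using j.2), ?_⟩) ⟨?_, ?_⟩)
    · push Not
      exact ⟨j.1, by simp⟩
    · intro a b hab
      have h := congrArg Subtype.val hab
      simp only at h
      have := congrArg (Sum.inl (β := Fin n)) h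
      simp only [Sum.inl_getLeft] at this
      exact Subtype.ext (hf this)
    · rintro ⟨r, hr⟩
      push Not at hr
      obtain ⟨j, hj⟩ := hr
      exact ⟨⟨j, by simp [hj]⟩, by simp [hj]⟩
  have h2 := Fintype.card_subtype_compl (fun j : Fin i => (f j).isRight = true)
  have h3 := Fintype.card_subtype_compl (fun r : Fin m => ∀ j, f j ≠ Sum.inl r)
  have h4 := Fintype.card_subtype_le (fun j : Fin i => (f j).isRight = true)
  have h5 := Fintype.card_subtype_le (fun r : Fin m => ∀ j, f j ≠ Sum.inl r)
  simp only [Fintype.card_fin] at *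
  simp only [← Nat.card_eq_fintype_card, RR, I2] at *
  omega

/-- the Z block -/
def ZZ (f : Fin i → Fin m ⊕ Fin n) (U : Matrix (Fin m ⊕ Fin n) (Fin i) ℝ) : Matrix (RR f) (I2 f) ℝ :=
  Matrix.of fun r j => U (Sum.inl r.1) j.1

lemma vol_ge_small (f : Fin i → Fin m ⊕ Fin n) (U : Matrix (Fin m ⊕ Fin n) (Fin i) ℝ)
    (hU : U.submatrix f id = 1) (t : ℝ) :
    Real.exp (i * t / m) * vol (ZZ f U) ≤ vol (diagonal (aD m n t) * U) := by
  rw [← le_div_iff₀' (Real.exp_pos _)]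
  refine vol_le _ (div_nonneg (vol_nonneg _) (Real.exp_pos _).le) fun ρ => ?_
  rw [le_div_iff₀' (Real.exp_pos _)]
  refine le_trans (le_of_eq ?_) (vol_repl U f hU (fun j => (f j).isRight = true) (fun j => Sum.inl (ρ j).1) _ (aD_pos t))
  congr 1
  have : ∀ j, aD m n t (if h : (f j).isRight = true then Sum.inl (ρ ⟨j, h⟩).1 else f j) = Real.exp (t / m) := by
    intro j
    split_ifs with h
    · rfl
    · rcases hfj : f j with a | a
      · rfl
      · simp [hfj] at h
  rw [Finset.prod_congr rfl fun j _ => this j]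
  rw [Finset.prod_const, Finset.card_univ, Fintype.card_fin, ← Real.exp_nat_mul, mul_div_assoc]

lemma vol_ge_large (f : Fin i → Fin m ⊕ Fin n) (hf : Function.Injective f) (U : Matrix (Fin m ⊕ Fin n) (Fin i) ℝ)
    (hm : 0 < m) (hn : 0 < n) (hU : U.submatrix f id = 1) (t : ℝ) :
    Real.exp (((m : ℝ) + n - i) * t / n) * vol (ZZ f U)ᵀ ≤ vol (diagonal (aD m n t) * U) := by
  classical
  rw [← le_div_iff₀' (Real.exp_pos _)]
  refine vol_le _ (div_nonneg (vol_nonneg _) (Real.exp_pos _).le) fun σ => ?_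
  rw [le_div_iff₀' (Real.exp_pos _)]
  by_cases hσ : Function.Injective σ
  swap
  · have : ((ZZ f U)ᵀ.submatrix σ id).det = 0 := by
      by_contra h
      exact hσ (inj_of_det_ne h)
    rw [this, abs_zero, mul_zero]; exact vol_nonneg _
  let p : Fin i → Prop := fun j => ∃ r, (σ r).1 = j
  let e : RR f ≃ {j // p j} := Equiv.ofBijective (fun r => ⟨(σ r).1, r, rfl⟩)
    ⟨fun a b h => hσ (Subtype.ext (congrArg (fun z => z.1) h)), by
      rintro ⟨j, r, rfl⟩; exact ⟨r, rfl⟩⟩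
  refine le_trans (le_of_eq ?_) (vol_repl U f hU p (fun j => Sum.inl (e.symm j).1) _ (aD_pos t))
  congr 1
  ·
    have hval : ∀ j, aD m n t (if h : p j then Sum.inl (e.symm ⟨j, h⟩).1 else f j) =
        Real.exp (-(t / n)) * ((if p j then Real.exp (t / m + t / n) else 1) *
          (if ¬ ((f j).isRight = true) then Real.exp (t / m + t / n) else 1)) := by
      intro j
      by_cases h : p j
      · have hr : (f j).isRight = true := by
          obtain ⟨r, rfl⟩ := h; exact (σ r).2
        simp only [h, dif_pos, if_true, hr, not_true, if_false, mul_one, aD, Sum.elim_inl, ← Real.exp_add]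
        congr 1; ring
      · rcases hfj : f j with a | a
        · simp only [h, dif_neg, not_false_iff, hfj, if_false, Sum.isRight_inl, aD, Sum.elim_inl, one_mul, Bool.false_eq_true, if_true, ← Real.exp_add]
          congr 1; ring
        · simp only [h, dif_neg, not_false_iff, hfj, if_false, Sum.isRight_inr, aD, Sum.elim_inr, mul_one, not_true]
    rw [Finset.prod_congr rfl fun j _ => hval j, Finset.prod_mul_distrib, Finset.prod_mul_distrib,
      Finset.prod_ite, Finset.prod_ite]
    simp only [Finset.prod_const, Finset.prod_const_one, mul_one, one_pow, Finset.card_univ, Fintype.card_fin]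
    have c1 : (Finset.univ.filter fun j => p j).card = Fintype.card (RR f) := by
      rw [← Fintype.card_subtype]; exact (Fintype.card_congr e).symm
    have c2 : (Finset.univ.filter fun j => ¬ ((f j).isRight = true)).card + Fintype.card (I2 f) = i := by
      have := Fintype.card_subtype_compl (fun j : Fin i => (f j).isRight = true)
      have h4 := Fintype.card_subtype_le (fun j : Fin i => (f j).isRight = true)
      rw [← Fintype.card_subtype]
      simp only [Fintype.card_fin] at *
      simp only [← Nat.card_eq_fintype_card, I2] at *
      omega
    have c3 := card_RR f hf
    have c4 : (Finset.univ.filter fun j => p j).card + (Finset.univ.filter fun j => ¬ ((f j).isRight = true)).card = m := by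
      omega
    rw [← pow_add, c4, ← Real.exp_nat_mul, ← Real.exp_nat_mul, ← Real.exp_add]
    congr 1
    have : (m : ℝ) ≠ 0 := by positivity
    have : (n : ℝ) ≠ 0 := by positivity
    field_simp
    ring
  · congr 1
    rw [← det_submatrix_equiv_self e, ← det_transpose]
    congr 1
    ext a b
    have he : ((e b).1 : Fin i) = (σ b).1 := rfl
    simp [ZZ, he]

end Sumrows
end KK

namespace KK

section UAs
variable {m n i : ℕ}

/-- unipotent in sum coordinates -/
def UA (A : Fin m × Fin n → ℝ) : Matrix (Fin m ⊕ Fin n) (Fin m ⊕ Fin n) ℝ :=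
  fromBlocks 1 (Matrix.of fun a b => A (a, b)) 0 1

lemma UA_inl (A : Fin m × Fin n → ℝ) (W : Matrix (Fin m ⊕ Fin n) (Fin i) ℝ) (r c) :
    (UA A * W) (Sum.inl r) c = W (Sum.inl r) c + ∑ b, A (r, b) * W (Sum.inr b) c := by
  simp [UA, Matrix.mul_apply, Fintype.sum_sum_type, Matrix.one_apply]

lemma UA_inr (A : Fin m × Fin n → ℝ) (W : Matrix (Fin m ⊕ Fin n) (Fin i) ℝ) (r c) :
    (UA A * W) (Sum.inr r) c = W (Sum.inr r) c := by
  simp [UA, Matrix.mul_apply, Fintype.sum_sum_type, Matrix.one_apply]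

/-- bottom index -/
def bot (f : Fin i → Fin m ⊕ Fin n) (j : I2 f) : Fin n := (f j.1).getRight j.2

lemma inr_bot (f : Fin i → Fin m ⊕ Fin n) (j : I2 f) : Sum.inr (bot f j) = f j.1 := by
  simp [bot]

/-- integrated coordinates -/
def TT (f : Fin i → Fin m ⊕ Fin n) : Finset (Fin m × Fin n) :=
  Finset.univ.image (fun p : RR f × I2 f => (p.1.1, bot f p.2))

/-- pivot block -/
def EE (f : Fin i → Fin m ⊕ Fin n) (W : Matrix (Fin m ⊕ Fin n) (Fin i) ℝ) (A : Fin m × Fin n → ℝ) :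
    Matrix (Fin i) (Fin i) ℝ := (UA A * W).submatrix f id

/-- zeroed -/
def zer (f : Fin i → Fin m ⊕ Fin n) (A : Fin m × Fin n → ℝ) : Fin m × Fin n → ℝ :=
  fun e => if e ∈ TT f then 0 else A e

lemma EE_zer (f : Fin i → Fin m ⊕ Fin n) (W : Matrix (Fin m ⊕ Fin n) (Fin i) ℝ) (A : Fin m × Fin n → ℝ) :
    EE f W (zer f A) = EE f W A := by
  ext a c
  unfold EE
  simp only [submatrix_apply, id]
  rcases hfa : f a with r | b
  · rw [UA_inl, UA_inl]
    congr 1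
    refine Finset.sum_congr rfl fun b _ => ?_
    have : (r, b) ∉ TT f := by
      intro h
      obtain ⟨⟨r', j⟩, -, h⟩ := Finset.mem_image.1 h
      simp only [Prod.mk.injEq] at h
      exact r'.2 a (by rw [hfa, h.1])
    simp [zer, this]
  · rw [UA_inr, UA_inr]

lemma EE_near (f : Fin i → Fin m ⊕ Fin n) (W : Matrix (Fin m ⊕ Fin n) (Fin i) ℝ) (hWf : W.submatrix f id = 1)
    (hW : ∀ a b, |W a b| ≤ 1) (A : Fin m × Fin n → ℝ) {r : ℝ} (hr : 0 ≤ r) (hA : ∀ e, |A e| ≤ r) (a b) :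
    |EE f W A a b - (1 : Matrix (Fin i) (Fin i) ℝ) a b| ≤ n * r := by
  rw [← hWf]
  unfold EE
  simp only [submatrix_apply, id]
  rcases hfa : f a with q | q
  · rw [UA_inl, add_sub_cancel_left]
    refine (Finset.abs_sum_le_sum_abs _ _).trans ?_
    refine (Finset.sum_le_card_nsmul _ _ r fun b' _ => ?_).trans (by simp)
    rw [abs_mul]
    calc _ ≤ r * 1 := mul_le_mul (hA _) (hW _ _) (abs_nonneg _) hr
      _ = r := mul_one r
  · rw [UA_inr]; simp; positivity

lemma ZZ_formula (f : Fin i → Fin m ⊕ Fin n) (hf : Function.Injective f) (W : Matrix (Fin m ⊕ Fin n) (Fin i) ℝ) (hWf : W.submatrix f id = 1)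
    (A : Fin m × Fin n → ℝ) (hE : IsUnit (EE f W A).det) (r : RR f) (j : I2 f) :
    ZZ f (UA A * W * (EE f W A)⁻¹) r j = A (r.1, bot f j) +
      ZZ f (UA (zer f A) * W * (EE f W (zer f A))⁻¹) r j := by
  rw [EE_zer]
  have hWf' : ∀ a c, W (f a) c = (1 : Matrix (Fin i) (Fin i) ℝ) a c := fun a c => by rw [← hWf]; rfl
  have hmem : ∀ b, (r.1, b) ∈ TT f → ∃ j' : I2 f, bot f j' = b := by
    intro b h
    obtain ⟨⟨r', j'⟩, -, h⟩ := Finset.mem_image.1 h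
    simp only [Prod.mk.injEq] at h
    exact ⟨j', h.2⟩
  have hrow : ∀ j' : I2 f, ∀ k, ∑ c, W (Sum.inr (bot f j')) c * (EE f W A)⁻¹ c k = W (Sum.inr (bot f j')) k := by
    intro j' k
    have h1 : ((EE f W A) * (EE f W A)⁻¹) j'.1 k = (1 : Matrix (Fin i) (Fin i) ℝ) j'.1 k := by
      rw [Matrix.mul_nonsing_inv _ hE]
    rw [Matrix.mul_apply] at h1
    rw [inr_bot, hWf' j'.1 k, ← h1]
    refine Finset.sum_congr rfl fun c _ => ?_
    congr 1
    unfold EE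
    rw [submatrix_apply, ← inr_bot f j', UA_inr]; rfl
  have hd : ∀ c, (UA A * W) (Sum.inl r.1) c = (UA (zer f A) * W) (Sum.inl r.1) c +
      ∑ b, (A (r.1, b) - zer f A (r.1, b)) * W (Sum.inr b) c := by
    intro c
    rw [UA_inl, UA_inl, add_assoc, ← Finset.sum_add_distrib]
    congr 1
    refine Finset.sum_congr rfl fun b _ => ?_
    ring
  have h2 : ∑ c, (∑ b, (A (r.1, b) - zer f A (r.1, b)) * W (Sum.inr b) c) * (EE f W A)⁻¹ c j.1 = A (r.1, bot f j) := by
    simp only [Finset.sum_mul]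
    rw [Finset.sum_comm]
    have h3 : ∀ b, ∑ c, (A (r.1, b) - zer f A (r.1, b)) * W (Sum.inr b) c * (EE f W A)⁻¹ c j.1 =
        (A (r.1, b) - zer f A (r.1, b)) * W (Sum.inr b) j.1 := by
      intro b
      by_cases hb : (r.1, b) ∈ TT f
      · obtain ⟨j', rfl⟩ := hmem b hb
        simp only [mul_assoc]
        rw [← Finset.mul_sum, hrow]
      · simp [zer, hb]
    rw [Finset.sum_congr rfl fun b _ => h3 b]
    rw [Finset.sum_eq_single (bot f j)]
    · have : (r.1, bot f j) ∈ TT f := Finset.mem_image.2 ⟨(r, j), Finset.mem_univ _, rfl⟩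
      rw [inr_bot, hWf']
      simp [zer, this]
    · intro b _ hb
      by_cases hb' : (r.1, b) ∈ TT f
      · obtain ⟨j', rfl⟩ := hmem b hb'
        rw [inr_bot, hWf', Matrix.one_apply_ne, mul_zero]
        intro h
        exact hb (congrArg (bot f) (Subtype.ext h))
      · simp [zer, hb']
    · simp
  simp only [ZZ, of_apply]
  rw [Matrix.mul_apply, Matrix.mul_apply (M := UA (zer f A) * W)]
  simp only [hd, add_mul, Finset.sum_add_distrib]
  rw [h2, add_comm]

lemma vol_lower (f : Fin i → Fin m ⊕ Fin n) (W : Matrix (Fin m ⊕ Fin n) (Fin i) ℝ)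
    (A : Fin m × Fin n → ℝ) (hE : 1 / 2 ≤ |(EE f W A).det|) (w : Fin m ⊕ Fin n → ℝ) :
    (UA A * W * (EE f W A)⁻¹).submatrix f id = 1 ∧
    1 / 2 * vol (diagonal w * (UA A * W * (EE f W A)⁻¹)) ≤ vol (diagonal w * (UA A * W)) := by
  have hu : IsUnit (EE f W A).det := by
    rw [isUnit_iff_ne_zero]; intro h; rw [h] at hE; norm_num at hE
  constructor
  · have : (UA A * W * (EE f W A)⁻¹).submatrix f id = EE f W A * (EE f W A)⁻¹ := rfl
    rw [this, Matrix.mul_nonsing_inv _ hu]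
  · have h1 : diagonal w * (UA A * W) = diagonal w * (UA A * W * (EE f W A)⁻¹) * EE f W A := by
      rw [Matrix.mul_assoc, Matrix.mul_assoc (UA A * W), Matrix.nonsing_inv_mul _ hu, Matrix.mul_one]
    conv_rhs => rw [h1, vol_mul_right]
    rw [mul_comm]
    exact mul_le_mul_of_nonneg_left hE (vol_nonneg _)

/-- the exponent -/
def kap (m n i : ℕ) : ℝ := if i ≤ m then (i : ℝ) / m else ((m : ℝ) + n - i) / n

/-- the box -/
def bx (m n : ℕ) (r : ℝ) : Set (Fin m × Fin n → ℝ) := {A | ∀ e, |A e| ≤ r}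

lemma meas_bx (r : ℝ) : MeasurableSet (bx m n r) := by
  have : bx m n r = ⋂ e, {A | |A e| ≤ r} := by ext; simp [bx]
  rw [this]
  exact MeasurableSet.iInter fun e => measurableSet_le (measurable_pi_apply e).abs measurable_const

lemma meas_F (β t : ℝ) (W : Matrix (Fin m ⊕ Fin n) (Fin i) ℝ) :
    Measurable (fun A : Fin m × Fin n → ℝ => np (vol (diagonal (aD m n t) * (UA A * W))) β) := by
  refine measurable_np (measurable_vol ?_) _
  rintro (a | a) c
  · simp only [diagonal_mul, UA_inl]
    refine Measurable.const_mul (measurable_const.add (Finset.measurable_sum _ fun b _ => ?_)) _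
    exact (measurable_pi_apply _).mul_const _
  · simp only [diagonal_mul, UA_inr]
    exact measurable_const

lemma card_I2_le (f : Fin i → Fin m ⊕ Fin n) : Fintype.card (I2 f) ≤ i := by
  simpa using Fintype.card_subtype_le (fun j : Fin i => (f j).isRight = true)

lemma bot_inj (f : Fin i → Fin m ⊕ Fin n) (hf : Function.Injective f) : Function.Injective (bot f) := by
  intro a b h
  have := congrArg (Sum.inr (α := Fin m)) h
  rw [inr_bot, inr_bot] at this
  exact Subtype.ext (hf this)

lemma zer_update (f : Fin i → Fin m ⊕ Fin n) (x : Fin m × Fin n → ℝ) (y) :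
    zer f (Function.updateFinset x (TT f) y) = zer f x := by
  ext e
  unfold zer
  split_ifs with h
  · rfl
  · simp [Function.updateFinset, h]

lemma expect_inner {r β : ℝ} (hr : 0 < r) (hm : 0 < m) (hn : 0 < n) (hβ : 0 < β)
    (hβ2 : β < |(m : ℝ) - i| + 1)
    (hdet : ∀ E : Matrix (Fin i) (Fin i) ℝ, (∀ a b, |E a b - (1 : Matrix (Fin i) (Fin i) ℝ) a b| ≤ n * r) → 1 / 2 ≤ |E.det|)
    (f : Fin i → Fin m ⊕ Fin n) (hf : Function.Injective f) :
    ∃ C : ℝ≥0∞, C ≠ ⊤ ∧ ∀ (W : Matrix (Fin m ⊕ Fin n) (Fin i) ℝ), W.submatrix f id = 1 → (∀ a b, |W a b| ≤ 1) →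
      ∀ t x, lmarginal (fun _ => unif r) (TT f) ((bx m n r).indicator (fun A => np (vol (diagonal (aD m n t) * (UA A * W))) β)) x ≤
        C * np (Real.exp (kap m n i * t)) β := by
  have := unif_prob hr
  have hg := good_unif hr
  have hcard := card_RR f hf
  have hpt : ∀ (W : Matrix (Fin m ⊕ Fin n) (Fin i) ℝ), W.submatrix f id = 1 → (∀ a b, |W a b| ≤ 1) →
      ∀ A ∈ bx m n r, IsUnit (EE f W A).det ∧ 1 / 2 ≤ |(EE f W A).det| := by
    intro W h1 h2 A hA
    have := hdet (EE f W A) (EE_near f W h1 h2 A hr.le hA)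
    refine ⟨?_, this⟩
    rw [isUnit_iff_ne_zero]; intro h; rw [h] at this; norm_num at this
  rcases le_total i m with him | him
  ·
    have hkap : kap m n i = i / m := by simp [kap, him]
    obtain ⟨C, hCt, hC⟩ := minor_integral (unif r) hg hβ (Fintype.card (RR f)) (Fintype.card (I2 f)) (by omega) (by
      have h1 : ((Fintype.card (RR f) : ℝ)) + i = m + Fintype.card (I2 f) := by exact_mod_cast hcard
      have h2 : (i : ℝ) ≤ m := by exact_mod_cast him
      rw [abs_of_nonneg (by linarith)] at hβ2
      linarith)
    refine ⟨np (1/2) β * C, ENNReal.mul_ne_top (by rw [np_pos_eq (by norm_num)]; exact ENNReal.ofReal_ne_top) hCt, ?_⟩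
    intro W hW1 hW2 t x
    let eI := (Fintype.equivFin (I2 f)).symm
    let b : RR f → Fin (Fintype.card (I2 f)) → ℝ := fun r j => ZZ f (UA (zer f x) * W * (EE f W (zer f x))⁻¹) r (eI j)
    have hC' := hC (Fin m × Fin n) (RR f) rfl (fun r j => (r.1, bot f (eI j))) (by
      rintro ⟨a, b⟩ ⟨a', b'⟩ h
      simp only [Prod.mk.injEq] at h
      have := eI.injective (bot_inj f hf h.2)
      exact Prod.ext (Subtype.ext h.1) this) b x
    have hT : Finset.univ.image (fun p : RR f × Fin (Fintype.card (I2 f)) => (p.1.1, bot f (eI p.2))) = TT f := by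
      ext e
      simp only [TT, Finset.mem_image, Finset.mem_univ, true_and, Prod.exists]
      constructor
      · rintro ⟨a, b, rfl⟩; exact ⟨a, eI b, rfl⟩
      · rintro ⟨a, b, rfl⟩; exact ⟨a, eI.symm b, by simp⟩
    rw [hT] at hC'
    have key : ∀ y, (bx m n r).indicator (fun A => np (vol (diagonal (aD m n t) * (UA A * W))) β) (Function.updateFinset x (TT f) y) ≤
        (np (1/2) β * np (Real.exp (kap m n i * t)) β) * np (vol (Matrix.of fun r j => (Function.updateFinset x (TT f) y) (r.1, bot f (eI j)) + b r j)) β := by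
      intro y
      set A := Function.updateFinset x (TT f) y with hA
      by_cases hAb : A ∈ bx m n r
      · rw [Set.indicator_of_mem hAb]
        obtain ⟨hu, hh⟩ := hpt W hW1 hW2 A hAb
        obtain ⟨v1, v2⟩ := vol_lower f W A hh (aD m n t)
        have v3 := vol_ge_small f _ v1 t
        have hz : (Matrix.of fun r j => A (r.1, bot f (eI j)) + b r j) = (ZZ f (UA A * W * (EE f W A)⁻¹)).submatrix id eI := by
          ext r j
          rw [submatrix_apply, id, ZZ_formula f hf W hW1 A hu, hA, zer_update]; rfl
        rw [hz, vol_col_equiv, ← np_mul (by norm_num), ← np_mul (by positivity)]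
        refine np_anti hβ.le (le_trans ?_ v2)
        rw [mul_assoc, hkap, div_mul_eq_mul_div _ _ t]
        linarith
      · rw [Set.indicator_of_notMem hAb]; exact zero_le
    calc _ ≤ lmarginal (fun _ => unif r) (TT f) (fun A => (np (1/2) β * np (Real.exp (kap m n i * t)) β) * np (vol (Matrix.of fun r j => A (r.1, bot f (eI j)) + b r j)) β) x :=
          lintegral_mono key
      _ = (np (1/2) β * np (Real.exp (kap m n i * t)) β) * _ := lmarg_const_mul _ (by
          refine measurable_np (measurable_vol fun i j => ?_) _
          exact (measurable_pi_apply _).add_const _)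
      _ ≤ (np (1/2) β * np (Real.exp (kap m n i * t)) β) * C := by gcongr
      _ = _ := by ring
  ·
    have hkap : kap m n i = ((m : ℝ) + n - i) / n := by
      unfold kap
      split_ifs with h
      · have : i = m := le_antisymm h him
        subst this
        have : (i : ℝ) ≠ 0 := by positivity
        have : (n : ℝ) ≠ 0 := by positivity
        field_simp; ring
      · rfl
    obtain ⟨C, hCt, hC⟩ := minor_integral (unif r) hg hβ (Fintype.card (I2 f)) (Fintype.card (RR f)) (by omega) (by
      have h1 : ((Fintype.card (RR f) : ℝ)) + i = m + Fintype.card (I2 f) := by exact_mod_cast hcard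
      have h2 : (m : ℝ) ≤ i := by exact_mod_cast him
      rw [abs_of_nonpos (by linarith)] at hβ2
      linarith)
    refine ⟨np (1/2) β * C, ENNReal.mul_ne_top (by rw [np_pos_eq (by norm_num)]; exact ENNReal.ofReal_ne_top) hCt, ?_⟩
    intro W hW1 hW2 t x
    let eI := (Fintype.equivFin (RR f)).symm
    let b : I2 f → Fin (Fintype.card (RR f)) → ℝ := fun j r => ZZ f (UA (zer f x) * W * (EE f W (zer f x))⁻¹) (eI r) j
    have hC' := hC (Fin m × Fin n) (I2 f) rfl (fun j r => ((eI r).1, bot f j)) (by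
      rintro ⟨a, b⟩ ⟨a', b'⟩ h
      simp only [Prod.mk.injEq] at h
      exact Prod.ext (bot_inj f hf h.2) (eI.injective (Subtype.ext h.1))) b x
    have hT : Finset.univ.image (fun p : I2 f × Fin (Fintype.card (RR f)) => ((eI p.2).1, bot f p.1)) = TT f := by
      ext e
      simp only [TT, Finset.mem_image, Finset.mem_univ, true_and, Prod.exists]
      constructor
      · rintro ⟨a, b, rfl⟩; exact ⟨eI b, a, rfl⟩
      · rintro ⟨a, b, rfl⟩; exact ⟨b, eI.symm a, by simp⟩
    rw [hT] at hC'
    have key : ∀ y, (bx m n r).indicator (fun A => np (vol (diagonal (aD m n t) * (UA A * W))) β) (Function.updateFinset x (TT f) y) ≤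
        (np (1/2) β * np (Real.exp (kap m n i * t)) β) * np (vol (Matrix.of fun j r => (Function.updateFinset x (TT f) y) ((eI r).1, bot f j) + b j r)) β := by
      intro y
      set A := Function.updateFinset x (TT f) y with hA
      by_cases hAb : A ∈ bx m n r
      · rw [Set.indicator_of_mem hAb]
        obtain ⟨hu, hh⟩ := hpt W hW1 hW2 A hAb
        obtain ⟨v1, v2⟩ := vol_lower f W A hh (aD m n t)
        have v3 := vol_ge_large f hf _ hm hn v1 t
        have hz : (Matrix.of fun j r => A ((eI r).1, bot f j) + b j r) = (ZZ f (UA A * W * (EE f W A)⁻¹))ᵀ.submatrix id eI := by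
          ext j r
          rw [submatrix_apply, transpose_apply, id, ZZ_formula f hf W hW1 A hu, hA, zer_update]; rfl
        rw [hz, vol_col_equiv, ← np_mul (by norm_num), ← np_mul (by positivity)]
        refine np_anti hβ.le (le_trans ?_ v2)
        rw [mul_assoc, hkap, div_mul_eq_mul_div _ _ t]
        linarith
      · rw [Set.indicator_of_notMem hAb]; exact zero_le
    calc _ ≤ lmarginal (fun _ => unif r) (TT f) (fun A => (np (1/2) β * np (Real.exp (kap m n i * t)) β) * np (vol (Matrix.of fun j r => A ((eI r).1, bot f j) + b j r)) β) x :=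
          lintegral_mono key
      _ = (np (1/2) β * np (Real.exp (kap m n i * t)) β) * _ := lmarg_const_mul _ (by
          refine measurable_np (measurable_vol fun i j => ?_) _
          exact (measurable_pi_apply _).add_const _)
      _ ≤ (np (1/2) β * np (Real.exp (kap m n i * t)) β) * C := by gcongr
      _ = _ := by ring

lemma expect {r β : ℝ} (hr : 0 < r) (hm : 0 < m) (hn : 0 < n) (hβ : 0 < β)
    (hβ2 : β < |(m : ℝ) - i| + 1)
    (hdet : ∀ E : Matrix (Fin i) (Fin i) ℝ, (∀ a b, |E a b - (1 : Matrix (Fin i) (Fin i) ℝ) a b| ≤ n * r) → 1 / 2 ≤ |E.det|) :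
    ∃ C : ℝ≥0∞, C ≠ ⊤ ∧ ∀ (W : Matrix (Fin m ⊕ Fin n) (Fin i) ℝ), vol W ≠ 0 →
      ∀ t, ∫⁻ A in bx m n r, np (vol (diagonal (aD m n t) * (UA A * W))) β ∂(Measure.pi fun _ => unif r) ≤
        C * np (Real.exp (kap m n i * t)) β * np (vol W) β := by
  classical
  have := unif_prob hr
  have := fun f : {f : Fin i → Fin m ⊕ Fin n // Function.Injective f} => expect_inner hr hm hn hβ hβ2 hdet f.1 f.2
  choose C hCt hC using this
  refine ⟨∑ f, C f, by simp [hCt], ?_⟩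
  intro W hW t
  obtain ⟨f, P, hPf, hP, hWP, hfd⟩ := exists_normal W hW
  have hfi : Function.Injective f := inj_of_det_ne (M := W) (f := f) (fun h0 => by
    rw [h0] at hfd; simp at hfd; exact hW hfd.symm)
  have h1 : ∀ A : Fin m × Fin n → ℝ, np (vol (diagonal (aD m n t) * (UA A * W))) β =
      np (vol W) β * np (vol (diagonal (aD m n t) * (UA A * P))) β := by
    intro A
    conv_lhs => rw [hWP]
    rw [← Matrix.mul_assoc, ← Matrix.mul_assoc, vol_mul_right, hfd, Matrix.mul_assoc, mul_comm, np_mul (vol_nonneg _)]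
  simp only [h1]
  rw [lintegral_const_mul _ (meas_F _ _ _), mul_comm]
  gcongr
  have hmi : Measurable ((bx m n r).indicator (fun A => np (vol (diagonal (aD m n t) * (UA A * P))) β)) :=
    (meas_F _ _ _).indicator (meas_bx r)
  rw [← lintegral_indicator (meas_bx r), lintegral_eq_lmarginal_univ (fun _ => 0)]
  have hu : (Finset.univ : Finset (Fin m × Fin n)) = (TT f)ᶜ ∪ TT f := by
    rw [Finset.union_comm, Finset.union_compl]
  rw [hu, lmarginal_union _ _ hmi disjoint_compl_left]
  refine lmarg_le _ fun y => ?_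
  refine (hC ⟨f, hfi⟩ P hPf hP t _).trans ?_
  gcongr
  exact Finset.single_le_sum (f := C) (fun _ _ => zero_le) (Finset.mem_univ _)

lemma exists_r (m n : ℕ) : ∃ r : ℝ, 0 < r ∧ r ≤ 1 ∧ ∀ i ≤ m + n, ∀ E : Matrix (Fin i) (Fin i) ℝ,
    (∀ a b, |E a b - (1 : Matrix (Fin i) (Fin i) ℝ) a b| ≤ n * r) → 1 / 2 ≤ |E.det| := by
  have h1 : ∀ i : ℕ, ∃ ε : ℝ, 0 < ε ∧ ∀ E : Matrix (Fin i) (Fin i) ℝ,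
    (∀ a b, |E a b - (1 : Matrix (Fin i) (Fin i) ℝ) a b| ≤ ε) → 1 / 2 ≤ |E.det| := by
    intro i
    have hc : Continuous (fun E : Fin i → Fin i → ℝ => |(Matrix.of E).det|) := by
      have : Continuous (fun E : Fin i → Fin i → ℝ => (Matrix.of E : Matrix (Fin i) (Fin i) ℝ)) := continuous_id
      exact (this.matrix_det).abs
    have h2 : ∀ᶠ E in 𝓝 (fun a b => (1 : Matrix (Fin i) (Fin i) ℝ) a b), 1 / 2 < |(Matrix.of E : Matrix (Fin i) (Fin i) ℝ).det| := by
      refine hc.continuousAt.eventually (lt_mem_nhds ?_)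
      have : (Matrix.of fun a b => (1 : Matrix (Fin i) (Fin i) ℝ) a b) = 1 := rfl
      beta_reduce
      rw [this]; norm_num
    obtain ⟨ε, hε, h3⟩ := Metric.eventually_nhds_iff.1 h2
    refine ⟨ε / 2, by positivity, fun E hE => (h3 (y := E) ?_).le⟩
    refine lt_of_le_of_lt ((dist_pi_le_iff (by positivity)).2 fun a => (dist_pi_le_iff (by positivity)).2 fun b => ?_) (half_lt_self hε)
    rw [Real.dist_eq]; exact hE a b
  choose ε hε h2 using h1
  have hne : (Finset.range (m + n + 1)).Nonempty := ⟨0, by simp⟩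
  obtain ⟨i0, -, hi0⟩ := Finset.exists_min_image (Finset.range (m + n + 1)) ε hne
  refine ⟨min 1 (ε i0 / (n + 1)), lt_min one_pos (div_pos (hε _) (by positivity)), min_le_left _ _, fun i hi E hE => h2 i E fun a b => (hE a b).trans ?_⟩
  have h3 := hi0 i (Finset.mem_range.2 (by omega))
  calc (n : ℝ) * min 1 (ε i0 / (n + 1)) ≤ (n + 1) * (ε i0 / (n + 1)) := by
        have := hε i0
        have h5 : (0:ℝ) ≤ min 1 (ε i0 / (n + 1)) := le_min zero_le_one (by positivity)
        exact mul_le_mul (by linarith) (min_le_right _ _) h5 (by positivity)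
    _ = ε i0 := by field_simp
    _ ≤ ε i := h3

end UAs
end KK

namespace KK

lemma vol_ne_of_inv {κ ι : Type*} [Fintype κ] [DecidableEq κ] [Fintype ι] [DecidableEq ι] (h h' : Matrix κ κ ℝ)
    (hh : h' * h = 1) (M : Matrix κ ι ℝ) (hM : vol M ≠ 0) : vol (h * M) ≠ 0 := by
  obtain ⟨c, hc0, hc⟩ := exists_bound h'
  have := vol_mul_left h' (h * M) hc hc0
  rw [← Matrix.mul_assoc, hh, Matrix.one_mul] at this
  intro h0
  rw [h0, mul_zero] at this
  exact hM (le_antisymm this (vol_nonneg _))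

section Grid
variable {m n i : ℕ}

lemma UA_add (A B : Fin m × Fin n → ℝ) : UA (A + B) = UA A * UA B := by
  unfold UA
  rw [fromBlocks_multiply]
  simp only [Matrix.one_mul, Matrix.mul_one, Matrix.mul_zero, Matrix.zero_mul, add_zero, zero_add]
  congr 1
  ext a b; simp [add_comm]

lemma UA_zero : UA (0 : Fin m × Fin n → ℝ) = 1 := by
  unfold UA
  rw [← fromBlocks_one]
  congr 1

/-- lambda -/
def lam (m n : ℕ) : ℝ := 1 / (m : ℝ) + 1 / n

lemma aD_UA (t : ℝ) (B : Fin m × Fin n → ℝ) :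
    diagonal (aD m n t) * UA B = UA (Real.exp (lam m n * t) • B) * diagonal (aD m n t) := by
  unfold UA aD
  rw [← fromBlocks_diagonal, fromBlocks_multiply, fromBlocks_multiply]
  simp only [Matrix.one_mul, Matrix.mul_one, Matrix.mul_zero, Matrix.zero_mul, add_zero, zero_add]
  congr 1
  ext a b
  simp only [diagonal_mul, mul_diagonal, of_apply, Pi.smul_apply, smul_eq_mul]
  rw [mul_right_comm, ← Real.exp_add]
  congr 2
  unfold lam
  ring

lemma UA_entry {A : Fin m × Fin n → ℝ} (hA : ∀ e, |A e| ≤ 1) (a b) : |UA A a b| ≤ 1 := by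
  rcases a with a | a <;> rcases b with b | b
  · simp only [UA, fromBlocks_apply₁₁, Matrix.one_apply]; split_ifs <;> simp
  · simp only [UA, fromBlocks_apply₁₂]; exact hA _
  · simp [UA]
  · simp only [UA, fromBlocks_apply₂₂, Matrix.one_apply]; split_ifs <;> simp

lemma vol_aU_pos (t : ℝ) (A : Fin m × Fin n → ℝ) (W : Matrix (Fin m ⊕ Fin n) (Fin i) ℝ) (hW : vol W ≠ 0) :
    0 < vol (diagonal (aD m n t) * (UA A * W)) := by
  refine vol_pos_of (vol_ne_of_inv _ (diagonal (fun k => (aD m n t k)⁻¹)) ?_ _ (vol_ne_of_inv _ (UA (-A)) ?_ _ hW))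
  · rw [diagonal_mul_diagonal, ← diagonal_one]
    congr 1; ext k
    exact inv_mul_cancel₀ (aD_pos t k).ne'
  · rw [← UA_add, neg_add_cancel, UA_zero]

/-- Grid centers. -/
def ctr (r : ℝ) {L : ℕ} (k : Fin m × Fin n → Fin L) : Fin m × Fin n → ℝ :=
  fun e => r * (-1 + (2 * (k e : ℕ) + 1) / L)

/-- Cells. -/
def cell (r : ℝ) {L : ℕ} (k : Fin m × Fin n → Fin L) : Set (Fin m × Fin n → ℝ) :=
  Set.univ.pi fun e => Set.Ioo (ctr r k e - r / L) (ctr r k e + r / L)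

lemma ctr_bound {r : ℝ} (hr : 0 < r) {L : ℕ} (hL : 0 < L) (k : Fin m × Fin n → Fin L) (e) :
    -r + r / L ≤ ctr r k e ∧ ctr r k e ≤ r - r / L := by
  have hL' : (0 : ℝ) < L := by exact_mod_cast hL
  have h1 : (((k e : ℕ) : ℝ)) + 1 ≤ L := by exact_mod_cast (k e).2
  have e1 : ctr r k e = -r + r / L + r * (2 * ((k e : ℕ) : ℝ)) / L := by
    unfold ctr; field_simp; ring
  have e2 : ctr r k e = r - r / L - r * (2 * (L - 1 - ((k e : ℕ) : ℝ))) / L := by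
    unfold ctr; field_simp; ring
  constructor
  · rw [e1]
    have : 0 ≤ r * (2 * ((k e : ℕ) : ℝ)) / L := by positivity
    linarith
  · rw [e2]
    have : 0 ≤ r * (2 * (L - 1 - ((k e : ℕ) : ℝ))) / L := div_nonneg (mul_nonneg hr.le (by linarith)) hL'.le
    linarith

lemma cell_sub {r : ℝ} (hr : 0 < r) {L : ℕ} (hL : 0 < L) (k : Fin m × Fin n → Fin L) : cell r k ⊆ bx m n r := by
  intro A hA e
  have h1 := hA e trivial
  have h2 := ctr_bound hr hL k e
  simp only [Set.mem_Ioo] at h1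
  rw [abs_le]
  constructor <;> linarith

lemma cell_disj {r : ℝ} (hr : 0 < r) {L : ℕ} (hL : 0 < L) :
    Pairwise (Function.onFun Disjoint (fun k : Fin m × Fin n → Fin L => cell r k)) := by
  intro k k' hkk
  have hL' : (0 : ℝ) < L := by exact_mod_cast hL
  obtain ⟨e, he⟩ := Function.ne_iff.1 hkk
  rw [Function.onFun, Set.disjoint_left]
  intro A hA hA'
  have h1 := hA e trivial
  have h2 := hA' e trivial
  simp only [Set.mem_Ioo, ctr] at h1 h2
  wlog h : (k e) < (k' e) generalizing k k'
  · exact this hkk.symm he.symm hA' hA h2 h1 (lt_of_le_of_ne (not_lt.1 h) he.symm)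
  have h3 : (((k e : ℕ) : ℝ)) + 1 ≤ ((k' e : ℕ) : ℝ) := by exact_mod_cast h
  have h4 : r * (-1 + (2 * ((k e : ℕ) : ℝ) + 1) / L) + r / L ≤ r * (-1 + (2 * ((k' e : ℕ) : ℝ) + 1) / L) - r / L := by
    have : r * (-1 + (2 * ((k' e : ℕ) : ℝ) + 1) / L) - r / L - (r * (-1 + (2 * ((k e : ℕ) : ℝ) + 1) / L) + r / L)
      = 2 * r * (((k' e : ℕ) : ℝ) - (((k e : ℕ) : ℝ) + 1)) / L := by field_simp; ring
    have h5 : 0 ≤ 2 * r * (((k' e : ℕ) : ℝ) - (((k e : ℕ) : ℝ) + 1)) / L :=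
      div_nonneg (mul_nonneg (by positivity) (by linarith)) hL'.le
    linarith
  linarith [h1.2, h2.1]

lemma meas_cell {r : ℝ} (hr : 0 < r) {L : ℕ} (hL : 0 < L) (k : Fin m × Fin n → Fin L) :
    Measure.pi (fun _ => unif r) (cell r k) = ((L : ℝ≥0∞)⁻¹) ^ (m * n) := by
  have := unif_prob hr
  have hL' : (0 : ℝ) < L := by exact_mod_cast hL
  unfold cell
  rw [Measure.pi_pi]
  have h1 : ∀ e, unif r (Set.Ioo (ctr r k e - r / L) (ctr r k e + r / L)) = (L : ℝ≥0∞)⁻¹ := by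
    intro e
    have h2 := ctr_bound hr hL k e
    have h0 : 0 < r / L := by positivity
    unfold unif
    rw [Measure.smul_apply, Measure.restrict_apply measurableSet_Ioo, Set.inter_eq_left.2, Real.volume_Ioo, smul_eq_mul]
    · rw [show ctr r k e + r / L - (ctr r k e - r / L) = (2 * r) * (L : ℝ)⁻¹ by field_simp; ring,
        ENNReal.ofReal_mul (p := 2 * r) (by positivity), ← mul_assoc, ENNReal.inv_mul_cancel (by simpa using hr) ENNReal.ofReal_ne_top,
        one_mul, ENNReal.ofReal_inv_of_pos hL', ENNReal.ofReal_natCast]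
    · intro x hx
      simp only [Set.mem_Ioo] at hx
      constructor <;> linarith
  rw [Finset.prod_congr rfl fun e _ => h1 e]
  simp

lemma vol_cell {r : ℝ} (hr : 0 < r) (hr1 : r ≤ 1) {L : ℕ} (t : ℝ) (hL : Real.exp (lam m n * t) ≤ L)
    (k : Fin m × Fin n → Fin L) (A) (hA : A ∈ cell r k) (W : Matrix (Fin m ⊕ Fin n) (Fin i) ℝ) :
    vol (diagonal (aD m n t) * (UA A * W)) ≤ ((m : ℝ) + n) ^ i * vol (diagonal (aD m n t) * (UA (ctr r k) * W)) := by
  have hL' : (0 : ℝ) < L := lt_of_lt_of_le (Real.exp_pos _) hL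
  have h1 : diagonal (aD m n t) * (UA A * W) = UA (Real.exp (lam m n * t) • (A - ctr r k)) * (diagonal (aD m n t) * (UA (ctr r k) * W)) := by
    conv_lhs => rw [← sub_add_cancel A (ctr r k), UA_add]
    rw [Matrix.mul_assoc, ← Matrix.mul_assoc, aD_UA, Matrix.mul_assoc]
  have h2 := vol_mul_left (UA (Real.exp (lam m n * t) • (A - ctr r k))) (diagonal (aD m n t) * (UA (ctr r k) * W)) (c := 1)
    (UA_entry fun e => by
      have h3 := hA e trivial
      simp only [Set.mem_Ioo] at h3
      have h4 : |A e - ctr r k e| ≤ r / L := abs_le.2 ⟨by linarith, by linarith⟩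
      simp only [Pi.smul_apply, Pi.sub_apply, smul_eq_mul, abs_mul, abs_of_pos (Real.exp_pos _)]
      calc _ ≤ L * (r / L) := mul_le_mul hL h4 (abs_nonneg _) hL'.le
        _ = r := by field_simp
        _ ≤ 1 := hr1) zero_le_one
  rw [h1]
  simpa using h2

lemma grid_sum {r β : ℝ} (hr : 0 < r) (hr1 : r ≤ 1) (hm : 0 < m) (hn : 0 < n) (hβ : 0 < β)
    (hβ2 : β < |(m : ℝ) - i| + 1)
    (hdet : ∀ E : Matrix (Fin i) (Fin i) ℝ, (∀ a b, |E a b - (1 : Matrix (Fin i) (Fin i) ℝ) a b| ≤ n * r) → 1 / 2 ≤ |E.det|) :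
    ∃ C : ℝ, 0 ≤ C ∧ ∀ (t : ℝ) (L : ℕ), Real.exp (lam m n * t) ≤ L → ∀ (W : Matrix (Fin m ⊕ Fin n) (Fin i) ℝ), vol W ≠ 0 →
      ∑ k : Fin m × Fin n → Fin L, (vol (diagonal (aD m n t) * (UA (ctr r k) * W))) ^ (-β) ≤
        C * (L : ℝ) ^ (m * n) * Real.exp (-(kap m n i * β * t)) * (vol W) ^ (-β) := by
  obtain ⟨C, hCt, hC⟩ := expect (m := m) (n := n) (i := i) hr hm hn hβ hβ2 hdet
  have hD0 : (0 : ℝ) < (((m : ℝ) + n) ^ i)⁻¹ := by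
    have : (0 : ℝ) < (m : ℝ) + n := by positivity
    positivity
  set D : ℝ := ((((m : ℝ) + n) ^ i)⁻¹) ^ (-β) with hD
  have hDp : 0 < D := Real.rpow_pos_of_pos hD0 _
  refine ⟨D * C.toReal, by positivity, ?_⟩
  intro t L hL W hW
  have hL0 : (0 : ℝ) < L := lt_of_lt_of_le (Real.exp_pos _) hL
  have hL0' : 0 < L := by exact_mod_cast hL0
  have hvW := vol_pos_of hW
  set P : Measure (Fin m × Fin n → ℝ) := Measure.pi (fun _ => unif r) with hP
  set F : (Fin m × Fin n → ℝ) → ℝ≥0∞ := fun A => np (vol (diagonal (aD m n t) * (UA A * W))) β with hF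
  have hk : ∀ k : Fin m × Fin n → Fin L, F (ctr r k) * ((L : ℝ≥0∞)⁻¹) ^ (m * n) ≤ ENNReal.ofReal D * ∫⁻ A in cell r k, F A ∂P := by
    intro k
    rw [← lintegral_const_mul _ (meas_F _ _ _), ← meas_cell hr hL0' k, ← setLIntegral_const]
    refine setLIntegral_mono' (MeasurableSet.univ_pi fun e => measurableSet_Ioo) fun A hA => ?_
    have h1 := vol_cell hr hr1 t hL k A hA W
    rw [hD, ← np_pos_eq hD0, hF]
    beta_reduce
    rw [← np_mul hD0.le]
    refine np_anti hβ.le ?_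
    rw [inv_mul_le_iff₀ (inv_pos.1 hD0)]
    exact h1
  have hsum : ∑ k : Fin m × Fin n → Fin L, F (ctr r k) * ((L : ℝ≥0∞)⁻¹) ^ (m * n) ≤ ENNReal.ofReal D * (C * np (Real.exp (kap m n i * t)) β * np (vol W) β) := by
    refine (Finset.sum_le_sum fun k _ => hk k).trans ?_
    rw [← Finset.mul_sum]
    gcongr
    refine le_trans ?_ (hC W hW t)
    rw [← lintegral_biUnion_finset (fun k _ k' _ h => cell_disj hr hL0' h) (fun k _ => MeasurableSet.univ_pi fun e => measurableSet_Ioo)]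
    exact lintegral_mono_set (Set.iUnion₂_subset fun k _ => cell_sub hr hL0' k)
  have e1 : ∑ k : Fin m × Fin n → Fin L, F (ctr r k) * ((L : ℝ≥0∞)⁻¹) ^ (m * n) =
      ENNReal.ofReal ((∑ k : Fin m × Fin n → Fin L, (vol (diagonal (aD m n t) * (UA (ctr r k) * W))) ^ (-β)) * ((L : ℝ)⁻¹) ^ (m * n)) := by
    rw [ENNReal.ofReal_mul (Finset.sum_nonneg fun k _ => Real.rpow_nonneg (vol_nonneg _) _), ENNReal.ofReal_sum_of_nonneg (fun k _ => Real.rpow_nonneg (vol_nonneg _) _), ← Finset.sum_mul]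
    congr 1
    · refine Finset.sum_congr rfl fun k _ => ?_
      exact np_pos_eq (vol_aU_pos _ _ _ hW) _
    · rw [ENNReal.ofReal_pow (by positivity), ENNReal.ofReal_inv_of_pos hL0, ENNReal.ofReal_natCast]
  have e2 : ENNReal.ofReal D * (C * np (Real.exp (kap m n i * t)) β * np (vol W) β) =
      ENNReal.ofReal (D * (C.toReal * Real.exp (-(kap m n i * β * t)) * vol W ^ (-β))) := by
    rw [np_pos_eq (Real.exp_pos _), np_pos_eq hvW, ENNReal.ofReal_mul hDp.le, ENNReal.ofReal_mul (by positivity), ENNReal.ofReal_mul (by positivity), ENNReal.ofReal_toReal hCt, ← Real.exp_mul]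
    congr 5
    ring
  rw [e1, e2, ENNReal.ofReal_le_ofReal_iff (by positivity)] at hsum
  rw [inv_pow, ← div_eq_mul_inv, div_le_iff₀ (by positivity)] at hsum
  refine hsum.trans (le_of_eq (by ring))

end Grid
end KK

namespace KK

section Height
variable {m n : ℕ}

/-- unipotent with pair index -/
def uS (m n : ℕ) (A : Fin m × Fin n → ℝ) : G (m + n) := uSL m n (fun a b => A (a, b))

lemma vol_transfer {i : ℕ} (hm : 0 < m) (hn : 0 < n) (t : ℝ) (A : Fin m × Fin n → ℝ) (M : Matrix (Fin (m + n)) (Fin i) ℝ) :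
    vol ((aSL m n hm hn t * uS m n A : G (m + n)).1 * M) =
      vol (diagonal (aD m n t) * (UA A * M.submatrix finSumFinEquiv id)) := by
  have h1 : (aSL m n hm hn t * uS m n A : G (m + n)).1 * M =
      (diagonal (aD m n t) * (UA A * M.submatrix finSumFinEquiv id)).submatrix finSumFinEquiv.symm id := by
    have ha : (aSL m n hm hn t : G (m+n)).1 = (diagonal (aD m n t)).submatrix finSumFinEquiv.symm finSumFinEquiv.symm := by
      change aMat m n t = _
      unfold aMat aD
      rw [reindex_apply]
      congr 1
      ext a b
      rcases a with a | a <;> rcases b with b | b <;> simp [Matrix.one_apply, diagonal_apply]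
    have hu : (uS m n A : G (m+n)).1 = (UA A).submatrix finSumFinEquiv.symm finSumFinEquiv.symm := by
      change uMat m n (fun a b => A (a, b)) = _
      unfold uMat UA
      rw [reindex_apply]
    have hM : M = (M.submatrix finSumFinEquiv id).submatrix (finSumFinEquiv (m := m) (n := n)).symm id := by
      ext a b; simp
    change (aSL m n hm hn t : G (m+n)).1 * (uS m n A : G (m+n)).1 * M = _
    conv_lhs => rw [ha, hu, hM]
    rw [submatrix_mul_equiv, submatrix_mul_equiv, Matrix.mul_assoc]
  rw [h1, vol_row_equiv _ finSumFinEquiv.symm]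

lemma kap_eq_min (hm : 0 < m) (hn : 0 < n) (i : ℕ) : kap m n i = min ((i : ℝ) / m) (((m : ℝ) + n - i) / n) := by
  have hm' : (0 : ℝ) < m := by exact_mod_cast hm
  have hn' : (0 : ℝ) < n := by exact_mod_cast hn
  unfold kap
  split_ifs with h
  · have : (i : ℝ) ≤ m := by exact_mod_cast h
    rw [min_eq_left]
    calc (i : ℝ) / m ≤ 1 := by rw [div_le_one hm']; exact this
      _ ≤ _ := by rw [le_div_iff₀ hn']; linarith
  · have : (m : ℝ) ≤ i := by exact_mod_cast (not_le.1 h).le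
    rw [min_eq_right]
    calc _ ≤ (1 : ℝ) := by rw [div_le_one hn']; linarith
      _ ≤ _ := by rw [le_div_iff₀ hm']; linarith

lemma kap_concave (hm : 0 < m) (hn : 0 < n) {i j : ℕ} (hj : j ≤ i) :
    kap m n (i - j) + kap m n (i + j) ≤ 2 * kap m n i := by
  rw [kap_eq_min hm hn, kap_eq_min hm hn, kap_eq_min hm hn, Nat.cast_sub hj, Nat.cast_add]
  rcases min_cases ((i : ℝ) / m) (((m : ℝ) + n - i) / n) with ⟨h, -⟩ | ⟨h, -⟩ <;> rw [h]
  · refine (add_le_add (min_le_left _ _) (min_le_left _ _)).trans (le_of_eq ?_)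
    ring
  · refine (add_le_add (min_le_right _ _) (min_le_right _ _)).trans (le_of_eq ?_)
    ring

lemma kap_pos (hm : 0 < m) (hn : 0 < n) {i : ℕ} (h1 : 1 ≤ i) (h2 : i < m + n) : 0 < kap m n i := by
  have hm' : (0 : ℝ) < m := by exact_mod_cast hm
  have hn' : (0 : ℝ) < n := by exact_mod_cast hn
  rw [kap_eq_min hm hn]
  have a1 : (1 : ℝ) ≤ i := by exact_mod_cast h1
  have a2 : (i : ℝ) < m + n := by exact_mod_cast h2
  exact lt_min (div_pos (by linarith) hm') (div_pos (by linarith) hn')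

lemma kap_le_one (hm : 0 < m) (hn : 0 < n) (i : ℕ) : kap m n i ≤ 1 := by
  have hm' : (0 : ℝ) < m := by exact_mod_cast hm
  have hn' : (0 : ℝ) < n := by exact_mod_cast hn
  unfold kap
  split_ifs with h
  · rw [div_le_one hm']; exact_mod_cast h
  · have : (m : ℝ) ≤ i := by exact_mod_cast (not_le.1 h).le
    rw [div_le_one hn']; linarith

lemma kap_zero : kap m n 0 = 0 := by simp [kap]
lemma kap_top (hm : 0 < m) (hn : 0 < n) : kap m n (m + n) = 0 := by
  unfold kap; rw [if_neg (by omega)]; simp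

lemma kap_nonneg (hm : 0 < m) (hn : 0 < n) {i : ℕ} (h2 : i ≤ m + n) : 0 ≤ kap m n i := by
  rcases Nat.eq_zero_or_pos i with rfl | h1
  · rw [kap_zero]
  rcases h2.lt_or_eq with h | rfl
  · exact (kap_pos hm hn h1 h).le
  · rw [kap_top hm hn]

lemma beta_lt (hm : 0 < m) (hn : 0 < n) {ε : ℝ} (hε : 0 < ε) {i : ℕ} (h1 : 1 ≤ i) (h2 : i < m + n) :
    (1 - ε) / kap m n i < |(m : ℝ) - i| + 1 := by
  have hm' : (0 : ℝ) < m := by exact_mod_cast hm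
  have hn' : (0 : ℝ) < n := by exact_mod_cast hn
  have a1 : (1 : ℝ) ≤ i := by exact_mod_cast h1
  have hk := kap_pos hm hn h1 h2
  rw [div_lt_iff₀ hk]
  suffices 1 ≤ (|(m : ℝ) - i| + 1) * kap m n i by linarith
  unfold kap
  split_ifs with h
  · have h' : (i : ℝ) ≤ m := by exact_mod_cast h
    rw [abs_of_nonneg (by linarith), mul_div_assoc', le_div_iff₀ hm']
    nlinarith
  · have h' : (m : ℝ) ≤ i := by exact_mod_cast (not_le.1 h).le
    have h3 : (i : ℝ) + 1 ≤ m + n := by exact_mod_cast h2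
    rw [abs_of_nonpos (by linarith), mul_div_assoc', le_div_iff₀ hn']
    nlinarith

/-- weights -/
def wt (m n : ℕ) (η : ℝ) (i : ℕ) : ℝ := η ^ (i * (m + n - i))

/-- The height function. -/
def Hh (m n : ℕ) (ε η : ℝ) (g : G (m + n)) : ℝ :=
  (Finset.range (m + n + 1)).sup' ⟨0, by simp⟩ (fun i => (wt m n η i * alpha i g) ^ ((1 - ε) / kap m n i))

lemma le_Hh {ε η : ℝ} (g : G (m + n)) {i : ℕ} (hi : i ≤ m + n) :
    (wt m n η i * alpha i g) ^ ((1 - ε) / kap m n i) ≤ Hh m n ε η g :=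
  Finset.le_sup' (fun i => (wt m n η i * alpha i g) ^ ((1 - ε) / kap m n i)) (Finset.mem_range.2 (by omega))

lemma one_le_Hh {ε η : ℝ} (g : G (m + n)) : 1 ≤ Hh m n ε η g := by
  have := le_Hh (ε := ε) (η := η) g (i := 0) (by omega)
  rwa [kap_zero, _root_.div_zero, Real.rpow_zero] at this

lemma Hh_gamma {ε η : ℝ} (g γ : G (m + n)) (hγ : γ ∈ Gamma (m + n)) : Hh m n ε η (g * γ) = Hh m n ε η g := by
  unfold Hh
  simp only [alpha_gamma _ g γ hγ]

lemma alpha_open (i : ℕ) (c : ℝ) (hc : 0 ≤ c) : IsOpen {g : G (m + n) | c < alpha i g} := by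
  have : {g : G (m + n) | c < alpha i g} = ⋃ B : {B : Matrix (Fin (m + n)) (Fin i) ℤ // vol (ic B) ≠ 0}, {g | c < (vol (g.1 * ic B.1))⁻¹} := by
    ext g
    simp only [Set.mem_ofPred_eq, Set.mem_iUnion]
    constructor
    · intro h
      by_contra hcon
      push Not at hcon
      exact absurd (alpha_le hc fun B hB => hcon ⟨B, hB⟩) (not_le.2 h)
    · rintro ⟨B, hB⟩
      exact hB.trans_le (le_alpha g B.1 B.2 (by simp))
  rw [this]
  refine isOpen_iUnion fun B => ?_
  have hcont : Continuous fun g : G (m + n) => vol (g.1 * ic B.1) := by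
    unfold vol
    have hfin : Finite (Fin i → Fin (m+n)) := inferInstance
    have hd : ∀ f : Fin i → Fin (m+n), Continuous fun g : G (m + n) => |((g.1 * ic B.1).submatrix f id).det| := by
      intro f
      have h1 : Continuous fun g : G (m + n) => (g.1 * ic B.1).submatrix f id := by
        refine continuous_matrix fun a b => ?_
        simp only [submatrix_apply, Matrix.mul_apply]
        refine continuous_finsetSum _ fun c _ => ?_
        exact (show Continuous fun g : G (m + n) => g.1 (f a) c from ((continuous_apply c).comp ((continuous_apply (f a)).comp (continuous_subtype_val (p := fun A : Matrix (Fin (m+n)) (Fin (m+n)) ℝ => A.det = 1))))).mul continuous_const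
      exact h1.matrix_det.abs
    by_cases hne : Nonempty (Fin i → Fin (m + n))
    · have : (fun g : G (m + n) => ⨆ f : Fin i → Fin (m+n), |((g.1 * ic B.1).submatrix f id).det|) =
        fun g => Finset.univ.sup' Finset.univ_nonempty fun f : Fin i → Fin (m+n) => |((g.1 * ic B.1).submatrix f id).det| := by
        ext g
        rw [Finset.sup'_univ_eq_ciSup]
      rw [this]
      exact Continuous.finset_sup'_apply _ fun f _ => hd f
    · rw [not_nonempty_iff] at hne
      simp only [Real.iSup_of_isEmpty]
      exact continuous_const
  have hne : ∀ g : G (m + n), vol (g.1 * ic B.1) ≠ 0 := fun g => vol_mul_ne_zero g _ B.2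
  exact isOpen_lt continuous_const (hcont.inv₀ hne)

lemma wt_pos {η : ℝ} (hη : 0 < η) (i : ℕ) : 0 < wt m n η i := pow_pos hη _

lemma Hh_open (hm : 0 < m) (hn : 0 < n) {ε η : ℝ} (hη : 0 < η) (hε1 : ε < 1) (M : ℝ) (hM : 0 ≤ M) :
    IsOpen {g : G (m + n) | M < Hh m n ε η g} := by
  have : {g : G (m + n) | M < Hh m n ε η g} = ⋃ i ∈ Finset.range (m + n + 1),
      {g : G (m + n) | M < (wt m n η i * alpha i g) ^ ((1 - ε) / kap m n i)} := by
    ext g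
    simp only [Set.mem_ofPred_eq, Hh, Set.mem_iUnion, exists_prop]
    exact Finset.lt_sup'_iff _
  rw [this]
  refine isOpen_biUnion fun i hi => ?_
  have hi' : i ≤ m + n := by simpa [Nat.lt_succ_iff] using hi
  rcases (kap_nonneg hm hn hi').eq_or_lt with h | h
  · rw [← h]; simp
  · have hb : 0 < (1 - ε) / kap m n i := div_pos (by linarith) h
    have : {g : G (m + n) | M < (wt m n η i * alpha i g) ^ ((1 - ε) / kap m n i)} =
        {g : G (m + n) | M ^ ((1 - ε) / kap m n i)⁻¹ / wt m n η i < alpha i g} := by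
      ext g
      simp only [Set.mem_ofPred_eq]
      rw [div_lt_iff₀' (wt_pos hη i), Real.rpow_inv_lt_iff_of_pos hM (mul_nonneg (wt_pos hη i).le (alpha_nonneg _ _)) hb]
    rw [this]
    exact alpha_open i _ (div_nonneg (Real.rpow_nonneg hM _) (wt_pos hη i).le)

lemma Hh_alpha1 (hm : 0 < m) (hn : 0 < n) {ε η : ℝ} (hη : 0 < η) (hε1 : ε < 1) (M : ℝ) :
    ∃ R, ∀ g : G (m + n), Hh m n ε η g ≤ M → alpha 1 g ≤ R := by
  have hk := kap_pos hm hn (i := 1) le_rfl (by omega)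
  have hb : 0 < (1 - ε) / kap m n 1 := div_pos (by linarith) hk
  refine ⟨M ^ ((1 - ε) / kap m n 1)⁻¹ / wt m n η 1, fun g hg => ?_⟩
  have h1 := (le_Hh (ε := ε) (η := η) g (i := 1) (by omega)).trans hg
  have hM : 0 ≤ M := le_trans zero_le_one ((one_le_Hh g).trans hg)
  rw [le_div_iff₀' (wt_pos hη 1)]
  rwa [Real.le_rpow_inv_iff_of_pos (mul_nonneg (wt_pos hη _).le (alpha_nonneg _ _)) hM hb]

/-- growth exponent -/
def bexp (m n : ℕ) (ε : ℝ) : ℝ := ∑ i ∈ Finset.range (m + n + 1), (i : ℝ) * ((1 - ε) / kap m n i)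

lemma beta_nonneg (hm : 0 < m) (hn : 0 < n) {ε : ℝ} (hε1 : ε < 1) {i : ℕ} (hi : i ≤ m + n) :
    0 ≤ (1 - ε) / kap m n i := div_nonneg (by linarith) (kap_nonneg hm hn hi)

lemma bexp_nonneg (hm : 0 < m) (hn : 0 < n) {ε : ℝ} (hε1 : ε < 1) : 0 ≤ bexp m n ε :=
  Finset.sum_nonneg fun i hi => mul_nonneg (by positivity) (beta_nonneg hm hn hε1 (by simpa [Nat.lt_succ_iff] using hi))

lemma Hh_mul_le (hm : 0 < m) (hn : 0 < n) {ε η : ℝ} (hη : 0 < η) (hε1 : ε < 1) {c : ℝ} (hc1 : 1 ≤ c)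
    (h g : G (m + n)) (hc : ∀ a b, |(h⁻¹ : G (m + n)).1 a b| ≤ c) :
    Hh m n ε η (h * g) ≤ (((m + n : ℕ) : ℝ) * c) ^ (bexp m n ε) * Hh m n ε η g := by
  have hd1 : (1 : ℝ) ≤ ((m + n : ℕ) : ℝ) := by exact_mod_cast (by omega : 1 ≤ m + n)
  have hdc : (1 : ℝ) ≤ ((m + n : ℕ) : ℝ) * c := by nlinarith
  conv_lhs => unfold Hh
  refine Finset.sup'_le _ _ fun i hi => ?_
  have hi' : i ≤ m + n := by simpa [Nat.lt_succ_iff] using hi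
  have hb := beta_nonneg hm hn hε1 hi'
  have hw := wt_pos (m := m) (n := n) hη i
  have h1 := alpha_mul_le (i := i) g h (by linarith) hc
  have h2 : (i : ℝ) * ((1 - ε) / kap m n i) ≤ bexp m n ε :=
    Finset.single_le_sum (f := fun i : ℕ => (i : ℝ) * ((1 - ε) / kap m n i)) (fun i hi => mul_nonneg (by positivity) (beta_nonneg hm hn hε1 (by simpa [Nat.lt_succ_iff] using hi))) hi
  calc (wt m n η i * alpha i (h * g)) ^ ((1 - ε) / kap m n i)
      ≤ ((((m + n : ℕ) : ℝ) * c) ^ i * (wt m n η i * alpha i g)) ^ ((1 - ε) / kap m n i) := by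
        refine Real.rpow_le_rpow (mul_nonneg hw.le (alpha_nonneg _ _)) ?_ hb
        nlinarith
    _ = (((m + n : ℕ) : ℝ) * c) ^ ((i : ℝ) * ((1 - ε) / kap m n i)) * (wt m n η i * alpha i g) ^ ((1 - ε) / kap m n i) := by
        rw [Real.mul_rpow (by positivity) (mul_nonneg hw.le (alpha_nonneg _ _)), Real.rpow_mul (by positivity), Real.rpow_natCast]
    _ ≤ _ := by
        refine mul_le_mul (Real.rpow_le_rpow_of_exponent_le hdc h2) (le_Hh g hi') (Real.rpow_nonneg (mul_nonneg hw.le (alpha_nonneg _ _)) _) (by positivity)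

lemma alpha_le_Hh (hm : 0 < m) (hn : 0 < n) {ε η : ℝ} (hη : 0 < η) (hε1 : ε < 1) (g : G (m + n)) {i : ℕ} (hi : i ≤ m + n) :
    wt m n η i * alpha i g ≤ Hh m n ε η g ^ (kap m n i / (1 - ε)) := by
  rcases Nat.eq_zero_or_pos i with rfl | h1
  · rw [kap_zero, zero_div, Real.rpow_zero, alpha_zero]; simp [wt]
  rcases hi.lt_or_eq with h | rfl
  · have hk := kap_pos hm hn h1 h
    have hb : 0 < (1 - ε) / kap m n i := div_pos (by linarith) hk
    have h1 := le_Hh (ε := ε) (η := η) g hi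
    rw [← Real.le_rpow_inv_iff_of_pos (mul_nonneg (wt_pos hη _).le (alpha_nonneg _ _)) (by linarith [one_le_Hh (ε := ε) (η := η) g]) hb] at h1
    rwa [inv_div] at h1
  · rw [kap_top hm hn, zero_div, Real.rpow_zero]
    have := alpha_top g
    simpa [wt] using this

lemma wt_ratio {η : ℝ} (hη : 0 < η) (hη1 : η ≤ 1) {i j : ℕ} (hj1 : 1 ≤ j) (hj : j ≤ i) (hij : i + j ≤ m + n) :
    wt m n η i ^ 2 ≤ η ^ 2 * (wt m n η (i - j) * wt m n η (i + j)) := by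
  unfold wt
  rw [← pow_mul, ← pow_add, ← pow_add]
  refine pow_le_pow_of_le_one hη.le hη1 ?_
  obtain ⟨a, rfl⟩ := Nat.exists_eq_add_of_le hj
  obtain ⟨b, hb⟩ := Nat.exists_eq_add_of_le hij
  rw [hb]
  have e1 : j + a - j = a := by omega
  have e2 : j + a + j + b - (j + a + j) = b := by omega
  have e3 : j + a + j + b - a = 2 * j + b := by omega
  have e4 : j + a + j + b - (j + a) = j + b := by omega
  rw [e1, e2, e3, e4]
  nlinarith

end Height
end KK

namespace KK

section HeightThm
variable {m n : ℕ}

lemma height_term (hm : 0 < m) (hn : 0 < n) {ε r : ℝ} (hε : 0 < ε) (hε1 : ε < 1) (hr : 0 < r) (hr1 : r ≤ 1)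
    {i : ℕ} (h1 : 1 ≤ i) (h2 : i < m + n)
    (hdet : ∀ E : Matrix (Fin i) (Fin i) ℝ, (∀ a b, |E a b - (1 : Matrix (Fin i) (Fin i) ℝ) a b| ≤ n * r) → 1 / 2 ≤ |E.det|) :
    ∃ C : ℝ, 0 ≤ C ∧ ∀ (t : ℝ) (L : ℕ), 0 ≤ t → Real.exp (lam m n * t) ≤ L →
      ∀ Q : ℝ, 0 ≤ Q → (∀ (k : Fin m × Fin n → Fin L) (M : Matrix (Fin (m+n)) (Fin i) ℝ),
        vol M ≤ Q * vol ((aSL m n hm hn t * uS m n (ctr r k) : G (m+n)).1 * M)) →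
      ∀ η : ℝ, 0 < η → η ≤ 1 → Real.sqrt (2 * ((m+n).factorial : ℝ)) * Q * η ≤ Real.exp (-t) →
      ∀ g : G (m + n), ∑ k : Fin m × Fin n → Fin L,
        (wt m n η i * alpha i (aSL m n hm hn t * uS m n (ctr r k) * g)) ^ ((1 - ε) / kap m n i) ≤
        (L : ℝ) ^ (m * n) * (C * Real.exp (-((1 - ε) * t)) * Hh m n ε η g) := by
  have hk := kap_pos hm hn h1 h2
  have hb : 0 < (1 - ε) / kap m n i := div_pos (by linarith) hk
  obtain ⟨C, hC0, hC⟩ := grid_sum (i := i) hr hr1 hm hn hb (beta_lt hm hn hε h1 h2) hdet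
  refine ⟨C + 1, by linarith, fun t L ht hL Q hQ hvol η hη hη1 hηQ g => ?_⟩
  obtain ⟨B, hB, hemm⟩ := emm h2.le g
  set β := (1 - ε) / kap m n i with hβ
  set H := Hh m n ε η g with hH
  have hH1 : 1 ≤ H := one_le_Hh g
  have hw := wt_pos (m := m) (n := n) hη i
  set w := wt m n η i with hwd
  set c := Real.sqrt (2 * ((m+n).factorial : ℝ)) * Q with hc
  have hc0 : 0 ≤ c := by positivity
  set X := c * η * H ^ (kap m n i / (1 - ε)) / w with hX
  have hX0 : 0 ≤ X := by positivity
  set hk' : (Fin m × Fin n → Fin L) → G (m + n) := fun k => aSL m n hm hn t * uS m n (ctr r k) with hkd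
  have hvB : vol (g.1 * ic B) ≠ 0 := vol_mul_ne_zero g _ hB
  have hstep : ∀ k, (w * alpha i (hk' k * g)) ^ β ≤ w ^ β * (vol ((hk' k).1 * (g.1 * ic B))) ^ (-β) + Real.exp (-((1 - ε) * t)) * H := by
    intro k
    have hv : 0 < vol ((hk' k).1 * (g.1 * ic B)) := vol_pos_of (vol_mul_ne_zero _ _ hvB)
    have hα : alpha i (hk' k * g) ≤ max (vol ((hk' k).1 * (g.1 * ic B)))⁻¹ X := by
      refine hemm (hk' k) Q hQ (hvol k) _ (hX0.trans (le_max_right _ _)) (le_max_left _ _) fun j hj1 hji hij => ?_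
      refine le_trans ?_ (pow_le_pow_left₀ hX0 (le_max_right _ _) 2)
      have e1 := alpha_le_Hh hm hn hη hε1 g (i := i - j) (by omega)
      have e2 := alpha_le_Hh hm hn hη hε1 g (i := i + j) hij
      have e3 := wt_ratio (m := m) (n := n) hη hη1 hj1 hji hij
      have p1 := alpha_nonneg (i - j) g
      have p2 := alpha_nonneg (i + j) g
      have q1 := wt_pos (m := m) (n := n) hη (i - j)
      have q2 := wt_pos (m := m) (n := n) hη (i + j)
      have e4 : (wt m n η (i - j) * alpha (i - j) g) * (wt m n η (i + j) * alpha (i + j) g) ≤ (H ^ (kap m n i / (1 - ε))) ^ 2 := by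
        calc _ ≤ H ^ (kap m n (i - j) / (1 - ε)) * H ^ (kap m n (i + j) / (1 - ε)) :=
              mul_le_mul e1 e2 (mul_nonneg q2.le p2) (by positivity)
          _ = H ^ ((kap m n (i - j) + kap m n (i + j)) / (1 - ε)) := by
              rw [← Real.rpow_add (by linarith), add_div]
          _ ≤ H ^ ((2 * kap m n i) / (1 - ε)) := by
              refine Real.rpow_le_rpow_of_exponent_le hH1 ?_
              have := kap_concave hm hn hji
              exact div_le_div_of_nonneg_right this (by linarith)
          _ = _ := by
              rw [← Real.rpow_natCast, ← Real.rpow_mul (by linarith)]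
              congr 1; push_cast; ring
      have e5 : w ^ 2 * (alpha (i - j) g * alpha (i + j) g) ≤ η ^ 2 * (H ^ (kap m n i / (1 - ε))) ^ 2 := by
        calc _ ≤ (η ^ 2 * (wt m n η (i - j) * wt m n η (i + j))) * (alpha (i - j) g * alpha (i + j) g) :=
              mul_le_mul_of_nonneg_right e3 (mul_nonneg p1 p2)
          _ = η ^ 2 * ((wt m n η (i - j) * alpha (i - j) g) * (wt m n η (i + j) * alpha (i + j) g)) := by ring
          _ ≤ _ := mul_le_mul_of_nonneg_left e4 (by positivity)
      have e6 : c ^ 2 = 2 * ((m+n).factorial : ℝ) * Q ^ 2 := by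
        rw [hc, mul_pow, Real.sq_sqrt (by positivity)]
      rw [← e6, hX, div_pow, le_div_iff₀ (by positivity)]
      calc c ^ 2 * (alpha (i - j) g * alpha (i + j) g) * w ^ 2 = c ^ 2 * (w ^ 2 * (alpha (i - j) g * alpha (i + j) g)) := by ring
        _ ≤ c ^ 2 * (η ^ 2 * (H ^ (kap m n i / (1 - ε))) ^ 2) := mul_le_mul_of_nonneg_left e5 (by positivity)
        _ = _ := by ring
    have hXb : (w * X) ^ β ≤ Real.exp (-((1 - ε) * t)) * H := by
      have e1 : w * X = (c * η) * H ^ (kap m n i / (1 - ε)) := by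
        rw [hX]; field_simp
      rw [e1, Real.mul_rpow (by positivity) (by positivity), ← Real.rpow_mul (by linarith)]
      have e2 : kap m n i / (1 - ε) * β = 1 := by
        rw [hβ]; have : 1 - ε ≠ 0 := by linarith
        field_simp
      rw [e2, Real.rpow_one]
      refine mul_le_mul_of_nonneg_right ?_ (by linarith)
      calc (c * η) ^ β ≤ (Real.exp (-t)) ^ β := Real.rpow_le_rpow (by positivity) hηQ hb.le
        _ = Real.exp (-t * β) := by rw [← Real.exp_mul]
        _ ≤ _ := by
          refine Real.exp_le_exp.2 ?_
          have : 1 - ε ≤ β := by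
            rw [hβ, le_div_iff₀ hk]
            have := kap_le_one hm hn i
            nlinarith
          nlinarith
    have hL1 : (w * (vol ((hk' k).1 * (g.1 * ic B)))⁻¹) ^ β = w ^ β * (vol ((hk' k).1 * (g.1 * ic B))) ^ (-β) := by
      rw [Real.mul_rpow hw.le (by positivity), Real.inv_rpow hv.le, Real.rpow_neg hv.le]
    calc (w * alpha i (hk' k * g)) ^ β ≤ (w * max (vol ((hk' k).1 * (g.1 * ic B)))⁻¹ X) ^ β :=
          Real.rpow_le_rpow (mul_nonneg hw.le (alpha_nonneg _ _)) (mul_le_mul_of_nonneg_left hα hw.le) hb.le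
      _ ≤ (w * (vol ((hk' k).1 * (g.1 * ic B)))⁻¹) ^ β + (w * X) ^ β := by
          have n1 : 0 ≤ (w * (vol ((hk' k).1 * (g.1 * ic B)))⁻¹) ^ β := by positivity
          have n2 : 0 ≤ (w * X) ^ β := by positivity
          rcases max_cases (vol ((hk' k).1 * (g.1 * ic B)))⁻¹ X with ⟨h, -⟩ | ⟨h, -⟩ <;> rw [h] <;> linarith
      _ ≤ _ := by rw [hL1]; linarith
  have hcard : (Fintype.card (Fin m × Fin n → Fin L) : ℝ) = (L : ℝ) ^ (m * n) := by
    simp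
  have hsum := hC t L hL ((g.1 * ic B).submatrix finSumFinEquiv id) (by rwa [vol_row_equiv])
  rw [vol_row_equiv] at hsum
  have hsum' : ∑ k, (vol ((hk' k).1 * (g.1 * ic B))) ^ (-β) ≤ C * (L : ℝ) ^ (m * n) * Real.exp (-(kap m n i * β * t)) * (vol (g.1 * ic B)) ^ (-β) := by
    refine le_trans (le_of_eq ?_) hsum
    refine Finset.sum_congr rfl fun k _ => ?_
    rw [← vol_transfer hm hn]
  have hkb : kap m n i * β = 1 - ε := by rw [hβ]; field_simp
  rw [hkb] at hsum'
  have hgB : w ^ β * (vol (g.1 * ic B)) ^ (-β) ≤ H := by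
    have hv := vol_pos_of hvB
    rw [Real.rpow_neg hv.le, ← Real.inv_rpow hv.le, ← Real.mul_rpow hw.le (by positivity)]
    refine le_trans (Real.rpow_le_rpow (by positivity) (mul_le_mul_of_nonneg_left (le_alpha g B hB (by simp)) hw.le) hb.le) (le_Hh g h2.le)
  calc _ ≤ ∑ k, (w ^ β * (vol ((hk' k).1 * (g.1 * ic B))) ^ (-β) + Real.exp (-((1 - ε) * t)) * H) :=
        Finset.sum_le_sum fun k _ => hstep k
    _ = w ^ β * ∑ k, (vol ((hk' k).1 * (g.1 * ic B))) ^ (-β) + (L : ℝ) ^ (m * n) * (Real.exp (-((1 - ε) * t)) * H) := by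
        rw [Finset.sum_add_distrib, Finset.mul_sum, Finset.sum_const, Finset.card_univ, nsmul_eq_mul, hcard]
    _ ≤ w ^ β * (C * (L : ℝ) ^ (m * n) * Real.exp (-((1 - ε) * t)) * (vol (g.1 * ic B)) ^ (-β)) + (L : ℝ) ^ (m * n) * (Real.exp (-((1 - ε) * t)) * H) := by
        gcongr
    _ = C * (L : ℝ) ^ (m * n) * Real.exp (-((1 - ε) * t)) * (w ^ β * (vol (g.1 * ic B)) ^ (-β)) + (L : ℝ) ^ (m * n) * (Real.exp (-((1 - ε) * t)) * H) := by ring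
    _ ≤ C * (L : ℝ) ^ (m * n) * Real.exp (-((1 - ε) * t)) * H + (L : ℝ) ^ (m * n) * (Real.exp (-((1 - ε) * t)) * H) := by
        gcongr
    _ = _ := by ring

lemma height_thm (hm : 0 < m) (hn : 0 < n) {ε : ℝ} (hε : 0 < ε) (hε1 : ε < 1) :
    ∃ r C : ℝ, 0 < r ∧ r ≤ 1 ∧ 0 ≤ C ∧ ∀ (t : ℝ) (L : ℕ), 0 ≤ t → Real.exp (lam m n * t) ≤ L →
      ∃ η : ℝ, 0 < η ∧ η ≤ 1 ∧ ∀ g : G (m + n), ∑ k : Fin m × Fin n → Fin L,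
        Hh m n ε η (aSL m n hm hn t * uS m n (ctr r k) * g) ≤
        (L : ℝ) ^ (m * n) * (1 + C * Real.exp (-((1 - ε) * t)) * Hh m n ε η g) := by
  obtain ⟨r, hr, hr1, hdet⟩ := exists_r m n
  have hh : ∀ i : ℕ, ∃ C : ℝ, 0 ≤ C ∧ (1 ≤ i → i < m + n → ∀ (t : ℝ) (L : ℕ), 0 ≤ t → Real.exp (lam m n * t) ≤ L →
      ∀ Q : ℝ, 0 ≤ Q → (∀ (k : Fin m × Fin n → Fin L) (M : Matrix (Fin (m+n)) (Fin i) ℝ),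
        vol M ≤ Q * vol ((aSL m n hm hn t * uS m n (ctr r k) : G (m+n)).1 * M)) →
      ∀ η : ℝ, 0 < η → η ≤ 1 → Real.sqrt (2 * ((m+n).factorial : ℝ)) * Q * η ≤ Real.exp (-t) →
      ∀ g : G (m + n), ∑ k : Fin m × Fin n → Fin L,
        (wt m n η i * alpha i (aSL m n hm hn t * uS m n (ctr r k) * g)) ^ ((1 - ε) / kap m n i) ≤
        (L : ℝ) ^ (m * n) * (C * Real.exp (-((1 - ε) * t)) * Hh m n ε η g)) := by
    intro i
    by_cases h : 1 ≤ i ∧ i < m + n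
    · obtain ⟨C, h0, hC⟩ := height_term hm hn hε hε1 hr hr1 h.1 h.2 (hdet i h.2.le)
      exact ⟨C, h0, fun _ _ => hC⟩
    · exact ⟨0, le_rfl, fun a b => absurd ⟨a, b⟩ h⟩
  choose C hC0 hC using hh
  refine ⟨r, ∑ i ∈ Finset.Ico 1 (m + n), C i, hr, hr1, Finset.sum_nonneg fun i _ => hC0 i, fun t L ht hL => ?_⟩
  have hbd : ∀ k : Fin m × Fin n → Fin L, ∃ c : ℝ, 0 ≤ c ∧ ∀ a b, |((aSL m n hm hn t * uS m n (ctr r k))⁻¹ : G (m+n)).1 a b| ≤ c := fun k => exists_bound _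
  choose cc hcc0 hcc using hbd
  set c := 1 + ∑ k, cc k with hc
  have hc1 : 1 ≤ c := by have := Finset.sum_nonneg fun k (_ : k ∈ Finset.univ) => hcc0 k; linarith
  have hcle : ∀ k, cc k ≤ c := fun k => by
    have := Finset.single_le_sum (f := cc) (fun k _ => hcc0 k) (Finset.mem_univ k); linarith
  have hd1 : (1 : ℝ) ≤ ((m + n : ℕ) : ℝ) := by exact_mod_cast (by omega : 1 ≤ m + n)
  have hdc : (1 : ℝ) ≤ ((m + n : ℕ) : ℝ) * c := by nlinarith
  set Q := (((m + n : ℕ) : ℝ) * c) ^ (m + n) with hQ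
  have hQ1 : 1 ≤ Q := one_le_pow₀ hdc
  set s := Real.sqrt (2 * ((m+n).factorial : ℝ)) with hs
  have hs1 : 1 ≤ s := by
    rw [hs, Real.one_le_sqrt]
    have : (1 : ℝ) ≤ ((m+n).factorial : ℝ) := by exact_mod_cast Nat.succ_le_of_lt (Nat.factorial_pos _)
    linarith
  have hsQ : 1 ≤ s * Q := one_le_mul_of_one_le_of_one_le hs1 hQ1
  refine ⟨Real.exp (-t) / (s * Q), by positivity, ?_, fun g => ?_⟩
  · rw [div_le_one (by positivity)]
    exact le_trans (Real.exp_le_one_iff.2 (by linarith)) hsQ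
  set η := Real.exp (-t) / (s * Q) with hη
  have hη0 : 0 < η := by positivity
  have hη1 : η ≤ 1 := by
    rw [hη, div_le_one (by positivity)]
    exact le_trans (Real.exp_le_one_iff.2 (by linarith)) hsQ
  have hcard : (Fintype.card (Fin m × Fin n → Fin L) : ℝ) = (L : ℝ) ^ (m * n) := by
    simp
  have hHs : ∀ g' : G (m+n), Hh m n ε η g' ≤ 1 + ∑ i ∈ Finset.Ico 1 (m + n), (wt m n η i * alpha i g') ^ ((1 - ε) / kap m n i) := by
    intro g'
    have hnn : ∀ i, 0 ≤ (wt m n η i * alpha i g') ^ ((1 - ε) / kap m n i) := fun i =>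
      Real.rpow_nonneg (mul_nonneg (wt_pos hη0 i).le (alpha_nonneg _ _)) _
    unfold Hh
    refine Finset.sup'_le _ _ fun i hi => ?_
    have hi' : i ≤ m + n := by simpa [Nat.lt_succ_iff] using hi
    by_cases h : 1 ≤ i ∧ i < m + n
    · have := Finset.single_le_sum (f := fun i => (wt m n η i * alpha i g') ^ ((1 - ε) / kap m n i)) (fun i _ => hnn i) (Finset.mem_Ico.2 h)
      linarith
    · have : kap m n i = 0 := by
        rcases (by omega : i = 0 ∨ i = m + n) with rfl | rfl
        · exact kap_zero
        · exact kap_top hm hn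
      rw [this, _root_.div_zero, Real.rpow_zero]
      have := Finset.sum_nonneg fun i (_ : i ∈ Finset.Ico 1 (m+n)) => hnn i
      linarith
  calc _ ≤ ∑ k : Fin m × Fin n → Fin L, (1 + ∑ i ∈ Finset.Ico 1 (m + n), (wt m n η i * alpha i (aSL m n hm hn t * uS m n (ctr r k) * g)) ^ ((1 - ε) / kap m n i)) :=
        Finset.sum_le_sum fun k _ => hHs _
    _ = (L : ℝ) ^ (m * n) + ∑ i ∈ Finset.Ico 1 (m + n), ∑ k : Fin m × Fin n → Fin L, (wt m n η i * alpha i (aSL m n hm hn t * uS m n (ctr r k) * g)) ^ ((1 - ε) / kap m n i) := by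
        rw [Finset.sum_add_distrib, Finset.sum_comm, Finset.sum_const, Finset.card_univ, nsmul_eq_mul, hcard, mul_one]
    _ ≤ (L : ℝ) ^ (m * n) + ∑ i ∈ Finset.Ico 1 (m + n), (L : ℝ) ^ (m * n) * (C i * Real.exp (-((1 - ε) * t)) * Hh m n ε η g) := by
        refine add_le_add le_rfl (Finset.sum_le_sum fun i hi => ?_)
        rw [Finset.mem_Ico] at hi
        refine hC i hi.1 hi.2 t L ht hL Q (by linarith) (fun k M => ?_) η hη0 hη1 ?_ g
        · refine (vol_le_inv _ _ (inv_mul_coe (aSL m n hm hn t * uS m n (ctr r k))) (by linarith) (fun a b => (hcc k a b).trans (hcle k)) M).trans ?_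
          refine mul_le_mul_of_nonneg_right ?_ (vol_nonneg _)
          rw [Fintype.card_fin]
          exact pow_le_pow_right₀ hdc hi.2.le
        · rw [hη]; field_simp; exact le_rfl
    _ = _ := by
        rw [← Finset.mul_sum, ← Finset.sum_mul, ← Finset.sum_mul]; ring

end HeightThm
end KK

namespace KK

section Tree
variable {m n : ℕ}

lemma aSL_val (hm : 0 < m) (hn : 0 < n) (t : ℝ) :
    (aSL m n hm hn t : G (m+n)).1 = (diagonal (aD m n t)).submatrix finSumFinEquiv.symm finSumFinEquiv.symm := by
  change aMat m n t = _
  unfold aMat aD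
  rw [reindex_apply]
  congr 1
  ext a b
  rcases a with a | a <;> rcases b with b | b <;> simp [Matrix.one_apply, diagonal_apply]

lemma uS_val (A : Fin m × Fin n → ℝ) :
    (uS m n A : G (m+n)).1 = (UA A).submatrix finSumFinEquiv.symm finSumFinEquiv.symm := by
  change uMat m n (fun a b => A (a, b)) = _
  unfold uMat UA
  rw [reindex_apply]

lemma G_ext {d : ℕ} {g h : G d} (e : g.1 = h.1) : g = h := Subtype.ext e

lemma uS_add (A B : Fin m × Fin n → ℝ) : uS m n (A + B) = uS m n A * uS m n B := by
  apply G_ext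
  change _ = (uS m n A).1 * (uS m n B).1
  rw [uS_val, uS_val, uS_val, UA_add, submatrix_mul_equiv]

lemma uS_zero : uS m n 0 = 1 := by
  apply G_ext
  rw [uS_val, UA_zero]
  change _ = (1 : Matrix _ _ ℝ)
  simp

lemma uS_neg (A : Fin m × Fin n → ℝ) : uS m n (-A) = (uS m n A)⁻¹ := by
  rw [eq_inv_iff_mul_eq_one, ← uS_add, neg_add_cancel, uS_zero]

lemma aSL_uS (hm : 0 < m) (hn : 0 < n) (t : ℝ) (B : Fin m × Fin n → ℝ) :
    aSL m n hm hn t * uS m n B = uS m n (Real.exp (lam m n * t) • B) * aSL m n hm hn t := by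
  apply G_ext
  change (aSL m n hm hn t).1 * (uS m n B).1 = (uS m n _).1 * (aSL m n hm hn t).1
  rw [uS_val, uS_val, aSL_val, submatrix_mul_equiv, submatrix_mul_equiv, aD_UA]

lemma aSL_add (hm : 0 < m) (hn : 0 < n) (s t : ℝ) :
    aSL m n hm hn (s + t) = aSL m n hm hn s * aSL m n hm hn t := by
  apply G_ext
  change _ = (aSL m n hm hn s).1 * (aSL m n hm hn t).1
  rw [aSL_val, aSL_val, aSL_val, submatrix_mul_equiv, diagonal_mul_diagonal]
  congr 2
  ext k
  rcases k with k | k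
  · simp only [aD, Sum.elim_inl]; rw [← Real.exp_add]; congr 1; ring
  · simp only [aD, Sum.elim_inr]; rw [← Real.exp_add]; congr 1; ring

lemma aSL_zero (hm : 0 < m) (hn : 0 < n) : aSL m n hm hn 0 = 1 := by
  have := aSL_add hm hn 0 0
  rw [add_zero] at this
  exact (mul_eq_left.1 this.symm)

lemma aSL_pow (hm : 0 < m) (hn : 0 < n) (t : ℝ) (k : ℕ) : aSL m n hm hn t ^ k = aSL m n hm hn (k * t) := by
  induction k with
  | zero => simp [aSL_zero hm hn]
  | succ k ih => rw [pow_succ, ih, ← aSL_add]; congr 1; push_cast; ring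

lemma uS_entry {A : Fin m × Fin n → ℝ} (hA : ∀ e, |A e| ≤ 1) (a b) : |(uS m n A).1 a b| ≤ 1 := by
  rw [uS_val, submatrix_apply]
  rcases finSumFinEquiv.symm a with i | i <;> rcases finSumFinEquiv.symm b with j | j <;> simp [UA, Matrix.one_apply]
  · split_ifs <;> simp
  · exact hA _
  · split_ifs <;> simp

lemma Hh_pert (hm : 0 < m) (hn : 0 < n) {ε η : ℝ} (hη : 0 < η) (hε1 : ε < 1) {B : Fin m × Fin n → ℝ} (hB : ∀ e, |B e| ≤ 1) (g : G (m+n)) :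
    Hh m n ε η g ≤ ((m + n : ℕ) : ℝ) ^ (bexp m n ε) * Hh m n ε η (uS m n B * g) := by
  have := Hh_mul_le hm hn hη hε1 le_rfl (uS m n B)⁻¹ (uS m n B * g) (by rw [inv_inv]; exact uS_entry hB)
  rwa [inv_mul_cancel_left, mul_one] at this

lemma exists_ctr {r : ℝ} (hr : 0 < r) {L : ℕ} (hL : 0 < L) (A : Fin m × Fin n → ℝ) (hA : ∀ e, |A e| ≤ r) :
    ∃ k : Fin m × Fin n → Fin L, ∀ e, |A e - ctr r k e| ≤ r / L := by
  have hL' : (0 : ℝ) < L := by exact_mod_cast hL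
  have : ∀ e, ∃ k : Fin L, |A e - r * (-1 + (2 * (k : ℕ) + 1) / L)| ≤ r / L := by
    intro e
    have h1 := abs_le.1 (hA e)
    set y := (A e + r) / (2 * r) * L with hy
    have hy0 : 0 ≤ y := by
      have : 0 ≤ A e + r := by linarith
      positivity
    have hyL : y ≤ L := by
      rw [hy]
      have : (A e + r) / (2 * r) ≤ 1 := by rw [div_le_one (by linarith)]; linarith
      nlinarith
    have hAe : A e = r * (-1 + 2 * y / L) := by rw [hy]; field_simp; ring
    have key : ∀ k : ℕ, (k : ℝ) ≤ y → y ≤ k + 1 → |A e - r * (-1 + (2 * k + 1) / L)| ≤ r / L := by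
      intro k a b
      have : A e - r * (-1 + (2 * k + 1) / L) = r / L * (2 * y - (2 * k + 1)) := by rw [hAe]; field_simp; ring
      rw [this, abs_mul, abs_of_pos (div_pos hr hL')]
      have : |2 * y - (2 * (k : ℝ) + 1)| ≤ 1 := abs_le.2 ⟨by linarith, by linarith⟩
      have h0 := div_pos hr hL'
      nlinarith
    by_cases hlt : ⌊y⌋₊ < L
    · exact ⟨⟨_, hlt⟩, key _ (Nat.floor_le hy0) (Nat.lt_floor_add_one y).le⟩
    · have : (L : ℝ) ≤ y := by
        have := Nat.floor_le hy0
        have h2 : (L : ℝ) ≤ ⌊y⌋₊ := by exact_mod_cast not_lt.1 hlt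
        linarith
      have hyL' : y = L := le_antisymm hyL this
      refine ⟨⟨L - 1, by omega⟩, key (L - 1) ?_ ?_⟩
      · rw [hyL']; exact_mod_cast Nat.sub_le _ _
      · rw [hyL', Nat.cast_sub hL]; simp
  choose k hk using this
  exact ⟨k, hk⟩

open Classical in
lemma tree (hm : 0 < m) (hn : 0 < n) {t r s C Cp M1 : ℝ} (hr : 0 < r) (hr1 : r ≤ 1) {L : ℕ}
    (hL : Real.exp (lam m n * t) ≤ L) (hC : 0 ≤ C) (hs : 0 ≤ s) (hM1 : Real.exp s ≤ M1)
    (H : G (m + n) → ℝ) (hH1 : ∀ g, 1 ≤ H g)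
    (hstep : ∀ g, ∑ k : Fin m × Fin n → Fin L, H (aSL m n hm hn t * uS m n (ctr r k) * g) ≤
        (L : ℝ) ^ (m * n) * (1 + C * Real.exp (-s) * H g))
    (hCp : 0 < Cp) (hpert : ∀ B : Fin m × Fin n → ℝ, (∀ e, |B e| ≤ 1) → ∀ g, H (uS m n B * g) ≤ Cp * H g)
    (N : ℕ) : ∀ g : G (m + n), ∃ (W : Type) (_ : Fintype W) (cnt : W → ℕ) (z : W → (Fin m × Fin n → ℝ)),
      ∑ w, Real.exp (s * cnt w) ≤ ((L : ℝ) ^ (m * n) * (2 + C)) ^ N * max 1 (H g / M1) ∧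
      ∀ A : Fin m × Fin n → ℝ, (∀ e, |A e| ≤ r) → ∃ w, (∀ e, |A e - z w e| ≤ r * Real.exp (-(lam m n * t * N))) ∧
        ∑ l ∈ Finset.range N, (if Cp * M1 < H (aSL m n hm hn t ^ (l + 1) * uS m n A * g) then 1 else 0) ≤ cnt w := by
  have hLpos : 0 < L := by
    have : (0 : ℝ) < L := lt_of_lt_of_le (Real.exp_pos _) hL
    exact_mod_cast this
  have hL' : (0 : ℝ) < L := by exact_mod_cast hLpos
  have hM1p : 0 < M1 := lt_of_lt_of_le (Real.exp_pos _) hM1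
  induction N with
  | zero =>
    intro g
    refine ⟨Unit, inferInstance, fun _ => 0, fun _ => 0, ?_, fun A hA => ⟨(), fun e => ?_, ?_⟩⟩
    · simp
    · simpa using hA e
    · simp
  | succ N ih =>
    intro g
    set gk : (Fin m × Fin n → Fin L) → G (m + n) := fun k => aSL m n hm hn t * uS m n (ctr r k) * g with hgk
    choose W hW cnt z hsum hz using fun k => ih (gk k)
    set bit : (Fin m × Fin n → Fin L) → ℕ := fun k => if M1 < H (gk k) then 1 else 0 with hbit
    refine ⟨Σ k, W k, inferInstance, fun p => bit p.1 + cnt p.1 p.2,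
      fun p => ctr r p.1 + Real.exp (-(lam m n * t)) • z p.1 p.2, ?_, fun A hA => ?_⟩
    · rw [Fintype.sum_sigma]
      have hΛ : 0 ≤ (L : ℝ) ^ (m * n) * (2 + C) := by positivity
      calc ∑ k, ∑ w, Real.exp (s * ((bit k + cnt k w : ℕ) : ℝ))
          = ∑ k, Real.exp (s * bit k) * ∑ w, Real.exp (s * cnt k w) := by
            refine Finset.sum_congr rfl fun k _ => ?_
            rw [Finset.mul_sum]
            refine Finset.sum_congr rfl fun w _ => ?_
            rw [← Real.exp_add]; congr 1; push_cast; ring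
        _ ≤ ∑ k, Real.exp (s * bit k) * (((L : ℝ) ^ (m * n) * (2 + C)) ^ N * max 1 (H (gk k) / M1)) :=
            Finset.sum_le_sum fun k _ => mul_le_mul_of_nonneg_left (hsum k) (Real.exp_pos _).le
        _ ≤ ∑ k, ((L : ℝ) ^ (m * n) * (2 + C)) ^ N * (1 + Real.exp s * H (gk k) / M1) := by
            refine Finset.sum_le_sum fun k _ => ?_
            rw [mul_left_comm]
            refine mul_le_mul_of_nonneg_left ?_ (by positivity)
            have hH0 : 0 < H (gk k) := by linarith [hH1 (gk k)]
            have : 0 < Real.exp s * H (gk k) / M1 := by positivity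
            by_cases h : M1 < H (gk k)
            · simp only [hbit, if_pos h, Nat.cast_one, mul_one]
              rw [max_eq_right (by rw [one_le_div hM1p]; exact h.le), mul_div_assoc]
              rw [mul_div_assoc] at this
              linarith
            · simp only [hbit, if_neg h, Nat.cast_zero, mul_zero, Real.exp_zero, one_mul]
              rw [max_eq_left (by rw [div_le_one hM1p]; exact not_lt.1 h)]
              linarith
        _ = ((L : ℝ) ^ (m * n) * (2 + C)) ^ N * ((L : ℝ) ^ (m * n) + Real.exp s / M1 * ∑ k, H (gk k)) := by
            rw [← Finset.mul_sum, Finset.sum_add_distrib, Finset.mul_sum]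
            congr 2
            · simp
            · refine Finset.sum_congr rfl fun k _ => by ring
        _ ≤ ((L : ℝ) ^ (m * n) * (2 + C)) ^ N * ((L : ℝ) ^ (m * n) + Real.exp s / M1 * ((L : ℝ) ^ (m * n) * (1 + C * Real.exp (-s) * H g))) := by
            have := hstep g
            gcongr
        _ ≤ ((L : ℝ) ^ (m * n) * (2 + C)) ^ N * (((L : ℝ) ^ (m * n) * (2 + C)) * max 1 (H g / M1)) := by
            refine mul_le_mul_of_nonneg_left ?_ (by positivity)
            have e1 : Real.exp s / M1 * ((L : ℝ) ^ (m * n) * (1 + C * Real.exp (-s) * H g)) = (L : ℝ) ^ (m * n) * (Real.exp s / M1 + C * (H g / M1)) := by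
              rw [Real.exp_neg]
              have := (Real.exp_pos s).ne'
              field_simp
            have e2 : Real.exp s / M1 ≤ 1 := by rw [div_le_one hM1p]; exact hM1
            have e3 := le_max_left 1 (H g / M1)
            have e4 := le_max_right 1 (H g / M1)
            rw [e1]
            calc (L : ℝ) ^ (m * n) + (L : ℝ) ^ (m * n) * (Real.exp s / M1 + C * (H g / M1))
                = (L : ℝ) ^ (m * n) * (1 + Real.exp s / M1 + C * (H g / M1)) := by ring
              _ ≤ (L : ℝ) ^ (m * n) * ((2 + C) * max 1 (H g / M1)) := by
                refine mul_le_mul_of_nonneg_left ?_ (by positivity)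
                have := mul_le_mul_of_nonneg_left e4 hC
                linarith
              _ = _ := by ring
        _ = _ := by rw [pow_succ]; ring
    · obtain ⟨k, hk⟩ := exists_ctr hr hLpos A hA
      set B : Fin m × Fin n → ℝ := Real.exp (lam m n * t) • (A - ctr r k) with hB
      have hBr : ∀ e, |B e| ≤ r := by
        intro e
        simp only [hB, Pi.smul_apply, smul_eq_mul, Pi.sub_apply]
        rw [abs_mul, abs_of_pos (Real.exp_pos _)]
        calc _ ≤ Real.exp (lam m n * t) * (r / L) := mul_le_mul_of_nonneg_left (hk e) (Real.exp_pos _).le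
          _ ≤ L * (r / L) := by gcongr
          _ = r := by field_simp
      have hcomm : aSL m n hm hn t * uS m n A * g = uS m n B * gk k := by
        have e : A = (A - ctr r k) + ctr r k := by simp
        conv_lhs => rw [e, uS_add, ← mul_assoc, aSL_uS]
        simp only [hgk, hB, mul_assoc]
      obtain ⟨w, hw1, hw2⟩ := hz k B hBr
      refine ⟨⟨k, w⟩, fun e => ?_, ?_⟩
      · have e1 : A e - (ctr r k + Real.exp (-(lam m n * t)) • z k w) e = Real.exp (-(lam m n * t)) * (B e - z k w e) := by
          simp only [hB, Pi.add_apply, Pi.smul_apply, smul_eq_mul, Pi.sub_apply]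
          rw [Real.exp_neg]
          have := (Real.exp_pos (lam m n * t)).ne'
          field_simp
          ring
        change |A e - (ctr r k + Real.exp (-(lam m n * t)) • z k w) e| ≤ _
        rw [e1, abs_mul, abs_of_pos (Real.exp_pos _)]
        calc _ ≤ Real.exp (-(lam m n * t)) * (r * Real.exp (-(lam m n * t * N))) := mul_le_mul_of_nonneg_left (hw1 e) (Real.exp_pos _).le
          _ = _ := by
            rw [mul_left_comm, ← Real.exp_add]; congr 2; push_cast; ring
      · rw [Finset.sum_range_succ', add_comm]
        refine add_le_add ?_ ?_
        · simp only [zero_add, pow_one, hcomm]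
          have hp := hpert B (fun e => (hBr e).trans hr1) (gk k)
          split_ifs with h
          · have : M1 < H (gk k) := by
              by_contra hcon
              have := mul_le_mul_of_nonneg_left (not_lt.1 hcon) hCp.le
              linarith
            simp [hbit, this]
          · exact Nat.zero_le _
        · refine le_trans (le_of_eq ?_) hw2
          refine Finset.sum_congr rfl fun l _ => ?_
          have : aSL m n hm hn t ^ (l + 1 + 1) * uS m n A * g = aSL m n hm hn t ^ (l + 1) * uS m n B * gk k := by
            rw [pow_succ, mul_assoc, mul_assoc, ← mul_assoc (aSL m n hm hn t), hcomm, mul_assoc]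
          rw [this]

end Tree
end KK

namespace KK

section Mahler
variable {d : ℕ}

/-- cast of integer vectors -/
def vc (v : Fin d → ℤ) : Fin d → ℝ := fun i => (v i : ℝ)

lemma minkowski (h : Matrix (Fin d) (Fin d) ℝ) (hdet : h.det = 1) (b : Fin d → ℝ) (hb : ∀ s, 0 < b s)
    (hprod : 1 < ∏ s, b s) : ∃ v : Fin d → ℤ, v ≠ 0 ∧ ∀ s, |(h.mulVec (vc v)) s| < b s := by
  have fund := ZSpan.isAddFundamentalDomain' (Pi.basisFun ℝ (Fin d)) volume
  set S : Set (Fin d → ℝ) := (toLin' h) ⁻¹' (Set.pi Set.univ fun s => Set.Ioo (-(b s)) (b s)) with hS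
  have hvol : volume S = ENNReal.ofReal (2 ^ d * ∏ s, b s) := by
    have hd : LinearMap.det (toLin' h) ≠ 0 := by rw [LinearMap.det_toLin', hdet]; exact one_ne_zero
    rw [hS, Measure.addHaar_preimage_linearMap volume hd, LinearMap.det_toLin', hdet, Real.volume_pi_Ioo]
    simp only [inv_one, abs_one, ENNReal.ofReal_one, one_mul]
    rw [← ENNReal.ofReal_prod_of_nonneg (fun s _ => by linarith [hb s])]
    congr 1
    have : ∀ s, b s - -b s = 2 * b s := fun s => by ring
    simp only [this, Finset.prod_mul_distrib, Finset.prod_const, Finset.card_univ, Fintype.card_fin]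
  have hF : volume (ZSpan.fundamentalDomain (Pi.basisFun ℝ (Fin d))) = 1 := by
    rw [ZSpan.fundamentalDomain_pi_basisFun, volume_pi, Measure.pi_pi]; simp
  have hcount : Countable (Submodule.span ℤ (Set.range (Pi.basisFun ℝ (Fin d)))) := inferInstance
  have hcount' : Countable (Submodule.span ℤ (Set.range (Pi.basisFun ℝ (Fin d)))).toAddSubgroup := hcount
  obtain ⟨x, hx0, hx⟩ := exists_ne_zero_mem_lattice_of_measure_mul_two_pow_lt_measure (s := S) fund (by
      intro x hx
      simp only [hS, Set.mem_preimage, Set.mem_pi, Set.mem_univ, true_implies, map_neg, Pi.neg_apply, Set.mem_Ioo] at hx ⊢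
      intro s; have := hx s; constructor <;> linarith) (by
      refine Convex.linear_preimage ?_ _
      exact convex_pi fun s _ => convex_Ioo _ _) (by
      rw [hF, hvol, one_mul, Module.finrank_fintype_fun_eq_card, Fintype.card_fin]
      rw [show (2 : ℝ≥0∞) ^ d = ENNReal.ofReal (2 ^ d) by rw [ENNReal.ofReal_pow (by norm_num)]; simp]
      rw [ENNReal.ofReal_lt_ofReal_iff (by positivity)]
      have : (0 : ℝ) < 2 ^ d := by positivity
      nlinarith)
  have hmem := x.2
  rw [Submodule.mem_toAddSubgroup, Module.Basis.mem_span_iff_repr_mem] at hmem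
  choose v hv using hmem
  have hxv : x.1 = vc v := by
    ext i
    have := hv i
    simp only [Pi.basisFun_repr, algebraMap_int_eq, eq_intCast] at this
    exact this.symm
  refine ⟨v, ?_, fun s => ?_⟩
  · rintro rfl
    apply hx0
    apply Subtype.ext
    rw [hxv]; ext i; simp [vc]
  · rw [hxv] at hx
    have := hx s (Set.mem_univ _)
    rw [toLin'_apply] at this
    exact abs_lt.2 this

lemma short_span (hd : 0 < d) {c : ℝ} (hc : 0 < c) : ∃ R : ℝ, 0 < R ∧ ∀ g : G d,
    (∀ v : Fin d → ℤ, v ≠ 0 → ∃ s, c ≤ |(g.1.mulVec (vc v)) s|) →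
    ∃ B : Matrix (Fin d) (Fin d) ℤ, B.det ≠ 0 ∧ ∀ a b, |(g.1 * ic B) a b| ≤ R := by
  have hd' : (0 : ℝ) < d := by exact_mod_cast hd
  set q := c / d with hq
  have hq0 : 0 < q := by positivity
  set T := 2 / q ^ (d - 1) with hT
  have hT0 : 0 < T := by positivity
  refine ⟨T + c, by positivity, fun g hg => ?_⟩
  set S : Set (Fin d → ℝ) := {y | ∃ v : Fin d → ℤ, y = g.1.mulVec (vc v) ∧ ∀ s, |y s| ≤ T + c} with hS
  have hspan : Submodule.span ℝ S = ⊤ := by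
    by_contra hne
    obtain ⟨f, hf0, hf⟩ := Submodule.exists_le_ker_of_lt_top _ (lt_top_iff_ne_top.2 hne)
    set l : Fin d → ℝ := fun s => f (Pi.single s 1) with hl
    have hfl : ∀ y, f y = ∑ s, l s * y s := by
      intro y
      conv_lhs => rw [← Finset.univ_sum_single y, map_sum]
      refine Finset.sum_congr rfl fun s _ => ?_
      have : (Pi.single s (y s) : Fin d → ℝ) = y s • Pi.single s 1 := by
        rw [← Pi.single_smul, smul_eq_mul, mul_one]
      rw [this, map_smul, smul_eq_mul, mul_comm]
    have : Nonempty (Fin d) := ⟨⟨0, hd⟩⟩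
    obtain ⟨r, hr⟩ := Finite.exists_max (fun s => |l s|)
    have hlr : l r ≠ 0 := by
      intro h0
      apply hf0
      ext y
      simp only [h0, abs_zero, abs_nonpos_iff] at hr
      change f (Pi.single y 1) = 0
      exact hr y
    set e : Fin d → ℝ := fun s => l s / l r with he
    have he1 : ∀ s, |e s| ≤ 1 := fun s => by
      rw [he]; simp only [abs_div]; rw [div_le_one (abs_pos.2 hlr)]; exact hr s
    have her : e r = 1 := div_self hlr
    set E : Matrix (Fin d) (Fin d) ℝ := (1 : Matrix (Fin d) (Fin d) ℝ).updateRow r e with hE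
    have hEdet : E.det = 1 := by
      have h1 := det_updateRow_sum (1 : Matrix (Fin d) (Fin d) ℝ) r e
      have h2 : (∑ k, e k • (1 : Matrix (Fin d) (Fin d) ℝ) k) = e := by
        ext b
        simp [Finset.sum_apply, Matrix.one_apply]
      rw [h2, her] at h1
      simpa using h1
    obtain ⟨v, hv0, hv⟩ := minkowski (E * g.1) (by rw [det_mul, hEdet, one_mul]; exact g.2)
      (fun s => if s = r then T else q) (fun s => by split_ifs <;> assumption) (by
        rw [← Finset.mul_prod_erase _ _ (Finset.mem_univ r), if_pos rfl]
        rw [Finset.prod_congr rfl (g := fun _ => q) (fun s hs => if_neg (Finset.ne_of_mem_erase hs))]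
        rw [Finset.prod_const, Finset.card_erase_of_mem (Finset.mem_univ _), Finset.card_univ, Fintype.card_fin, hT]
        rw [div_mul_cancel₀ _ (by positivity)]; norm_num)
    set y := g.1.mulVec (vc v) with hy
    have hEy : (E * g.1).mulVec (vc v) = E.mulVec y := by rw [hy, mulVec_mulVec]
    rw [hEy] at hv
    have hs : ∀ s, s ≠ r → |y s| < q := by
      intro s hs
      have := hv s
      rw [if_neg hs] at this
      have e1 : (E.mulVec y) s = y s := by
        simp only [mulVec, hE, dotProduct]
        rw [updateRow_ne hs]; simp [Matrix.one_apply]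
      rwa [e1] at this
    have hEr : (E.mulVec y) r = y r + ∑ s ∈ Finset.univ.erase r, e s * y s := by
      simp only [mulVec, hE, dotProduct, updateRow_self]
      rw [← Finset.add_sum_erase _ _ (Finset.mem_univ r), her, one_mul]
    have hsumle : |∑ s ∈ Finset.univ.erase r, e s * y s| ≤ (d - 1) * q := by
      refine (Finset.abs_sum_le_sum_abs _ _).trans ?_
      calc _ ≤ ∑ s ∈ Finset.univ.erase r, q := Finset.sum_le_sum fun s h => by
            rw [abs_mul]
            have h1 := hs s (Finset.ne_of_mem_erase h)
            have h2 := he1 s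
            nlinarith [abs_nonneg (e s), abs_nonneg (y s)]
        _ = _ := by
          rw [Finset.sum_const, Finset.card_erase_of_mem (Finset.mem_univ _), Finset.card_univ, Fintype.card_fin, nsmul_eq_mul, Nat.cast_sub hd]; simp
    have hdq : (d : ℝ) * q = c := by rw [hq]; field_simp
    have hd1 : (1 : ℝ) ≤ d := by exact_mod_cast hd
    have hvr := hv r
    rw [if_pos rfl, hEr] at hvr
    have hyS : y ∈ S := by
      refine ⟨v, rfl, fun s => ?_⟩
      by_cases hsr : s = r
      · subst hsr
        have := abs_sub (y s + ∑ s ∈ Finset.univ.erase s, e s * y s) (∑ s ∈ Finset.univ.erase s, e s * y s)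
        rw [add_sub_cancel_right] at this
        nlinarith
      · have := hs s hsr
        nlinarith
    have hfy : f y = 0 := hf (Submodule.subset_span hyS)
    have hEr0 : (E.mulVec y) r = 0 := by
      have : (E.mulVec y) r = f y / l r := by
        rw [hfl, Finset.sum_div]
        simp only [mulVec, hE, dotProduct, updateRow_self, he]
        refine Finset.sum_congr rfl fun s _ => by ring
      rw [this, hfy, zero_div]
    obtain ⟨s, hs'⟩ := hg v hv0
    have hyr : |y r| < c := by
      have : y r = -∑ s ∈ Finset.univ.erase r, e s * y s := by linarith [hEr0, hEr]
      rw [this, abs_neg]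
      nlinarith
    have : |y s| < c := by
      by_cases hsr : s = r
      · rw [hsr]; exact hyr
      · have := hs s hsr
        nlinarith
    exact absurd hs' (not_le.2 this)
  set bs := Module.Basis.ofSpan hspan.ge with hbs
  have hbsub := Module.Basis.ofSpan_subset hspan.ge
  have : Finite _ := Module.Finite.finite_basis bs
  let e := bs.indexEquiv (Pi.basisFun ℝ (Fin d))
  set b' := bs.reindex e with hb'
  have hmem : ∀ j, b' j ∈ S := fun j => by
    rw [hb', Module.Basis.reindex_apply]
    exact hbsub ⟨_, rfl⟩
  choose v hv hvb using hmem
  refine ⟨Matrix.of fun a j => v j a, ?_, fun a j => ?_⟩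
  · have hcol : (g.1 * ic (Matrix.of fun a j => v j a)).col = b' := by
      funext j
      rw [hv j]
      ext a
      rfl
    have hli : LinearIndependent ℝ (g.1 * ic (Matrix.of fun a j => v j a)).col := by
      rw [hcol]; exact b'.linearIndependent
    rw [linearIndependent_cols_iff_isUnit, isUnit_iff_isUnit_det] at hli
    have hdm := det_mul g.1 (ic (Matrix.of fun a j => v j a))
    rw [g.2, one_mul] at hdm
    replace hli := hdm ▸ hli
    intro h0
    have : (ic (Matrix.of fun a j => v j a) : Matrix (Fin d) (Fin d) ℝ).det = ((Matrix.of fun a j => v j a : Matrix (Fin d) (Fin d) ℤ).det : ℝ) := by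
      have := (Int.castRingHom ℝ).map_det (Matrix.of fun a j => v j a : Matrix (Fin d) (Fin d) ℤ)
      exact this.symm
    rw [this, h0] at hli
    simp at hli
  · have := hvb j a
    rw [hv j] at this
    exact this

end Mahler
end KK

namespace KK

section Mahler2
variable {d : ℕ}

lemma det_bound (M : Matrix (Fin d) (Fin d) ℝ) {R : ℝ} (hR : 0 ≤ R) (h : ∀ a b, |M a b| ≤ R) :
    |M.det| ≤ d.factorial * R ^ d := by
  have := det_le (abv := IsAbsoluteValue.toAbsoluteValue (abs : ℝ → ℝ)) (A := M) (x := R) (fun i j => h i j)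
  simpa [nsmul_eq_mul] using this

lemma reps (K : ℕ) : ∃ A : ℝ, 0 ≤ A ∧ ∀ B : Matrix (Fin d) (Fin d) ℤ, B.det ≠ 0 → |B.det| ≤ K →
    ∃ B0 : Matrix (Fin d) (Fin d) ℤ, B0.det = B.det ∧ (∀ a b, B.det ∣ B a b - B0 a b) ∧
      ∀ a b, |(ic (adjugate B0)) a b| ≤ A := by
  set S : Set (Matrix (Fin d) (Fin d) ℤ) := {B | B.det ≠ 0 ∧ |B.det| ≤ K} with hS
  set F : Matrix (Fin d) (Fin d) ℤ → ℤ × (Fin d → Fin d → ℤ) := fun B => (B.det, fun a b => B a b % B.det) with hF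
  have hfin : (F '' S).Finite := by
    refine Set.Finite.subset (s := (Set.Icc (-(K : ℤ)) K) ×ˢ (Set.pi Set.univ fun _ => Set.pi Set.univ fun _ => Set.Icc (0 : ℤ) K)) ?_ ?_
    · refine (Set.finite_Icc (-(K : ℤ)) K).prod (Set.Finite.pi' fun _ => Set.Finite.pi' fun _ => Set.finite_Icc (0 : ℤ) K) |>.subset ?_
      rintro ⟨x, y⟩ ⟨h1, h2⟩
      exact ⟨h1, fun a b => h2 a (Set.mem_univ _) b (Set.mem_univ _)⟩
    · rintro _ ⟨B, ⟨h0, hK⟩, rfl⟩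
      refine ⟨abs_le.1 hK, fun a _ b _ => ⟨Int.emod_nonneg _ h0, ?_⟩⟩
      exact (Int.emod_lt_abs _ h0).le.trans hK
  have hchoose : ∀ y : F '' S, ∃ B0 ∈ S, F B0 = y.1 := fun y => y.2
  choose σ hσS hσF using hchoose
  have := hfin.to_subtype
  have hb : ∀ y : F '' S, ∃ c : ℝ, 0 ≤ c ∧ ∀ i j, |ic (adjugate (σ y)) i j| ≤ c := fun y => exists_bound _
  choose cc hcc0 hcc using hb
  cases nonempty_fintype (F '' S)
  refine ⟨∑ y, cc y, Finset.sum_nonneg fun y _ => hcc0 y, fun B h0 hK => ?_⟩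
  set y : F '' S := ⟨F B, B, ⟨h0, hK⟩, rfl⟩ with hy
  have hFe := hσF y
  simp only [hF, hy, Prod.mk.injEq] at hFe
  refine ⟨σ y, hFe.1, fun a b => ?_, fun a b => (hcc y a b).trans (Finset.single_le_sum (f := cc) (fun y _ => hcc0 y) (Finset.mem_univ y))⟩
  have h2 := congrFun (congrFun hFe.2 a) b
  rw [hFe.1] at h2
  exact Int.ModEq.dvd h2

lemma mahler (hd : 0 < d) {c : ℝ} (hc : 0 < c) : ∃ R : ℝ, ∀ g : G d,
    (∀ v : Fin d → ℤ, v ≠ 0 → ∃ s, c ≤ |(g.1.mulVec (vc v)) s|) →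
    ∃ γ ∈ Gamma d, ∀ a b, |(g * γ : G d).1 a b| ≤ R := by
  obtain ⟨R, hR0, hR⟩ := short_span hd hc
  obtain ⟨A, hA0, hA⟩ := reps (d := d) ⌈(d.factorial : ℝ) * R ^ d⌉₊
  refine ⟨d * (R * A), fun g hg => ?_⟩
  obtain ⟨B, hB0, hBR⟩ := hR g hg
  have hgB : (g.1 * ic B).det = (B.det : ℝ) := by
    rw [det_mul, ic_det, g.2, one_mul]
  have hdB : |B.det| ≤ ⌈(d.factorial : ℝ) * R ^ d⌉₊ := by
    have h1 := det_bound _ hR0.le hBR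
    rw [hgB] at h1
    have h2 := h1.trans (Nat.le_ceil _)
    exact_mod_cast h2
  obtain ⟨B0, hdet, hdvd, hadj⟩ := hA B hB0 hdB
  choose E hE using hdvd
  have hBE : B = B0 + B.det • (Matrix.of E) := by
    ext a b
    have := hE a b
    simp only [Matrix.add_apply, Matrix.smul_apply, of_apply, smul_eq_mul]
    linarith
  set γ0 : Matrix (Fin d) (Fin d) ℤ := 1 + Matrix.of E * adjugate B0 with hγ
  have hγB : γ0 * B0 = B := by
    rw [hγ, add_mul, one_mul, Matrix.mul_assoc, adjugate_mul, hdet, Matrix.mul_smul, Matrix.mul_one]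
    exact hBE.symm
  have hγdet : γ0.det = 1 := by
    have := congrArg det hγB
    rw [det_mul, hdet] at this
    exact mul_right_cancel₀ hB0 (by rw [this, one_mul])
  set γ : SpecialLinearGroup (Fin d) ℤ := ⟨γ0, hγdet⟩
  refine ⟨SpecialLinearGroup.map (Int.castRingHom ℝ) γ, ⟨γ, rfl⟩, fun a b => ?_⟩
  have hval : (g * SpecialLinearGroup.map (Int.castRingHom ℝ) γ : G d).1 = g.1 * ic γ0 := rfl
  have hBadj : B * adjugate B0 = B.det • γ0 := by
    rw [← hγB, Matrix.mul_assoc, mul_adjugate, Matrix.mul_smul, Matrix.mul_one, det_mul, hγdet, one_mul]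
  have key : (B.det : ℝ) * (g.1 * ic γ0) a b = ((g.1 * ic B) * ic (adjugate B0)) a b := by
    rw [Matrix.mul_assoc, ← ic_mul, hBadj]
    simp only [Matrix.mul_apply, Finset.mul_sum, ic, Matrix.map_apply, Matrix.smul_apply, smul_eq_mul]
    refine Finset.sum_congr rfl fun k _ => ?_
    push_cast; ring
  have hB1 : (1 : ℝ) ≤ |(B.det : ℝ)| := by
    have : 1 ≤ |B.det| := Int.one_le_abs hB0
    exact_mod_cast this
  rw [hval]
  calc |(g.1 * ic γ0) a b| ≤ |(B.det : ℝ)| * |(g.1 * ic γ0) a b| := le_mul_of_one_le_left (abs_nonneg _) hB1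
    _ = |((g.1 * ic B) * ic (adjugate B0)) a b| := by rw [← abs_mul, key]
    _ ≤ ∑ k : Fin d, R * A := by
      rw [Matrix.mul_apply]
      refine (Finset.abs_sum_le_sum_abs _ _).trans (Finset.sum_le_sum fun k _ => ?_)
      rw [abs_mul]
      exact mul_le_mul (hBR _ _) (hadj _ _) (abs_nonneg _) hR0.le
    _ = _ := by simp

lemma mahler_alpha (hd : 0 < d) (R0 : ℝ) : ∃ R : ℝ, ∀ g : G d, alpha 1 g ≤ R0 →
    ∃ γ ∈ Gamma d, ∀ a b, |(g * γ : G d).1 a b| ≤ R := by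
  set R1 := max R0 1 with hR1
  have hR1p : 0 < R1 := lt_of_lt_of_le one_pos (le_max_right _ _)
  obtain ⟨R, hR⟩ := mahler hd (inv_pos.2 hR1p)
  refine ⟨R, fun g hg => hR g fun v hv => ?_⟩
  by_contra hcon
  push Not at hcon
  set B : Matrix (Fin d) (Fin 1) ℤ := Matrix.of fun a _ => v a with hB
  have hdet1 : ∀ (M : Matrix (Fin d) (Fin 1) ℝ) (f : Fin 1 → Fin d), (M.submatrix f id).det = M (f 0) 0 := by
    intro M f; rw [det_unique]; rfl
  have hBv : vol (ic B) ≠ 0 := by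
    obtain ⟨a, ha⟩ := Function.ne_iff.1 hv
    have := le_vol (ic B) (fun _ => a)
    rw [hdet1] at this
    have h2 : (0 : ℝ) < |ic B a 0| := by
      rw [abs_pos]; simpa [ic, hB] using ha
    linarith
  have h1 := (le_alpha g B hBv (i := 1) (by simp)).trans hg
  have h2 : vol (g.1 * ic B) < R1⁻¹ := by
    have : Nonempty (Fin 1 → Fin d) := ⟨fun _ => ⟨0, hd⟩⟩
    obtain ⟨f, hf⟩ := exists_vol (g.1 * ic B) (vol_mul_ne_zero g _ hBv)
    rw [← hf, hdet1]
    exact hcon (f 0)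
  have h3 := vol_pos_of (vol_mul_ne_zero g _ hBv)
  have h4 : R1 < (vol (g.1 * ic B))⁻¹ := by
    rw [lt_inv_comm₀ hR1p h3]; exact h2
  have := le_max_left R0 1
  linarith

end Mahler2
end KK

namespace KK

theorem val_emb (d : ℕ) : IsClosedEmbedding (fun g : G d => (g.1 : Matrix (Fin d) (Fin d) ℝ)) :=
  Matrix.SpecialLinearGroup.isClosedEmbedding_val

instance topGrp (d : ℕ) : IsTopologicalGroup (G d) :=
  Matrix.SpecialLinearGroup.topologicalGroup

instance lcM (d : ℕ) : LocallyCompactSpace (Matrix (Fin d) (Fin d) ℝ) :=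
  inferInstanceAs (LocallyCompactSpace (Fin d → Fin d → ℝ))

instance scM (d : ℕ) : SecondCountableTopology (Matrix (Fin d) (Fin d) ℝ) :=
  inferInstanceAs (SecondCountableTopology (Fin d → Fin d → ℝ))

instance lcG (d : ℕ) : LocallyCompactSpace (G d) := (val_emb d).locallyCompactSpace

instance scG (d : ℕ) : SecondCountableTopology (G d) :=
  (val_emb d).isEmbedding.secondCountableTopology

theorem Gamma_mem_iff (d : ℕ) (g : G d) : g ∈ Gamma d ↔ ∀ i j, ∃ z : ℤ, (z : ℝ) = g.1 i j := by
  constructor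
  · rintro ⟨γ, rfl⟩ i j
    exact ⟨γ.1 i j, rfl⟩
  · intro h
    choose z hz using h
    have hdet : (Matrix.of z).det = 1 := by
      have h1 : (Int.castRingHom ℝ).mapMatrix (Matrix.of z) = g.1 := by
        ext i j
        simp [hz]
      have h2 := (Int.castRingHom ℝ).map_det (Matrix.of z)
      rw [h1, g.2] at h2
      simpa using h2
    refine ⟨⟨Matrix.of z, hdet⟩, ?_⟩
    ext i j
    exact hz i j

instance Gamma_closed (d : ℕ) : IsClosed (Gamma d : Set (G d)) := by
  have : (Gamma d : Set (G d)) = ⋂ i, ⋂ j, (fun g : G d => g.1 i j) ⁻¹' (Set.range ((↑) : ℤ → ℝ)) := by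
    ext g
    simp only [SetLike.mem_coe, Gamma_mem_iff, Set.mem_iInter, Set.mem_preimage, Set.mem_range]
  rw [this]
  refine isClosed_iInter fun i => isClosed_iInter fun j => ?_
  refine IsClosed.preimage ?_ Int.isClosedEmbedding_coe_real.isClosed_range
  exact ((val_emb d).continuous.matrix_elem i j)

instance t2X (d : ℕ) : T2Space (XSp d) := inferInstance
instance lcX (d : ℕ) : LocallyCompactSpace (XSp d) := inferInstance
instance scX (d : ℕ) : SecondCountableTopology (XSp d) := inferInstance
instance bX (d : ℕ) : BorelSpace (XSp d) := ⟨rfl⟩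
instance cX (d : ℕ) : ContinuousSMul (G d) (XSp d) := inferInstance

theorem aAct_cont (m n : ℕ) (hm : 0 < m) (hn : 0 < n) : Continuous (aAct m n hm hn) :=
  continuous_const_smul _

theorem aAct_iter (m n : ℕ) (hm : 0 < m) (hn : 0 < n) (j : ℕ) (x : XSp (m+n)) :
    (aAct m n hm hn)^[j] x = (aSL m n hm hn j) • x := by
  have h : ∀ j : ℕ, (aAct m n hm hn)^[j] x = (aSL m n hm hn 1 ^ j) • x := by
    intro j
    induction j with
    | zero => simp
    | succ j ih =>
      rw [Function.iterate_succ_apply', ih, pow_succ', mul_smul]; rfl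
  rw [h, aSL_pow]; simp


/-- the height on the quotient -/
def HX (m n : ℕ) (ε η : ℝ) : XSp (m+n) → ℝ :=
  fun x => Hh m n ε η (Quotient.out x)

theorem HX_mk (m n : ℕ) (ε η : ℝ) (g : G (m+n)) : HX m n ε η (QuotientGroup.mk g) = Hh m n ε η g := by
  unfold HX
  obtain ⟨γ, hγ⟩ := QuotientGroup.mk_out_eq_mul (Gamma (m+n)) g
  have : (Quotient.out (QuotientGroup.mk g : XSp (m+n)) : G (m+n)) = g * γ := hγ
  rw [this, Hh_gamma _ _ γ.2]

theorem HX_open {m n : ℕ} (hm : 0 < m) (hn : 0 < n) {ε η : ℝ} (hη : 0 < η) (hε1 : ε < 1) (M : ℝ) (hM : 0 ≤ M) :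
    IsOpen {x | M < HX m n ε η x} := by
  rw [← (QuotientGroup.isQuotientMap_mk (Gamma (m+n))).isOpen_preimage]
  have : (QuotientGroup.mk : G (m+n) → XSp (m+n)) ⁻¹' {x | M < HX m n ε η x} = {g | M < Hh m n ε η g} := by
    ext g
    simp only [Set.mem_preimage, Set.mem_ofPred_eq, HX_mk]
  rw [this]
  exact Hh_open hm hn hη hε1 M hM

theorem bdd_compact (d : ℕ) (R : ℝ) : IsCompact {g : G d | ∀ a b, |g.1 a b| ≤ R} := by
  have h1 : IsCompact {M : Matrix (Fin d) (Fin d) ℝ | ∀ a b, |M a b| ≤ R} := by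
    have : {M : Matrix (Fin d) (Fin d) ℝ | ∀ a b, |M a b| ≤ R} = Set.pi Set.univ (fun a => Set.pi Set.univ (fun b => Set.Icc (-R) R)) := by
      ext M
      simp only [abs_le, Set.mem_ofPred_eq]
      exact ⟨fun h a _ b _ => h a b, fun h a b => h a trivial b trivial⟩
    rw [this]
    exact isCompact_univ_pi fun a => isCompact_univ_pi fun b => isCompact_Icc
  exact (val_emb d).isCompact_preimage h1

theorem HX_compact {m n : ℕ} (hm : 0 < m) (hn : 0 < n) {ε η : ℝ} (hη : 0 < η) (hε1 : ε < 1) (M : ℝ) (hM : 0 ≤ M) :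
    IsCompact {x | HX m n ε η x ≤ M} := by
  obtain ⟨R0, hR0⟩ := Hh_alpha1 hm hn hη hε1 M
  obtain ⟨R, hR⟩ := mahler_alpha (d := m+n) (by omega) R0
  have hcl : IsClosed {x | HX m n ε η x ≤ M} := by
    have := (HX_open hm hn hη hε1 M hM).isClosed_compl
    convert this using 1
    ext x; simp
  refine ((bdd_compact (m+n) R).image (QuotientGroup.continuous_mk (N := Gamma (m+n)))).of_isClosed_subset hcl ?_
  intro x hx
  obtain ⟨g, rfl⟩ := QuotientGroup.mk_surjective x
  rw [Set.mem_ofPred_eq, HX_mk] at hx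
  obtain ⟨γ, hγ, hb⟩ := hR g (hR0 g hx)
  exact ⟨g * γ, hb, by
    rw [QuotientGroup.eq]; simpa using hγ⟩

end KK

namespace KK

/-- entrywise close to identity -/
def Near {d : ℕ} (ρ : ℝ) (g : G d) : Prop := ∀ a b, |g.1 a b - (1 : Matrix (Fin d) (Fin d) ℝ) a b| ≤ ρ

theorem one_fs {m n : ℕ} (x y : Fin m ⊕ Fin n) :
    (1 : Matrix (Fin (m+n)) (Fin (m+n)) ℝ) (finSumFinEquiv x) (finSumFinEquiv y) = (1 : Matrix (Fin m ⊕ Fin n) (Fin m ⊕ Fin n) ℝ) x y := by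
  have h : (finSumFinEquiv x = finSumFinEquiv y) ↔ x = y := finSumFinEquiv.injective.eq_iff
  by_cases hxy : x = y
  · subst hxy; simp only [Matrix.one_apply_eq]
  · rw [Matrix.one_apply_ne hxy, Matrix.one_apply_ne (fun e => hxy (h.1 e))]

theorem near_nhds (d : ℕ) {ρ : ℝ} (hρ : 0 < ρ) : {g : G d | Near ρ g} ∈ 𝓝 (1 : G d) := by
  have : {g : G d | Near ρ g} = ⋂ a, ⋂ b, {g : G d | |g.1 a b - (1 : Matrix (Fin d) (Fin d) ℝ) a b| ≤ ρ} := by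
    ext g; simp [Near]
  rw [this]
  refine Filter.iInter_mem.2 fun a => Filter.iInter_mem.2 fun b => ?_
  have hc : Continuous fun g : G d => |g.1 a b - (1 : Matrix (Fin d) (Fin d) ℝ) a b| :=
    (((val_emb d).continuous.matrix_elem a b).sub continuous_const).abs
  have h1 := hc.tendsto (1 : G d)
  have h0 : |(1 : G d).1 a b - (1 : Matrix (Fin d) (Fin d) ℝ) a b| = 0 := by simp
  rw [h0] at h1
  filter_upwards [h1.eventually_lt_const hρ] with g hg
  exact le_of_lt hg

theorem near_basis (d : ℕ) {V : Set (G d)} (hV : V ∈ 𝓝 (1 : G d)) : ∃ ρ > 0, ∀ g : G d, Near ρ g → g ∈ V := by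
  rw [(val_emb d).isEmbedding.isInducing.nhds_eq_comap, Filter.mem_comap] at hV
  obtain ⟨U, hU, hUV⟩ := hV
  have hU' : ∃ ε > 0, @Metric.ball (Fin d → Fin d → ℝ) _ ((1 : G d).1 : Fin d → Fin d → ℝ) ε ⊆ U :=
    (Metric.mem_nhds_iff (α := Fin d → Fin d → ℝ)).1 hU
  obtain ⟨ρ, hρ, hb⟩ := hU'
  refine ⟨ρ / 2, by positivity, fun g hg => hUV (hb ?_)⟩
  change dist (α := Fin d → Fin d → ℝ) (g.1 : Fin d → Fin d → ℝ) (((1 : G d).1) : Fin d → Fin d → ℝ) < ρ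
  refine lt_of_le_of_lt ?_ (half_lt_self hρ)
  refine (dist_pi_le_iff (by positivity)).2 fun a => (dist_pi_le_iff (by positivity)).2 fun b => ?_
  rw [Real.dist_eq]
  exact hg a b

theorem near_smul (d : ℕ) {V : Set (G d)} (hV : V ∈ 𝓝 (1 : G d)) :
    ∃ ρ > 0, ∀ g₁ g₂ g₃ : G d, Near ρ g₁ → Near ρ g₂ → Near ρ g₃ → g₁ * g₂ * g₃⁻¹ ∈ V := by
  have hc : Continuous fun q : G d × G d × G d => q.1 * q.2.1 * q.2.2⁻¹ := by fun_prop
  have h1 := hc.tendsto ((1, 1, 1) : G d × G d × G d)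
  simp only [mul_one, inv_one] at h1
  have h2 := h1 hV
  rw [Filter.mem_map, nhds_prod_eq, nhds_prod_eq] at h2
  obtain ⟨A, hA, B, hB, hAB⟩ := Filter.mem_prod_iff.1 h2
  obtain ⟨B1, hB1, B2, hB2, hBB⟩ := Filter.mem_prod_iff.1 hB
  obtain ⟨ρ1, h1, k1⟩ := near_basis d hA
  obtain ⟨ρ2, h2, k2⟩ := near_basis d hB1
  obtain ⟨ρ3, h3, k3⟩ := near_basis d hB2
  refine ⟨min ρ1 (min ρ2 ρ3), by positivity, fun g₁ g₂ g₃ n1 n2 n3 => ?_⟩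
  have : ((g₁, g₂, g₃) : G d × G d × G d) ∈ A ×ˢ B := by
    refine ⟨k1 _ fun a b => (n1 a b).trans (min_le_left _ _), hBB ⟨k2 _ fun a b => (n2 a b).trans ?_, k3 _ fun a b => (n3 a b).trans ?_⟩⟩
    · exact (min_le_right _ _).trans (min_le_left _ _)
    · exact (min_le_right _ _).trans (min_le_right _ _)
  exact hAB this

theorem near_inv (d : ℕ) : ∃ ρ > 0, ∀ g : G d, Near ρ g → ∀ a b, |g⁻¹.1 a b| ≤ 2 := by
  have hV : {g : G d | Near 1 g} ∈ 𝓝 (1 : G d) := near_nhds d one_pos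
  obtain ⟨ρ, hρ, h⟩ := near_smul d hV
  refine ⟨ρ, hρ, fun g hg a b => ?_⟩
  have n1 : Near ρ (1 : G d) := fun a b => by simp [hρ.le]
  have := h 1 1 g n1 n1 hg
  rw [one_mul, one_mul] at this
  have h2 := this a b
  have h3 : |(1 : Matrix (Fin d) (Fin d) ℝ) a b| ≤ 1 := by
    rw [Matrix.one_apply]; split_ifs <;> simp
  rw [abs_le] at *
  constructor <;> linarith [h2.1, h2.2, h3.1, h3.2]

/-- the stable-neutral piece -/
def InP (m n : ℕ) (ρ : ℝ) (p : G (m+n)) : Prop :=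
  Near ρ p ∧ ∀ (i : Fin m) (j : Fin n), p.1 (finSumFinEquiv (Sum.inl i)) (finSumFinEquiv (Sum.inr j)) = 0

theorem uS_near {m n : ℕ} {ρ : ℝ} (hρ : 0 ≤ ρ) (B : Fin m × Fin n → ℝ) (hB : ∀ e, |B e| ≤ ρ) : Near ρ (uS m n B) := by
  intro a b
  obtain ⟨a, rfl⟩ := finSumFinEquiv.surjective a
  obtain ⟨b, rfl⟩ := finSumFinEquiv.surjective b
  rw [uS_val, Matrix.submatrix_apply, Equiv.symm_apply_apply, Equiv.symm_apply_apply]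
  rw [one_fs]
  rcases a with a | a <;> rcases b with b | b <;> simp [UA, Matrix.one_apply, hρ, hB]

theorem conj_InP {m n : ℕ} (hm : 0 < m) (hn : 0 < n) {ρ t : ℝ} (ht : 0 ≤ t) {p : G (m+n)} (hp : InP m n ρ p) :
    InP m n ρ (aSL m n hm hn t * p * aSL m n hm hn (-t)) := by
  have hval : ∀ x y, (aSL m n hm hn t * p * aSL m n hm hn (-t)).1 (finSumFinEquiv x) (finSumFinEquiv y) =
      aD m n t x * p.1 (finSumFinEquiv x) (finSumFinEquiv y) * aD m n (-t) y := by
    intro x y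
    have hps : p.1 = (p.1.submatrix finSumFinEquiv finSumFinEquiv).submatrix finSumFinEquiv.symm finSumFinEquiv.symm := by
      ext a b; simp
    change ((aSL m n hm hn t).1 * p.1 * (aSL m n hm hn (-t)).1) _ _ = _
    rw [hps, aSL_val, aSL_val, submatrix_mul_equiv, submatrix_mul_equiv, submatrix_apply, mul_diagonal, diagonal_mul]
    simp
  have hmp : (0:ℝ) < m := by exact_mod_cast hm
  have hnp : (0:ℝ) < n := by exact_mod_cast hn
  constructor
  · intro a b
    obtain ⟨a, rfl⟩ := finSumFinEquiv.surjective a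
    obtain ⟨b, rfl⟩ := finSumFinEquiv.surjective b
    have h0 := hp.1 (finSumFinEquiv a) (finSumFinEquiv b)
    rw [hval]
    rcases a with a | a <;> rcases b with b | b
    · have : aD m n t (Sum.inl a) * p.1 (finSumFinEquiv (Sum.inl a)) (finSumFinEquiv (Sum.inl b)) * aD m n (-t) (Sum.inl b)
        = p.1 (finSumFinEquiv (Sum.inl a)) (finSumFinEquiv (Sum.inl b)) := by
        simp only [aD, Sum.elim_inl]
        rw [mul_right_comm, ← Real.exp_add, neg_div, add_neg_cancel, Real.exp_zero, one_mul]
      rw [this]; exact h0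
    · rw [hp.2] at h0 ⊢
      simpa using h0
    · have h1 : (1 : Matrix (Fin (m+n)) (Fin (m+n)) ℝ) (finSumFinEquiv (Sum.inr a)) (finSumFinEquiv (Sum.inl b)) = 0 := by
        rw [one_fs]; simp
      rw [h1, sub_zero] at h0 ⊢
      simp only [aD, Sum.elim_inl, Sum.elim_inr]
      rw [mul_right_comm, ← Real.exp_add, abs_mul, abs_of_pos (Real.exp_pos _)]
      refine le_trans (mul_le_of_le_one_left (abs_nonneg _) ?_) h0
      rw [Real.exp_le_one_iff, neg_div]
      have h2 : 0 ≤ t / m := by positivity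
      have h3 : 0 ≤ t / n := by positivity
      linarith
    · have : aD m n t (Sum.inr a) * p.1 (finSumFinEquiv (Sum.inr a)) (finSumFinEquiv (Sum.inr b)) * aD m n (-t) (Sum.inr b)
        = p.1 (finSumFinEquiv (Sum.inr a)) (finSumFinEquiv (Sum.inr b)) := by
        simp only [aD, Sum.elim_inr]
        rw [mul_right_comm, ← Real.exp_add, neg_div, neg_neg, neg_add_cancel, Real.exp_zero, one_mul]
      rw [this]; exact h0
  · intro i j
    rw [hval, hp.2]; simp

theorem conj_InP' {m n : ℕ} (hm : 0 < m) (hn : 0 < n) {ρ t : ℝ} (ht : 0 ≤ t) {p : G (m+n)} (hp : InP m n ρ p) :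
    ∃ q, InP m n ρ q ∧ aSL m n hm hn t * p = q * aSL m n hm hn t := by
  refine ⟨_, conj_InP hm hn ht hp, ?_⟩
  rw [mul_assoc (_ * _), ← aSL_add, neg_add_cancel, aSL_zero, mul_one]

theorem chart {m n : ℕ} {ρ r : ℝ} (hρ : 0 < ρ) (hr : 0 < r) :
    {g : G (m+n) | ∃ p A, InP m n ρ p ∧ (∀ e, |A e| ≤ r) ∧ g = p * uS m n A} ∈ 𝓝 (1 : G (m+n)) := by
  obtain ⟨ρ', hρ', hsm⟩ := near_smul (m+n) (near_nhds (m+n) hρ)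
  let X : G (m+n) → Matrix (Fin m) (Fin m) ℝ := fun g => g.1.submatrix (fun i => finSumFinEquiv (Sum.inl i)) (fun i => finSumFinEquiv (Sum.inl i))
  let Y : G (m+n) → Matrix (Fin m) (Fin n) ℝ := fun g => g.1.submatrix (fun i => finSumFinEquiv (Sum.inl i)) (fun i => finSumFinEquiv (Sum.inr i))
  have hX : Continuous X := (val_emb (m+n)).continuous.matrix_submatrix _ _
  have hY : Continuous Y := (val_emb (m+n)).continuous.matrix_submatrix _ _
  have hX1 : X 1 = 1 := by
    ext i j; simp [X, Matrix.one_apply]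
  have hY1 : Y 1 = 0 := by
    ext i j
    change (1 : Matrix (Fin (m+n)) (Fin (m+n)) ℝ) (finSumFinEquiv (Sum.inl i)) (finSumFinEquiv (Sum.inr j)) = 0
    rw [one_fs]; simp
  have hdet : Continuous fun g => (X g).det := hX.matrix_det
  let A : G (m+n) → Fin m × Fin n → ℝ := fun g e => (X g).det⁻¹ * ((X g).adjugate * Y g) e.1 e.2
  have hA : ∀ e, ∀ᶠ g in 𝓝 (1 : G (m+n)), |A g e| < min r ρ' := by
    intro e
    have h1 : Tendsto (fun g => |A g e|) (𝓝 1) (𝓝 |A 1 e|) := by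
      refine Tendsto.abs ?_
      refine Tendsto.mul ?_ ?_
      · refine Tendsto.inv₀ (hdet.tendsto 1) ?_
        rw [hX1]; simp
      · exact ((hX.matrix_adjugate.matrix_mul hY).matrix_elem e.1 e.2).tendsto 1
    have h0 : |A 1 e| = 0 := by
      simp only [A, hY1]; simp
    rw [h0] at h1
    exact h1.eventually_lt_const (lt_min hr hρ')
  have hd : ∀ᶠ g in 𝓝 (1 : G (m+n)), (X g).det ≠ 0 := by
    refine (hdet.tendsto 1).eventually_ne ?_
    rw [hX1]; simp
  filter_upwards [near_nhds (m+n) hρ', Filter.eventually_all.2 hA, hd] with g hg hAg hdg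
  have hn1 : Near ρ' (1 : G (m+n)) := fun a b => by simp [hρ'.le]
  have huA : Near ρ' (uS m n (A g)) := uS_near hρ'.le _ fun e => (hAg e).le.trans (min_le_right _ _)
  refine ⟨g * (uS m n (A g))⁻¹, A g, ⟨?_, ?_⟩, fun e => (hAg e).le.trans (min_le_left _ _), by group⟩
  · have := hsm g 1 _ hg hn1 huA
    rwa [mul_one] at this
  · intro i j
    rw [← uS_neg]
    change (g.1 * (uS m n (-(A g))).1) _ _ = 0
    have hgs : g.1 = (g.1.submatrix finSumFinEquiv finSumFinEquiv).submatrix finSumFinEquiv.symm finSumFinEquiv.symm := by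
      ext a b; simp
    rw [hgs, uS_val, submatrix_mul_equiv, submatrix_apply, Equiv.symm_apply_apply, Equiv.symm_apply_apply, Matrix.mul_apply, Fintype.sum_sum_type]
    have h1 : ∀ a, (UA (-(A g))) (Sum.inl a) (Sum.inr j) = - A g (a, j) := fun a => by simp [UA]
    have h2 : ∀ b, (UA (-(A g))) (Sum.inr b) (Sum.inr j) = (1 : Matrix (Fin n) (Fin n) ℝ) b j := fun a => by simp [UA]
    simp only [h1, h2]
    have h3 : X g * ((X g).det⁻¹ • ((X g).adjugate * Y g)) = Y g := by
      rw [Matrix.mul_smul, ← Matrix.mul_assoc, Matrix.mul_adjugate, Matrix.smul_mul, smul_smul, inv_mul_cancel₀ hdg]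
      simp
    have h4 := congrFun (congrFun h3 i) j
    rw [Matrix.mul_apply] at h4
    have h5 : ∑ x, g.1 (finSumFinEquiv (Sum.inl i)) (finSumFinEquiv (Sum.inr x)) * (1 : Matrix (Fin n) (Fin n) ℝ) x j = Y g i j := by
      simp [Matrix.one_apply, Y]
    simp only [submatrix_apply, mul_neg, Finset.sum_neg_distrib]
    rw [h5, ← h4, neg_add_eq_zero]
    rfl

end KK

namespace KK

theorem sep_nhd {d k : ℕ} (Q : Fin k → Set (XSp d)) (hQ : ∀ c, IsCompact (Q c))
    (hdis : ∀ c c', c ≠ c' → Disjoint (Q c) (Q c')) :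
    ∃ O ∈ 𝓝 (1 : G d), ∀ g ∈ O, ∀ c c', ∀ x ∈ Q c, g • x ∈ Q c' → c = c' := by
  have h : ∀ c c', ∃ O ∈ 𝓝 (1 : G d), ∀ g ∈ O, ∀ x ∈ Q c, g • x ∈ Q c' → c = c' := by
    intro c c'
    by_cases hc : c = c'
    · exact ⟨Set.univ, univ_mem, fun _ _ _ _ _ => hc⟩
    have hcont : Continuous fun q : G d × XSp d => q.1 • q.2 := continuous_smul
    have hop : IsOpen ((fun q : G d × XSp d => q.1 • q.2) ⁻¹' (Q c')ᶜ) :=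
      (hQ c').isClosed.isOpen_compl.preimage hcont
    obtain ⟨u, v, hu, hv, h1, h2, h3⟩ := generalized_tube_lemma (isCompact_singleton (x := (1 : G d))) (hQ c) hop (by
      rintro ⟨g, x⟩ ⟨hg, hx⟩
      rw [Set.mem_singleton_iff] at hg
      simp only at hg hx
      subst hg
      simp only [Set.mem_preimage, one_smul, Set.mem_compl_iff]
      exact fun hx' => (Set.disjoint_left.1 (hdis c c' hc)) hx hx')
    refine ⟨u, hu.mem_nhds (h1 rfl), fun g hg x hx hgx => ?_⟩
    exact absurd hgx (h3 (Set.mk_mem_prod hg (h2 hx)))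
  choose O hO hO' using h
  refine ⟨⋂ c, ⋂ c', O c c', Filter.iInter_mem.2 fun c => Filter.iInter_mem.2 fun c' => hO c c', ?_⟩
  intro g hg c c'
  exact hO' c c' g (Set.mem_iInter.1 (Set.mem_iInter.1 hg c) c')

theorem smul_nhd {d : ℕ} {D : Set (G d)} (hD : D ∈ 𝓝 (1 : G d)) (x : XSp d) :
    (fun g : G d => g • x) '' D ∈ 𝓝 x := by
  obtain ⟨g0, rfl⟩ := QuotientGroup.mk_surjective x
  have hop : IsOpenMap (fun g : G d => g • (QuotientGroup.mk g0 : XSp d)) := by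
    have : (fun g : G d => g • (QuotientGroup.mk g0 : XSp d)) = (QuotientGroup.mk : G d → XSp d) ∘ (fun g => g * g0) := rfl
    rw [this]
    exact QuotientGroup.isOpenMap_coe.comp (isOpenMap_mul_right g0)
  have := hop.image_mem_nhds hD
  simpa using this

theorem exists_n0 {b c q : ℝ} (hb : 0 < b) (hc : 0 < c) (hq : 0 < q) : ∃ n0 : ℕ, c * Real.exp (-(b * n0)) ≤ q := by
  obtain ⟨n0, hn⟩ := exists_nat_ge (Real.log (c / q) / b)
  refine ⟨n0, ?_⟩
  rw [div_le_iff₀ hb] at hn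
  have h1 : c / q ≤ Real.exp (b * n0) := by
    rw [← Real.log_le_iff_le_exp (by positivity)]; linarith
  rw [Real.exp_neg, ← div_eq_mul_inv, div_le_iff₀ (Real.exp_pos _)]
  rwa [div_le_iff₀' hq] at h1

theorem transfer {m n : ℕ} (hm : 0 < m) (hn : 0 < n) {ρ i : ℝ} (hi : 0 ≤ i) {p p' : G (m+n)}
    (hp : InP m n ρ p) (hp' : InP m n ρ p') (A A' : Fin m × Fin n → ℝ) :
    ∃ q q', InP m n ρ q ∧ InP m n ρ q' ∧ aSL m n hm hn i * (p * uS m n A) =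
      (q * uS m n (Real.exp (lam m n * i) • (A - A')) * q'⁻¹) * (aSL m n hm hn i * (p' * uS m n A')) := by
  obtain ⟨q, hq, e⟩ := conj_InP' hm hn hi hp
  obtain ⟨q', hq', e'⟩ := conj_InP' hm hn hi hp'
  refine ⟨q, q', hq, hq', ?_⟩
  rw [← mul_assoc, ← mul_assoc (aSL m n hm hn i), e, e']
  have : uS m n A = uS m n (A - A') * uS m n A' := by rw [← uS_add, sub_add_cancel]
  rw [this]
  have h2 := aSL_uS hm hn i (A - A')
  calc q * aSL m n hm hn i * (uS m n (A - A') * uS m n A') = q * (aSL m n hm hn i * uS m n (A - A')) * uS m n A' := by group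
    _ = _ := by rw [h2]; group

open Classical in
theorem cover_core {m n : ℕ} (hm : 0 < m) (hn : 0 < n) {ε η : ℝ} (hε1 : ε < 1) (hη : 0 < η) {r C : ℝ} (hr : 0 < r) (hr1 : r ≤ 1)
    (hC : 0 ≤ C) {t : ℕ} (ht : 0 < t) {L : ℕ} (hL : Real.exp (lam m n * t) ≤ L)
    (hstep : ∀ g : G (m + n), ∑ k : Fin m × Fin n → Fin L,
        Hh m n ε η (aSL m n hm hn t * uS m n (ctr r k) * g) ≤
        (L : ℝ) ^ (m * n) * (1 + C * Real.exp (-((1 - ε) * t)) * Hh m n ε η g))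
    {M : ℝ} (hM : M = (((m + n : ℕ) : ℝ) * 2) ^ (bexp m n ε) * (((m + n : ℕ) : ℝ) ^ (bexp m n ε) * Real.exp ((1 - ε) * t)))
    {k : ℕ} (hk : 0 < k) (Q : Fin k → Set (XSp (m+n))) (hQ : ∀ c, IsCompact (Q c))
    (hdis : ∀ c c', c ≠ c' → Disjoint (Q c) (Q c')) :
    ∃ Z0 : ℝ, 0 < Z0 ∧ ∀ N : ℕ, ∃ (W : Type) (_ : Fintype W) (cnt : W → ℕ) (iota : W → ℕ → Fin k),
      ∑ w, Real.exp ((1 - ε) * t * cnt w) ≤ Z0 * ((L : ℝ) ^ (m * n) * (2 + C)) ^ N ∧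
      ∀ x ∈ ⋃ c, Q c, ∃ w, (∀ i < t * N, ∀ c, (aAct m n hm hn)^[i] x ∈ Q c → iota w i = c) ∧
        ∑ l ∈ Finset.range N, (if M < HX m n ε η ((aAct m n hm hn)^[t * (l + 1)] x) then 1 else 0) ≤ cnt w := by
  have hd1 : (1 : ℝ) ≤ ((m + n : ℕ) : ℝ) := by exact_mod_cast (by omega : 1 ≤ m + n)
  have htp : (0:ℝ) < t := by exact_mod_cast ht
  have hlam : 0 < lam m n := by
    have hmp : (0:ℝ) < m := by exact_mod_cast hm
    have hnp : (0:ℝ) < n := by exact_mod_cast hn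
    unfold lam; positivity
  set s : ℝ := (1 - ε) * t with hs
  have hs0 : 0 ≤ s := mul_nonneg (by linarith) htp.le
  set Cp : ℝ := ((m + n : ℕ) : ℝ) ^ (bexp m n ε) with hCp
  have hCp0 : 0 < Cp := Real.rpow_pos_of_pos (by linarith) _
  set Kp : ℝ := (((m + n : ℕ) : ℝ) * 2) ^ (bexp m n ε) with hKp
  have hKp0 : 0 < Kp := Real.rpow_pos_of_pos (by linarith) _
  have hpert : ∀ B : Fin m × Fin n → ℝ, (∀ e, |B e| ≤ 1) → ∀ g, Hh m n ε η (uS m n B * g) ≤ Cp * Hh m n ε η g := by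
    intro B hB g
    have := Hh_pert hm hn hη hε1 (B := -B) (fun e => by simpa using hB e) (uS m n B * g)
    rwa [uS_neg, inv_mul_cancel_left] at this
  have htree := tree hm hn hr hr1 hL hC hs0 le_rfl (Hh m n ε η) (fun g => one_le_Hh g) hstep hCp0 hpert
  obtain ⟨O, hO, hsep⟩ := sep_nhd Q hQ hdis
  obtain ⟨ρ1, hρ1, hsm⟩ := near_smul (m+n) hO
  obtain ⟨ρ2, hρ2, hinv⟩ := near_inv (m+n)
  set ρ := min ρ1 ρ2 with hρdef
  have hρ : 0 < ρ := lt_min hρ1 hρ2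
  obtain ⟨n0, hn0⟩ := exists_n0 (b := lam m n * t) (c := 2 * r) (q := ρ1) (by positivity) (by positivity) hρ1
  have hK0 : IsCompact (⋃ c, Q c) := isCompact_iUnion hQ
  obtain ⟨T, hT, hcov⟩ := hK0.elim_nhds_subcover (fun x => (fun g : G (m+n) => g • x) '' {g : G (m+n) | ∃ p A, InP m n ρ p ∧ (∀ e, |A e| ≤ r) ∧ g = p * uS m n A})
    (fun x _ => smul_nhd (chart hρ hr) x)
  set Λ : ℝ := (L : ℝ) ^ (m * n) * (2 + C) with hΛ
  have hΛ0 : 0 ≤ Λ := by positivity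
  refine ⟨(∑ x : T, Λ ^ n0 * max 1 (Hh m n ε η (Quotient.out x.1) / Real.exp s)) + 1, ?_, ?_⟩
  · have : 0 ≤ ∑ x : T, Λ ^ n0 * max 1 (Hh m n ε η (Quotient.out x.1) / Real.exp s) :=
      Finset.sum_nonneg fun x _ => mul_nonneg (pow_nonneg hΛ0 _) (le_trans zero_le_one (le_max_left _ _))
    linarith
  intro N
  have htr := fun x : T => htree (N + n0) (Quotient.out x.1)
  choose W iW cnt z hsum hcv using htr
  let InCl : (Σ x : T, W x) → XSp (m+n) → Prop := fun w y => ∃ p A, InP m n ρ p ∧ (∀ e, |A e| ≤ r) ∧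
    (∀ e, |A e - z w.1 w.2 e| ≤ r * Real.exp (-(lam m n * t * ((N + n0 : ℕ) : ℝ)))) ∧ y = (p * uS m n A) • w.1.1
  refine ⟨Σ x : T, W x, inferInstance, fun w => cnt w.1 w.2, fun w i =>
    if h : ∃ c, ∃ y, InCl w y ∧ (aAct m n hm hn)^[i] y ∈ Q c then h.choose else ⟨0, hk⟩, ?_, ?_⟩
  · rw [Fintype.sum_sigma, add_mul, Finset.sum_mul]
    have h1 : ∑ x : T, ∑ y : W x, Real.exp (s * (cnt x y)) ≤ ∑ x : T, Λ ^ n0 * max 1 (Hh m n ε η (Quotient.out x.1) / Real.exp s) * Λ ^ N := by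
      refine Finset.sum_le_sum fun x _ => (hsum x).trans (le_of_eq ?_)
      rw [pow_add]; ring
    have h2 : 0 ≤ 1 * Λ ^ N := by positivity
    linarith
  · intro y hy
    have h1 := hcov hy
    rw [Set.mem_iUnion₂] at h1
    obtain ⟨x, hxT, g, ⟨p, A, hp, hA, rfl⟩, hgy⟩ := h1
    simp only at hgy
    obtain ⟨w, hw, hcnt⟩ := hcv ⟨x, hxT⟩ A hA
    have hcl : InCl ⟨⟨x, hxT⟩, w⟩ y := ⟨p, A, hp, hA, hw, hgy.symm⟩
    refine ⟨⟨⟨x, hxT⟩, w⟩, ?_, ?_⟩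
    · intro i hi c hc
      have hex : ∃ c, ∃ y, InCl ⟨⟨x, hxT⟩, w⟩ y ∧ (aAct m n hm hn)^[i] y ∈ Q c := ⟨c, y, hcl, hc⟩
      refine (dif_pos hex).trans ?_
      obtain ⟨y', ⟨p', A', hp', hA', hw', hgy'⟩, hc'⟩ := hex.choose_spec
      set c' := hex.choose
      obtain ⟨q, q', hq, hq', e⟩ := transfer hm hn (i := i) (Nat.cast_nonneg i) hp hp' A A'
      refine hsep (q * uS m n (Real.exp (lam m n * i) • (A - A')) * q'⁻¹) ?_ _ _ _ hc' ?_
      · refine hsm _ _ _ (fun a b => (hq.1 a b).trans (min_le_left _ _)) (uS_near hρ1.le _ fun e => ?_) (fun a b => (hq'.1 a b).trans (min_le_left _ _))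
        have h3 : |A e - A' e| ≤ 2 * (r * Real.exp (-(lam m n * t * ((N + n0 : ℕ) : ℝ)))) := by
          have h4 := hw e
          have h5 := hw' e
          rw [abs_le] at *
          constructor <;> linarith [h4.1, h4.2, h5.1, h5.2]
        rw [Pi.smul_apply, smul_eq_mul, abs_mul, abs_of_pos (Real.exp_pos _), Pi.sub_apply]
        calc Real.exp (lam m n * i) * |A e - A' e| ≤ Real.exp (lam m n * (t * N)) * (2 * (r * Real.exp (-(lam m n * t * ((N + n0 : ℕ) : ℝ))))) := by
              gcongr
              exact_mod_cast hi.le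
          _ = 2 * r * Real.exp (-(lam m n * t * n0)) := by
              have : Real.exp (-(lam m n * t * n0)) = Real.exp (lam m n * (t * N)) * Real.exp (-(lam m n * t * ((N + n0 : ℕ) : ℝ))) := by
                rw [← Real.exp_add]; congr 1; push_cast; ring
              rw [this]; ring
          _ ≤ ρ1 := hn0
      · have : (q * uS m n (Real.exp (lam m n * i) • (A - A')) * q'⁻¹) • (aAct m n hm hn)^[i] y' = (aAct m n hm hn)^[i] y := by
          rw [aAct_iter, aAct_iter, hgy', ← hgy, ← mul_smul, ← mul_smul, ← mul_smul, e, mul_assoc]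
        rw [this]; exact hc
    · refine le_trans ?_ hcnt
      refine le_trans ?_ (Finset.sum_le_sum_of_subset (Finset.range_mono (Nat.le_add_right N n0)))
      refine Finset.sum_le_sum fun l _ => ?_
      by_cases hl : M < HX m n ε η ((aAct m n hm hn)^[t * (l + 1)] y)
      · rw [if_pos hl, if_pos]
        obtain ⟨q, hq, e⟩ := conj_InP' hm hn (t := ((t * (l+1) : ℕ) : ℝ)) (Nat.cast_nonneg _) hp
        rw [aAct_iter, ← hgy, ← mul_smul] at hl
        have hx : x = QuotientGroup.mk (Quotient.out x) := (QuotientGroup.out_eq' x).symm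
        have hx2 : (aSL m n hm hn ((t * (l+1) : ℕ) : ℝ) * (p * uS m n A)) • x = QuotientGroup.mk (q * (aSL m n hm hn t ^ (l+1) * uS m n A * Quotient.out x)) := by
          conv_lhs => rw [hx]
          rw [← mul_assoc, e, aSL_pow]
          have : ((t * (l+1) : ℕ) : ℝ) = ((l+1 : ℕ):ℝ) * t := by push_cast; ring
          rw [this]
          change (QuotientGroup.mk (_ * _) : XSp (m+n)) = _
          congr 1
          group
        rw [hx2, HX_mk] at hl
        have h6 := Hh_mul_le hm hn hη hε1 one_le_two q (aSL m n hm hn t ^ (l+1) * uS m n A * Quotient.out x) (η := η) (hinv q (fun a b => (hq.1 a b).trans (min_le_right _ _)))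
        have h7 := lt_of_lt_of_le hl h6
        rw [hM] at h7
        exact lt_of_mul_lt_mul_left h7 hKp0.le
      · rw [if_neg hl]; exact Nat.zero_le _

theorem cover {m n : ℕ} (hm : 0 < m) (hn : 0 < n) {ε : ℝ} (hε : 0 < ε) (hε1 : ε < 1) :
    ∃ C' : ℝ, ∀ t : ℕ, 0 < t → ∃ η M : ℝ, 0 < η ∧ 0 ≤ M ∧ ∀ (k : ℕ) (hk : 0 < k) (Q : Fin k → Set (XSp (m+n))) (hQ : ∀ c, IsCompact (Q c))
    (hdis : ∀ c c', c ≠ c' → Disjoint (Q c) (Q c')),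
    ∃ Z0 : ℝ, 0 < Z0 ∧ ∀ N : ℕ, ∃ (W : Type) (_ : Fintype W) (cnt : W → ℕ) (iota : W → ℕ → Fin k),
      ∑ w, Real.exp ((1 - ε) * t * cnt w) ≤ Z0 * Real.exp (((m:ℝ)+n) * t + C') ^ N ∧
      ∀ x ∈ ⋃ c, Q c, ∃ w, (∀ i < t * N, ∀ c, (aAct m n hm hn)^[i] x ∈ Q c → iota w i = c) ∧
        ∑ l ∈ Finset.range N, Set.indicator {x | M < HX m n ε η x} (fun _ => (1:ℝ)) ((aAct m n hm hn)^[t * (l + 1)] x) ≤ cnt w := by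
  obtain ⟨r, C, hr, hr1, hC, hh⟩ := height_thm hm hn hε hε1
  have hmp : (0:ℝ) < m := by exact_mod_cast hm
  have hnp : (0:ℝ) < n := by exact_mod_cast hn
  refine ⟨Real.log (2 ^ (m*n) * (2 + C)), fun t ht => ?_⟩
  set L : ℕ := ⌈Real.exp (lam m n * t)⌉₊ with hLdef
  have hL : Real.exp (lam m n * t) ≤ L := Nat.le_ceil _
  have hlam : 0 < lam m n := by unfold lam; positivity
  have hL2 : (L : ℝ) ≤ 2 * Real.exp (lam m n * t) := by
    have h1 := (Nat.ceil_lt_add_one (Real.exp_pos (lam m n * t)).le).le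
    have h2 : 1 ≤ Real.exp (lam m n * t) := Real.one_le_exp (by positivity)
    linarith
  obtain ⟨η, hη, hη1, hstep⟩ := hh t L (Nat.cast_nonneg t) hL
  refine ⟨η, (((m + n : ℕ) : ℝ) * 2) ^ (bexp m n ε) * (((m + n : ℕ) : ℝ) ^ (bexp m n ε) * Real.exp ((1 - ε) * t)), hη, ?_, fun k hk Q hQ hdis => ?_⟩
  rotate_left
  · obtain ⟨Z0, hZ, hN⟩ := cover_core hm hn hε1 hη hr hr1 hC ht hL hstep rfl hk Q hQ hdis
    refine ⟨Z0, hZ, fun N => ?_⟩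
    obtain ⟨W, iW, cnt, iota, h1, h2⟩ := hN N
    refine ⟨W, iW, cnt, iota, h1.trans ?_, fun x hx => ?_⟩
    · refine mul_le_mul_of_nonneg_left (pow_le_pow_left₀ (by positivity) ?_ _) hZ.le
      rw [Real.exp_add, Real.exp_log (by positivity)]
      have : (L:ℝ)^(m*n) ≤ 2 ^ (m*n) * Real.exp (((m:ℝ)+n) * t) := by
        calc (L:ℝ)^(m*n) ≤ (2 * Real.exp (lam m n * t))^(m*n) := by gcongr
          _ = 2 ^ (m*n) * Real.exp (((m:ℝ)+n) * t) := by
            rw [mul_pow, ← Real.exp_nat_mul]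
            congr 2
            unfold lam; push_cast; field_simp
            ring
      calc (L:ℝ)^(m*n) * (2 + C) ≤ (2 ^ (m*n) * Real.exp (((m:ℝ)+n) * t)) * (2 + C) := by gcongr
        _ = _ := by ring
    · obtain ⟨w, hw1, hw2⟩ := h2 x hx
      refine ⟨w, hw1, ?_⟩
      refine le_trans (le_of_eq ?_) (Nat.cast_le.2 hw2)
      push_cast
      refine Finset.sum_congr rfl fun l _ => ?_
      rw [Set.indicator_apply]
      simp only [Set.mem_ofPred_eq]
  · positivity

end KK

namespace KK

theorem gibbs {ι : Type*} [Fintype ι] (p q : ι → ℝ) (hp : ∀ i, 0 ≤ p i) (hq : ∀ i, 0 < q i) (hsp : ∑ i, p i = 1)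
    (hsq : ∑ i, q i ≤ 1) : ∑ i, Real.negMulLog (p i) ≤ ∑ i, p i * (- Real.log (q i)) := by
  have h : ∀ i, Real.negMulLog (p i) ≤ p i * (- Real.log (q i)) + (q i - p i) := by
    intro i
    rcases (hp i).eq_or_lt with h0 | h0
    · rw [← h0]; simp [(hq i).le]
    · have h1 := Real.log_le_sub_one_of_pos (div_pos (hq i) h0)
      rw [Real.log_div (hq i).ne' h0.ne'] at h1
      have h2 := mul_le_mul_of_nonneg_left h1 h0.le
      rw [mul_sub, mul_sub, mul_div_cancel₀ _ h0.ne'] at h2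
      rw [Real.negMulLog]
      linarith
  have h3 := Finset.sum_le_sum fun i (_ : i ∈ Finset.univ) => h i
  rw [Finset.sum_add_distrib, Finset.sum_sub_distrib] at h3
  linarith

open Classical in
theorem joinPart_mem {α : Type*} (T : α → α) {k : ℕ} (P : Fin k → Set α) (N : ℕ) (ω : Fin N → Fin k) (x : α) :
    x ∈ joinPart T P N ω ↔ ∀ j : Fin N, T^[(j:ℕ)] x ∈ P (ω j) := by
  simp [joinPart]

theorem join_part {α : Type*} [MeasurableSpace α] {T : α → α} (hT : Measurable T) {k : ℕ} {P : Fin k → Set α} (hP : IsFinPart P) (N : ℕ) :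
    (∀ ω, MeasurableSet (joinPart T P N ω)) ∧ Pairwise (Function.onFun Disjoint (joinPart T P N)) ∧ (⋃ ω, joinPart T P N ω) = Set.univ := by
  refine ⟨fun ω => MeasurableSet.iInter fun j => (hT.iterate _) (hP.1 _), ?_, ?_⟩
  · intro ω ω' hne
    obtain ⟨j, hj⟩ := Function.ne_iff.1 hne
    refine Set.disjoint_left.2 fun x hx hx' => ?_
    rw [joinPart_mem] at hx hx'
    exact Set.disjoint_left.1 (hP.2.1 hj) (hx j) (hx' j)
  · refine Set.eq_univ_of_forall fun x => ?_
    have : ∀ y, ∃ c, y ∈ P c := fun y => by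
      have : y ∈ ⋃ i, P i := by rw [hP.2.2]; trivial
      exact Set.mem_iUnion.1 this
    choose c hc using this
    exact Set.mem_iUnion.2 ⟨fun j => c (T^[(j:ℕ)] x), (joinPart_mem T P N _ x).2 fun j => hc _⟩

open Classical in
theorem ent_bound {α : Type*} [MeasurableSpace α] {T : α → α} {μ : Measure α} [IsProbabilityMeasure μ] (hT : MeasurePreserving T μ μ)
    {k : ℕ} (hk : 0 < k) {P : Fin k → Set α} (hP : IsFinPart P) {Q : Fin k → Set α} (hQm : ∀ c, MeasurableSet (Q c))
    (hQP : ∀ c, Q c ⊆ P c) {B : Set α} (hB : MeasurableSet B) (t N : ℕ) {s Z δ : ℝ} (hs : 0 ≤ s) (hZ : 1 ≤ Z) (hδ : 0 < δ) (hδ1 : δ < 1)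
    {W : Type} [Fintype W] (cnt : W → ℕ) (iota : W → ℕ → Fin k) (hsum : ∑ w, Real.exp (s * cnt w) ≤ Z)
    (hcov : ∀ x ∈ ⋃ c, Q c, ∃ w, (∀ i < t * N, ∀ c, T^[i] x ∈ Q c → iota w i = c) ∧
        ∑ l ∈ Finset.range N, Set.indicator B (fun _ => (1:ℝ)) (T^[t * (l + 1)] x) ≤ cnt w) :
    partEnt μ (joinPart T P (t * N)) ≤ Real.log 2 + Real.log Z + (μ.real (⋃ c, Q c)ᶜ) * ((t * N : ℕ) * Real.log k)
      + (t * N : ℕ) * (-Real.log (1 - δ)) + Real.log (k / δ) * ((t * N : ℕ) * μ.real (⋃ c, Q c)ᶜ) - s * (N * μ.real B)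
      + s * N * μ.real (⋃ c, Q c)ᶜ := by
  set n' := t * N with hn'
  set E : Set α := (⋃ c, Q c)ᶜ with hE
  have hEm : MeasurableSet E := (MeasurableSet.iUnion hQm).compl
  have hkp : (0:ℝ) < k := by exact_mod_cast hk
  have hk1 : (1:ℝ) ≤ k := by exact_mod_cast hk
  obtain ⟨hJm, hJd, hJu⟩ := join_part hT.measurable hP n'
  set J := joinPart T P n' with hJ
  let th : W → ℕ → Fin k → ℝ := fun w j c => (if c = iota w j then (1 - δ) else 0) + δ / k
  have hth : ∀ w j c, 0 < th w j c := fun w j c => by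
    have : 0 < δ / k := by positivity
    simp only [th]; split_ifs <;> linarith
  have hth1 : ∀ w j, ∑ c, th w j c = 1 := fun w j => by
    simp only [th]
    rw [Finset.sum_add_distrib, Finset.sum_ite_eq' Finset.univ]
    simp only [Finset.mem_univ, if_true, Finset.sum_const, Finset.card_univ, Fintype.card_fin, nsmul_eq_mul]
    field_simp; ring
  let q : (Fin n' → Fin k) → ℝ := fun ω => (1/2) * ((k:ℝ)^n')⁻¹ + (1/(2*Z)) * ∑ w, Real.exp (s * cnt w) * ∏ j : Fin n', th w j (ω j)
  have hZ0 : 0 < Z := by linarith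
  have hq2 : ∀ ω, ∀ w, (1/(2*Z)) * (Real.exp (s * cnt w) * ∏ j : Fin n', th w j (ω j)) ≤ q ω := by
    intro ω w
    have h1 : Real.exp (s * cnt w) * ∏ j : Fin n', th w j (ω j) ≤ ∑ w, Real.exp (s * cnt w) * ∏ j : Fin n', th w j (ω j) :=
      Finset.single_le_sum (f := fun w => Real.exp (s * cnt w) * ∏ j : Fin n', th w j (ω j))
        (fun w _ => mul_nonneg (Real.exp_pos _).le (Finset.prod_nonneg fun j _ => (hth w j (ω j)).le)) (Finset.mem_univ w)
    have h2 : (1/(2*Z)) * (Real.exp (s * cnt w) * ∏ j : Fin n', th w j (ω j)) ≤ (1/(2*Z)) * ∑ w, Real.exp (s * cnt w) * ∏ j : Fin n', th w j (ω j) := by gcongr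
    have h3 : 0 ≤ (1/2) * ((k:ℝ)^n')⁻¹ := by positivity
    simp only [q]; linarith
  have hq1 : ∀ ω, (1/2) * ((k:ℝ)^n')⁻¹ ≤ q ω := by
    intro ω
    have : 0 ≤ (1/(2*Z)) * ∑ w, Real.exp (s * cnt w) * ∏ j : Fin n', th w j (ω j) :=
      mul_nonneg (by positivity) (Finset.sum_nonneg fun w _ => mul_nonneg (Real.exp_pos _).le (Finset.prod_nonneg fun j _ => (hth w j (ω j)).le))
    simp only [q]; linarith
  have hq0 : ∀ ω, 0 < q ω := fun ω => lt_of_lt_of_le (by positivity) (hq1 ω)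
  have hqs : ∑ ω, q ω ≤ 1 := by
    simp only [q]
    rw [Finset.sum_add_distrib, ← Finset.mul_sum, ← Finset.mul_sum, Finset.sum_comm]
    have h1 : ∀ w, ∑ ω : Fin n' → Fin k, Real.exp (s * cnt w) * ∏ j : Fin n', th w j (ω j) = Real.exp (s * cnt w) := by
      intro w
      rw [← Finset.mul_sum]
      have := Finset.prod_univ_sum (fun _ : Fin n' => (Finset.univ : Finset (Fin k))) (fun j c => th w j c)
      rw [Fintype.piFinset_univ] at this
      rw [← this, Finset.prod_eq_one (fun (j : Fin n') _ => hth1 w j), mul_one]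
    rw [Finset.sum_congr rfl (fun w _ => h1 w)]
    have h2 : (1/(2*Z)) * ∑ w, Real.exp (s * cnt w) ≤ (1/(2*Z)) * Z := by gcongr
    have h3 : (1/(2*Z)) * Z = 1/2 := by field_simp
    have h4 : (1/2) * ∑ _ω : Fin n' → Fin k, ((k:ℝ)^n')⁻¹ = 1/2 := by
      simp only [Finset.sum_const, Finset.card_univ, Fintype.card_fun, Fintype.card_fin, nsmul_eq_mul, Nat.cast_pow]
      field_simp
    linarith
  have hps : ∑ ω, μ.real (J ω) = 1 := by
    have h1 : μ.real (⋃ ω, J ω) = ∑ ω, μ.real (J ω) := measureReal_iUnion_fintype hJd hJm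
    rw [← h1, hJu]; simp
  have hG := gibbs (fun ω => μ.real (J ω)) q (fun ω => measureReal_nonneg) hq0 hps hqs
  refine (show partEnt μ J ≤ _ from hG).trans ?_
  let ind : Set α → α → ℝ := fun S => S.indicator (fun _ => (1:ℝ))
  have hind : ∀ S x, ind S x = if x ∈ S then 1 else 0 := fun S x => Set.indicator_apply _ _ _
  let R : α → ℝ := fun x => Real.log 2 + Real.log Z + ind E x * (n' * Real.log k) + n' * (-Real.log (1 - δ)) +
    Real.log (k / δ) * ∑ j ∈ Finset.range n', ind E (T^[j] x) - s * ∑ l ∈ Finset.range N, ind B (T^[t * (l+1)] x) + s * N * ind E x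
  have hlZ : 0 ≤ Real.log Z := Real.log_nonneg hZ
  have hlk : 0 ≤ Real.log k := Real.log_nonneg hk1
  have hld : 0 ≤ -Real.log (1 - δ) := by
    have := Real.log_nonpos (x := 1 - δ) (by linarith) (by linarith); linarith
  have hlkd : 0 ≤ Real.log (k / δ) := Real.log_nonneg (by rw [le_div_iff₀ hδ]; linarith)
  have hind0 : ∀ S x, 0 ≤ ind S x := fun S x => by rw [hind]; split_ifs <;> simp
  have hind1 : ∀ S x, ind S x ≤ 1 := fun S x => by rw [hind]; split_ifs <;> simp
  have hpt : ∀ ω x, x ∈ J ω → - Real.log (q ω) ≤ R x := by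
    intro ω x hx
    rw [hJ, joinPart_mem] at hx
    by_cases hxE : x ∈ E
    · have h1 : Real.log ((1/2) * ((k:ℝ)^n')⁻¹) ≤ Real.log (q ω) := Real.log_le_log (by positivity) (hq1 ω)
      rw [Real.log_mul (by norm_num) (by positivity), Real.log_inv, Real.log_pow, one_div, Real.log_inv] at h1
      have h2 : ind E x = 1 := by rw [hind, if_pos hxE]
      have h3 : ∑ l ∈ Finset.range N, ind B (T^[t * (l+1)] x) ≤ N := by
        refine (Finset.sum_le_sum fun l _ => hind1 B _).trans ?_
        simp
      have h4 := mul_le_mul_of_nonneg_left h3 hs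
      have h5 : 0 ≤ Real.log (k / δ) * ∑ j ∈ Finset.range n', ind E (T^[j] x) :=
        mul_nonneg hlkd (Finset.sum_nonneg fun j _ => hind0 _ _)
      have h6 : 0 ≤ n' * (-Real.log (1 - δ)) := mul_nonneg (Nat.cast_nonneg _) hld
      simp only [R, h2]
      linarith
    · have h2 : ind E x = 0 := by rw [hind, if_neg hxE]
      have hxQ : x ∈ ⋃ c, Q c := by simpa [hE] using hxE
      obtain ⟨w, hw, hwc⟩ := hcov x hxQ
      have hprod : 0 < ∏ j : Fin n', th w j (ω j) := Finset.prod_pos fun j _ => hth _ _ _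
      have h1 : Real.log ((1/(2*Z)) * (Real.exp (s * cnt w) * ∏ j : Fin n', th w j (ω j))) ≤ Real.log (q ω) :=
        Real.log_le_log (by positivity) (hq2 ω w)
      rw [Real.log_mul (by positivity) (by positivity), Real.log_mul (by positivity) (by positivity), Real.log_exp, one_div, Real.log_inv,
        Real.log_mul (by norm_num) (by positivity), Real.log_prod (fun j _ => (hth _ _ _).ne')] at h1
      have h3 : ∀ j : Fin n', -Real.log (th w j (ω j)) ≤ -Real.log (1 - δ) + Real.log (k / δ) * ind E (T^[(j:ℕ)] x) := by
        intro j
        by_cases hjE : T^[(j:ℕ)] x ∈ E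
        · rw [hind, if_pos hjE, mul_one]
          have : δ / k ≤ th w j (ω j) := by simp only [th]; split_ifs <;> linarith
          have h5 := Real.log_le_log (by positivity) this
          have h6 : Real.log (δ / k) = - Real.log (k / δ) := by rw [← Real.log_inv, inv_div]
          linarith
        · rw [hind, if_neg hjE, mul_zero, add_zero]
          have hjQ : T^[(j:ℕ)] x ∈ ⋃ c, Q c := by simpa [hE] using hjE
          obtain ⟨c, hc⟩ := Set.mem_iUnion.1 hjQ
          have e1 : iota w j = c := hw j j.2 c hc
          have e2 : ω j = c := by
            by_contra hne
            exact Set.disjoint_left.1 (hP.2.1 hne) (hx j) (hQP c hc)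
          have : 1 - δ ≤ th w j (ω j) := by
            simp only [th]; rw [if_pos (e2.trans e1.symm)]
            have : 0 < δ / k := by positivity
            linarith
          have h5 := Real.log_le_log (by linarith) this
          linarith
      have h4 := Finset.sum_le_sum fun j (_ : j ∈ (Finset.univ : Finset (Fin n'))) => h3 j
      rw [Finset.sum_neg_distrib, Finset.sum_add_distrib, ← Finset.mul_sum, Finset.sum_const, Finset.card_univ, Fintype.card_fin, nsmul_eq_mul,
        Fin.sum_univ_eq_sum_range (fun j => ind E (T^[j] x)) n'] at h4
      have h5 := mul_le_mul_of_nonneg_left hwc hs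
      simp only [R, h2]
      have h6 : ∑ l ∈ Finset.range N, ind B (T^[t * (l+1)] x) = ∑ l ∈ Finset.range N, Set.indicator B (fun _ => (1:ℝ)) (T^[t * (l + 1)] x) := rfl
      rw [h6]
      linarith
  have hintS : ∀ S, MeasurableSet S → Integrable (ind S) μ := fun S hS => (integrable_const (1:ℝ)).indicator hS
  have hiS : ∀ S, MeasurableSet S → ∫ x, ind S x ∂μ = μ.real S := fun S hS => by
    simp only [ind]
    rw [integral_indicator_const _ hS]; simp
  have hcomp : ∀ S, MeasurableSet S → ∀ j, Integrable (fun x => ind S (T^[j] x)) μ := fun S hS j =>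
    (hT.iterate j).integrable_comp_of_integrable (hintS S hS)
  have hicomp : ∀ S, MeasurableSet S → ∀ j, ∫ x, ind S (T^[j] x) ∂μ = μ.real S := fun S hS j => by
    have e : (fun x => ind S (T^[j] x)) = ind (T^[j] ⁻¹' S) := by
      ext x; rw [hind, hind]; rfl
    rw [e, hiS _ ((hT.iterate j).measurable hS)]
    exact (hT.iterate j).measureReal_preimage hS.nullMeasurableSet
  have hI1 : Integrable (fun x => ∑ j ∈ Finset.range n', ind E (T^[j] x)) μ := integrable_finsetSum _ fun j _ => hcomp E hEm j
  have hI2 : Integrable (fun x => ∑ l ∈ Finset.range N, ind B (T^[t * (l+1)] x)) μ := integrable_finsetSum _ fun j _ => hcomp B hB _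
  have hRi : Integrable R μ := by
    refine Integrable.add (Integrable.sub (Integrable.add (Integrable.add (Integrable.add (integrable_const _) ?_) (integrable_const _)) ?_) ?_) ?_
    · exact (hintS E hEm).mul_const _
    · exact hI1.const_mul _
    · exact hI2.const_mul _
    · exact (hintS E hEm).const_mul _
  have hR : ∫ x, R x ∂μ = Real.log 2 + Real.log Z + (μ.real E) * (n' * Real.log k)
      + n' * (-Real.log (1 - δ)) + Real.log (k / δ) * (n' * μ.real E) - s * (N * μ.real B) + s * N * μ.real E := by
    simp only [R]
    rw [integral_add, integral_sub, integral_add, integral_add, integral_add, integral_mul_const, integral_const_mul, integral_const_mul, integral_const_mul,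
      integral_finsetSum _ (fun j _ => hcomp E hEm j), integral_finsetSum _ (fun j _ => hcomp B hB _)]
    · simp only [integral_const_mul, hiS E hEm, hicomp E hEm, hicomp B hB]
      simp
    all_goals first | exact integrable_const _ | exact (hintS E hEm).mul_const _ | skip
    · exact (integrable_const _).add ((hintS E hEm).mul_const _)
    · exact ((integrable_const _).add ((hintS E hEm).mul_const _)).add (integrable_const _)
    · exact hI1.const_mul _
    · exact (((integrable_const _).add ((hintS E hEm).mul_const _)).add (integrable_const _)).add (hI1.const_mul _)
    · exact hI2.const_mul _
    · exact ((((integrable_const _).add ((hintS E hEm).mul_const _)).add (integrable_const _)).add (hI1.const_mul _)).sub (hI2.const_mul _)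
    · exact (hintS E hEm).const_mul _
  rw [← hR]
  have hF : ∑ ω, μ.real (J ω) * (- Real.log (q ω)) = ∫ x, ∑ ω, ind (J ω) x * (- Real.log (q ω)) ∂μ := by
    rw [integral_finsetSum _ (fun ω _ => (hintS _ (hJm ω)).mul_const _)]
    refine Finset.sum_congr rfl fun ω _ => ?_
    rw [integral_mul_const, hiS _ (hJm ω)]
  rw [hF]
  refine integral_mono (integrable_finsetSum _ fun ω _ => (hintS _ (hJm ω)).mul_const _) hRi fun x => ?_
  have hx : x ∈ ⋃ ω, J ω := by rw [hJu]; trivial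
  obtain ⟨ω, hω⟩ := Set.mem_iUnion.1 hx
  simp only
  rw [Finset.sum_eq_single ω]
  · rw [hind, if_pos hω, one_mul]; exact hpt ω x hω
  · intro ω' _ hne
    rw [hind, if_neg, zero_mul]
    exact fun h => Set.disjoint_left.1 (hJd hne) h hω
  · intro h; exact absurd (Finset.mem_univ _) h

end KK

namespace KK

theorem ks_part {α : Type*} [MeasurableSpace α] {T : α → α} {μ : Measure α} [IsProbabilityMeasure μ] {h : ℝ} (hh : 0 ≤ h)
    (hlt : h < ksEntropy T μ) : ∃ (k : ℕ) (P : Fin k → Set α), IsFinPart P ∧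
      ∀ N : ℕ, 0 < N → h * N ≤ partEnt μ (joinPart T P N) := by
  unfold ksEntropy at hlt
  obtain ⟨k, hk⟩ := exists_lt_of_lt_ciSup hlt
  obtain ⟨P, hP⟩ := exists_lt_of_lt_ciSup hk
  by_cases hF : IsFinPart P
  · refine ⟨k, P, hF, fun N hN => ?_⟩
    rw [ciSup_pos hF] at hP
    obtain ⟨N', rfl⟩ : ∃ N', N = N' + 1 := ⟨N - 1, by omega⟩
    have hb : BddBelow (Set.range fun N : ℕ => partEnt μ (joinPart T P (N + 1)) / ((N:ℝ) + 1)) := by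
      refine ⟨0, ?_⟩
      rintro _ ⟨N, rfl⟩
      refine div_nonneg (Finset.sum_nonneg fun i _ => ?_) (by positivity)
      exact Real.negMulLog_nonneg ENNReal.toReal_nonneg (measureReal_le_one (μ := μ))
    have h1 := hP.le.trans (ciInf_le hb N')
    rw [le_div_iff₀ (by positivity)] at h1
    push_cast
    exact h1
  · have : IsEmpty (IsFinPart P) := ⟨hF⟩
    rw [Real.iSup_of_isEmpty] at hP
    linarith

theorem lin_bound {X K : ℝ} (h : ∀ N : ℕ, 0 < N → N * X ≤ K) : X ≤ 0 := by
  by_contra hX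
  push Not at hX
  obtain ⟨N, hN⟩ := exists_nat_gt (K / X)
  rw [div_lt_iff₀ hX] at hN
  have h1 := h (N+1) (by omega)
  push_cast at h1
  nlinarith

theorem part_bound {m n : ℕ} (hm : 0 < m) (hn : 0 < n) {ε : ℝ} (hε : 0 < ε) (hε1 : ε < 1) :
    ∃ C' : ℝ, ∀ t : ℕ, 0 < t → ∃ η M : ℝ, 0 < η ∧ 0 ≤ M ∧ ∀ (μ : Measure (XSp (m+n))) (_ : IsProbabilityMeasure μ)
      (hT : MeasurePreserving (aAct m n hm hn) μ μ) (h : ℝ) (hh : 0 ≤ h) (hlt : h < ksEntropy (aAct m n hm hn) μ),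
      h * t + (1 - ε) * t * μ.real {x | M < HX m n ε η x} ≤ ((m:ℝ)+n) * t + C' := by
  obtain ⟨C', hC⟩ := cover hm hn hε hε1
  refine ⟨|C'|, fun t ht => ?_⟩
  obtain ⟨η, M, hη, hM, hcov⟩ := hC t ht
  refine ⟨η, M, hη, hM, fun μ hμ hT h hh hlt => ?_⟩
  obtain ⟨k, P, hP, hent⟩ := ks_part hh hlt
  have htp : (0:ℝ) < t := by exact_mod_cast ht
  have hk : 0 < k := by
    rcases Nat.eq_zero_or_pos k with h0 | h0
    · subst h0
      have h1 := hP.2.2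
      have h2 : (QuotientGroup.mk 1 : XSp (m+n)) ∈ ⋃ i, P i := by rw [h1]; trivial
      obtain ⟨i, _⟩ := Set.mem_iUnion.1 h2
      exact i.elim0
    · exact h0
  have hk1 : (1:ℝ) ≤ k := by exact_mod_cast hk
  set B : Set (XSp (m+n)) := {x | M < HX m n ε η x} with hB
  have hBm : MeasurableSet B := (HX_open hm hn hη hε1 M hM).measurableSet
  refine le_of_forall_pos_le_add fun γ0 hγ0 => ?_
  obtain ⟨γ, hγ, hγ'⟩ : ∃ γ : ℝ, 0 < γ ∧ γ + t * γ ≤ γ0 :=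
    ⟨γ0 / (1 + t), by positivity, by rw [← one_add_mul, mul_div_cancel₀ _ (by positivity)]⟩
  set δ : ℝ := 1 - Real.exp (-γ) with hδdef
  have hδ : 0 < δ := by
    have : Real.exp (-γ) < 1 := Real.exp_lt_one_iff.2 (by linarith)
    linarith
  have hδ1 : δ < 1 := by
    have := Real.exp_pos (-γ)
    linarith
  have hlogδ : -Real.log (1 - δ) = γ := by
    rw [hδdef, _root_.sub_sub_cancel, Real.log_exp, neg_neg]
  set c : ℝ := t * Real.log k + Real.log (k / δ) * t + (1 - ε) * t with hc
  have hlk : 0 ≤ Real.log k := Real.log_nonneg hk1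
  have hlkd : 0 ≤ Real.log (k / δ) := Real.log_nonneg (by rw [le_div_iff₀ hδ]; linarith)
  have h1e : 0 < 1 - ε := by linarith
  have hc0 : 0 < c := by positivity
  have hkp : (0:ℝ) < k := by linarith
  have hap : ∀ i : Fin k, ∃ K ⊆ P i, IsCompact K ∧ μ (P i \ K) < ENNReal.ofReal (γ / c / k) := by
    intro i
    exact (hP.1 i).exists_isCompact_sdiff_lt (measure_ne_top _ _) (by
      rw [Ne, ENNReal.ofReal_eq_zero, not_le]; positivity)
  choose Q hQP hQc hQs using hap
  have hQm : ∀ i, MeasurableSet (Q i) := fun i => (hQc i).measurableSet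
  have he : μ.real (⋃ i, Q i)ᶜ ≤ γ / c := by
    have hsub : (⋃ i, Q i)ᶜ ⊆ ⋃ i, (P i \ Q i) := by
      intro x hx
      have h2 : x ∈ ⋃ i, P i := by rw [hP.2.2]; trivial
      obtain ⟨i, hi⟩ := Set.mem_iUnion.1 h2
      exact Set.mem_iUnion.2 ⟨i, hi, fun hq => hx (Set.mem_iUnion.2 ⟨i, hq⟩)⟩
    calc μ.real (⋃ i, Q i)ᶜ ≤ μ.real (⋃ i, (P i \ Q i)) := measureReal_mono hsub
      _ ≤ ∑ i, μ.real (P i \ Q i) := measureReal_iUnion_fintype_le _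
      _ ≤ ∑ i : Fin k, γ / c / k := by
        refine Finset.sum_le_sum fun i _ => ?_
        rw [Measure.real]
        exact ENNReal.toReal_le_of_le_ofReal (by positivity) (hQs i).le
      _ = γ / c := by simp; field_simp
  obtain ⟨Z0, hZ0, hN⟩ := hcov k hk Q hQc (fun i j hij => (hP.2.1 hij).mono (hQP i) (hQP j))
  set A : ℝ := ((m:ℝ)+n) * t + |C'| with hA
  have hA0 : 0 ≤ A := by positivity
  set e := μ.real (⋃ i, Q i)ᶜ with hedef
  set b := μ.real B with hb
  have key : h * t - A - e * c - t * γ + (1 - ε) * t * b ≤ 0 := by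
    refine lin_bound (K := Real.log 2 + Real.log (Z0 + 1)) fun N hNpos => ?_
    obtain ⟨W, iW, cnt, iota, hs, hcv⟩ := hN N
    have hE1 : (1:ℝ) ≤ Real.exp A ^ N := one_le_pow₀ (Real.one_le_exp hA0)
    have hZle : Z0 * Real.exp (((m:ℝ)+n) * t + C') ^ N ≤ (Z0 + 1) * Real.exp A ^ N := by
      refine mul_le_mul (by linarith) (pow_le_pow_left₀ (Real.exp_pos _).le (Real.exp_le_exp.2 ?_) _) (by positivity) (by linarith)
      have := le_abs_self C'
      linarith
    have hZ1 : 1 ≤ (Z0 + 1) * Real.exp A ^ N := by nlinarith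
    have hb2 := ent_bound hT hk hP hQm hQP hBm t N (s := (1 - ε) * t) (by positivity) hZ1 hδ hδ1 cnt iota (hs.trans hZle) hcv
    have hb1 := hent (t * N) (Nat.mul_pos ht hNpos)
    rw [Real.log_mul (by linarith) (by positivity), Real.log_pow, Real.log_exp, hlogδ] at hb2
    push_cast at hb1 hb2
    have := hb1.trans hb2
    rw [hc]
    linarith
  have hec : e * c ≤ γ := by rwa [le_div_iff₀ hc0] at he
  linarith
end KK

/-- **Theorem (KKLM).** For any `h > 0` and any sequence `(μ_k)` of `a`-invariant probability
measures on `X_{m+n}` with `h_{μ_k}(a) ≥ h`, any weak* limit `μ` of the sequence satisfies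
`μ(X_{m+n}) ≥ h - (m+n-1)`. -/
theorem thm_KKLM (m n : ℕ) (hm : 0 < m) (hn : 0 < n) (h : ℝ) (hh : 0 < h)
    (μ : ℕ → Measure (XSp (m + n)))
    (hprob : ∀ k, IsProbabilityMeasure (μ k))
    (hinv : ∀ k, MeasurePreserving (aAct m n hm hn) (μ k) (μ k))
    (hent : ∀ k, h ≤ ksEntropy (aAct m n hm hn) (μ k))
    (μlim : Measure (XSp (m + n))) (hfin : IsFiniteMeasure μlim)
    (φ : ℕ → ℕ) (hφ : StrictMono φ)
    (hconv : ∀ f : XSp (m + n) → ℝ, Continuous f → HasCompactSupport f →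
      Tendsto (fun k => ∫ x, f x ∂(μ (φ k))) atTop (𝓝 (∫ x, f x ∂μlim))) :
    h - ((m : ℝ) + n - 1) ≤ (μlim Set.univ).toReal := by
  set L : ℝ := (μlim Set.univ).toReal with hL
  have hL0 : 0 ≤ L := ENNReal.toReal_nonneg
  have main : ∀ h' : ℝ, 0 ≤ h' → h' < h → ∀ ε : ℝ, 0 < ε → ε < 1 →
      (1 - ε) * (1 - L) + h' - ((m:ℝ) + n) ≤ 0 := by
    intro h' hh' hlt ε hε hε1
    obtain ⟨C', hC⟩ := KK.part_bound hm hn hε hε1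
    refine KK.lin_bound (K := C') fun t ht => ?_
    have htp : (0:ℝ) < t := by exact_mod_cast ht
    obtain ⟨η, M, hη, hM, hb⟩ := hC t ht
    have hK := KK.HX_compact hm hn hη hε1 M hM
    have hBo := KK.HX_open hm hn hη hε1 M hM
    set K : Set (XSp (m+n)) := {x | KK.HX m n ε η x ≤ M} with hKdef
    have hKB : {x | M < KK.HX m n ε η x} = Kᶜ := by
      ext x; simp [hKdef]
    obtain ⟨f, hf1, -, hfc, hf01⟩ := exists_continuous_one_zero_of_isCompact hK isClosed_empty (Set.disjoint_empty _)
    have hlow : ∀ k, 1 - (((m:ℝ)+n) * t + C' - h' * t) / ((1 - ε) * t) ≤ ∫ x, f x ∂(μ (φ k)) := by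
      intro k
      have := hprob (φ k)
      have h1 := hb (μ (φ k)) inferInstance (hinv _) h' hh' (hlt.trans_le (hent _))
      rw [hKB, probReal_compl_eq_one_sub hK.measurableSet] at h1
      have h2 : (μ (φ k)).real K ≤ ∫ x, f x ∂(μ (φ k)) := by
        rw [← integral_indicator_one hK.measurableSet]
        refine integral_mono ((integrable_const 1).indicator hK.measurableSet) (f.continuous.integrable_of_hasCompactSupport hfc) fun x => ?_
        by_cases hx : x ∈ K
        · simp [hx, hf1 hx]
        · simp [hx, (hf01 x).1]
      refine le_trans ?_ h2
      have hp : 0 < (1 - ε) * t := mul_pos (by linarith) htp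
      rw [sub_le_comm, le_div_iff₀ hp]
      linarith
    have hup : ∫ x, f x ∂μlim ≤ L := by
      calc ∫ x, f x ∂μlim ≤ ∫ x, (1:ℝ) ∂μlim := 
            integral_mono (f.continuous.integrable_of_hasCompactSupport hfc) (integrable_const 1) fun x => (hf01 x).2
        _ = L := by simp [hL, Measure.real]
    have hfin := (ge_of_tendsto' (hconv f f.continuous hfc) hlow).trans hup
    have hp : 0 < (1 - ε) * t := mul_pos (by linarith) htp
    rw [sub_le_comm, le_div_iff₀ hp] at hfin
    linarith
  have main2 : ∀ h' : ℝ, 0 ≤ h' → h' < h → h' ≤ (m:ℝ) + n - 1 + L := by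
    intro h' hh' hlt
    refine le_of_forall_pos_le_add fun γ hγ => ?_
    have h1 := main h' hh' hlt (min γ (1/2)) (by positivity) (lt_of_le_of_lt (min_le_right _ _) (by norm_num))
    have h2 := min_le_left γ (1/2)
    have h3 : 0 < min γ (1/2) := by positivity
    nlinarith
  have : h ≤ (m:ℝ) + n - 1 + L := by
    refine le_of_forall_lt_imp_le_of_dense fun a ha => ?_
    exact (le_max_left a 0).trans (main2 _ (le_max_right _ _) (max_lt ha hh))
  linarith
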